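/- (Major arc approximation of exponential sums.) Let k ∈ ℕ, Γ ⊆ ℕ_0^k∖{0} nonempty finite, k', k'' ∈ {0,…,k} with k' + k'' = k, N ∈ ℕ, and let Ω ⊆ B(0,N) ⊂ ℝ^k be a convex set or a Boolean combination of finitely many convex sets. Let 𝒦 : ℝ^k → ℂ be continuous and supported in Ω. Then for each β > 0 there is c = c_β > 0 such that for any q ∈ ℕ with 1 ≤ q ≤ (log N)^β, a ∈ A_q^Γ, and ξ = a/q + θ ∈ ℝ^Γ: | Σ_{(n,p)∈ℤ^{k'}×(±ℙ)^{k''}} e(ξ·𝒬(n,p)) 𝒦(n,p) Π_{i=1}^{k''} log|p_i| − G(a/q) ∫_Ω e((ξ − a/q)·𝒬(t)) 𝒦(t) dt | ≲ [ N^{k−1} ‖𝒦‖_{L^∞(Ω)} (1 + Σ_{γ∈Γ} |θ_γ| N^{|γ|}) + N^k sup_{x,y∈Ω, |x−y| ≤ q√k} |𝒦(x) − 𝒦(y)| ] · N exp(−c √(log N)), with implicit constant independent of N, a, q, ξ, and 𝒦. -/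

import Mathlib

open MeasureTheory
open scoped ENNReal NNReal

noncomputable section

/-- Embedding of `ℤ^k` into Euclidean space `ℝ^k`. -/
def zEmbed {k : ℕ} (v : Fin k → ℤ) : EuclideanSpace ℝ (Fin k) :=
  WithLp.toLp 2 fun i => (v i : ℝ)

/-- `e(x) = e^{2πix}`. -/
def eC (x : ℝ) : ℂ := Complex.exp (2 * Real.pi * Complex.I * x)

/-- The weight `𝟙_{(n,p) ∈ ℤ^{k'} × (±ℙ)^{k''}} ∏_{i ≥ k'} log |p_i|`. -/
def primeWeight {k : ℕ} (k' : ℕ) (v : Fin k → ℤ) : ℝ :=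
  Set.indicator {w : Fin k → ℤ | ∀ i : Fin k, k' ≤ (i : ℕ) → Prime (w i)} (fun _ => 1) v *
    ∏ i : Fin k, if k' ≤ (i : ℕ) then Real.log |(v i : ℝ)| else 1

/-- The pairing `ξ · 𝒬(v)` for `v ∈ ℤ^k`. -/
def qPair {k : ℕ} (Γ : Finset (Fin k → ℕ)) (ξ : (Fin k → ℕ) → ℝ) (v : Fin k → ℤ) : ℝ :=
  ∑ γ ∈ Γ, ξ γ * ∏ i, ((v i : ℝ)) ^ (γ i)

/-- The pairing `θ · 𝒬(u)` for `u ∈ ℝ^k`. -/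
def qPairR {k : ℕ} (Γ : Finset (Fin k → ℕ)) (θ : (Fin k → ℕ) → ℝ)
    (u : EuclideanSpace ℝ (Fin k)) : ℝ :=
  ∑ γ ∈ Γ, θ γ * ∏ i, (u i) ^ (γ i)

/-- The Gaussian sum `G(a/q)` associated with the canonical polynomial mapping. -/
def gaussSumQ {k : ℕ} (Γ : Finset (Fin k → ℕ)) (k' k'' : ℕ) (q : ℕ)
    (a : (Fin k → ℕ) → ℕ) : ℂ :=
  ((q : ℂ) ^ k' * (Nat.totient q : ℂ) ^ k'')⁻¹ *
    ∑ v ∈ Fintype.piFinset (fun i : Fin k =>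
        if (i : ℕ) < k' then Finset.Icc 1 q
        else (Finset.Icc 1 q).filter fun m => Nat.Coprime m q),
      eC (∑ γ ∈ Γ, ((a γ : ℝ) / (q : ℝ)) * ∏ i, (v i : ℝ) ^ (γ i))

/-- Boolean combinations of finitely many convex sets. -/
inductive IsBooleanCombConvex {E : Type*} [AddCommMonoid E] [Module ℝ E] : Set E → Prop
  | of (s : Set E) : Convex ℝ s → IsBooleanCombConvex s
  | compl (s : Set E) : IsBooleanCombConvex s → IsBooleanCombConvex sᶜ
  | union (s t : Set E) : IsBooleanCombConvex s → IsBooleanCombConvex t →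
      IsBooleanCombConvex (s ∪ t)

end

namespace SW

lemma logDeriv_bound_zero_free {F : ℂ → ℂ} {r M : ℝ} (hr : 0 < r) (hM : 0 < M)
    (hF : DifferentiableOn ℂ F (Metric.ball 0 r))
    (h0 : ∀ z ∈ Metric.ball (0:ℂ) r, F z ≠ 0)
    (hb : ∀ z ∈ Metric.ball (0:ℂ) r, ‖F z‖ ≤ Real.exp M * ‖F 0‖)
    {z : ℂ} (hz : ‖z‖ ≤ 3 / 4 * r) : ‖deriv F z / F z‖ ≤ 112 * M / r := by
  have hd : DifferentiableOn ℂ (deriv F) (Metric.ball 0 r) := hF.deriv Metric.isOpen_ball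
  have hq : DifferentiableOn ℂ (fun z => deriv F z / F z) (Metric.ball 0 r) := hd.div hF h0
  obtain ⟨h, hh0, hh⟩ := (hq.isExactOn_ball).with_val_at 0 0
  have hzero : (0:ℂ) ∈ Metric.ball (0:ℂ) r := Metric.mem_ball_self hr
  have hhd : DifferentiableOn ℂ h (Metric.ball 0 r) := fun w hw => (hh w hw).differentiableAt.differentiableWithinAt
  have hexp : ∀ w ∈ Metric.ball (0:ℂ) r, Complex.exp (h w) * F 0 = F w := by
    -- derivative of F * exp(-h) is zero
    have key : ∀ w ∈ Metric.ball (0:ℂ) r, HasDerivAt (fun w => F w * Complex.exp (-h w)) 0 w := by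
      intro w hw
      have h1 := (hF.differentiableAt (Metric.isOpen_ball.mem_nhds hw)).hasDerivAt
      have h2 := (hh w hw).neg.cexp
      have h3 := h1.mul h2
      have := h0 w hw
      have e : F w * (deriv F w / F w) = deriv F w := by field_simp
      refine h3.congr_deriv ?_
      simp only [Pi.neg_apply]
      linear_combination -(Complex.exp (-h w)) * e
    intro w hw
    have hc := (convex_ball (0:ℂ) r).is_const_of_fderivWithin_eq_zero (𝕜 := ℂ)
      (f := fun w => F w * Complex.exp (-h w))
      (fun x hx => (key x hx).differentiableAt.differentiableWithinAt)
      (fun x hx => by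
        rw [fderivWithin_of_isOpen Metric.isOpen_ball hx]
        ext
        have := (key x hx).deriv
        simpa using this) hw hzero
    simp only [hh0, neg_zero, Complex.exp_zero, mul_one] at hc
    rw [← hc, mul_comm, mul_assoc, ← Complex.exp_add]; simp
  have hF0 : 0 < ‖F 0‖ := norm_pos_iff.2 (h0 0 hzero)
  have hre : Set.MapsTo h (Metric.ball 0 r) {z | z.re ≤ M} := by
    intro w hw
    have h1 := hb w hw
    rw [← hexp w hw, norm_mul, Complex.norm_exp] at h1
    have := le_of_mul_le_mul_right h1 hF0
    exact Real.exp_le_exp.1 this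
  have hzb : z ∈ Metric.ball (0:ℂ) r := by simp; linarith
  have hder : deriv h z = deriv F z / F z := (hh z hzb).deriv
  rw [← hder]
  have hsub : Metric.closedBall z (r/8) ⊆ Metric.ball 0 r := by
    intro w hw
    simp only [Metric.mem_closedBall, dist_eq_norm, Metric.mem_ball, sub_zero] at *
    have : ‖w‖ ≤ ‖w - z‖ + ‖z‖ := by simpa using norm_add_le (w - z) z
    linarith
  have hcb : DiffContOnCl ℂ h (Metric.ball z (r/8)) :=
    (hhd.mono ((Metric.closure_ball_subset_closedBall).trans hsub)).diffContOnCl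
  have := Complex.norm_deriv_le_of_forall_mem_sphere_norm_le (C := 14 * M) (by positivity : 0 < r/8) hcb (by
    intro w hw
    have hwb := hsub (Metric.sphere_subset_closedBall hw)
    have h2 := Complex.borelCaratheodory_zero hM hhd hre hr hwb hh0
    have : ‖w‖ ≤ 7/8 * r := by
      simp only [mem_sphere_iff_norm] at hw
      have : ‖w‖ ≤ ‖w - z‖ + ‖z‖ := by simpa using norm_add_le (w - z) z
      linarith
    refine h2.trans ?_
    rw [div_le_iff₀ (by linarith)]
    nlinarith)
  refine this.trans (le_of_eq ?_)
  field_simp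
  norm_num

/-- dividing out one zero with a Blaschke factor. -/
lemma blaschke_step {F : ℂ → ℂ} (hF : Differentiable ℂ F) {R B : ℝ} (hR : 0 < R)
    (hb : ∀ z, ‖z‖ ≤ R → ‖F z‖ ≤ B) (h0 : F 0 ≠ 0) {ρ : ℂ} (hρ : F ρ = 0) (hρR : ‖ρ‖ < R) :
    ∃ F1 : ℂ → ℂ, Differentiable ℂ F1 ∧ (∀ z, ‖z‖ ≤ R → ‖F1 z‖ ≤ B) ∧
      ‖F1 0‖ = ‖F 0‖ * (R / ‖ρ‖) ∧ (∀ z, ‖z‖ < R → F1 z = 0 → F z = 0) ∧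
      -(deriv F 0 / F 0).re = -(deriv F1 0 / F1 0).re + ρ.re * (1 / ‖ρ‖^2 - 1 / R^2) := by
  have hρ0 : ρ ≠ 0 := by rintro rfl; exact h0 hρ
  have hρn : 0 < ‖ρ‖ := norm_pos_iff.2 hρ0
  have hRC : (R:ℂ) ≠ 0 := by exact_mod_cast hR.ne'
  set g := dslope F ρ with hg
  have hgd : Differentiable ℂ g := by
    have := (Complex.differentiableOn_dslope (s := Set.univ) (c := ρ) (f := F) Filter.univ_mem).2
      hF.differentiableOn
    exact differentiableOn_univ.1 this
  have hFg : ∀ z, F z = (z - ρ) * g z := by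
    intro z
    have := sub_smul_dslope F ρ z
    rw [hρ, sub_zero, smul_eq_mul] at this
    exact this.symm
  set b : ℂ → ℂ := fun z => R - (starRingEnd ℂ) ρ * z / R with hbdef
  have hbd : Differentiable ℂ b := by rw [hbdef]; fun_prop
  have hbnorm : ∀ z, ‖z‖ = R → ‖b z‖ = ‖z - ρ‖ := by
    intro z hz
    have hz0 : z ≠ 0 := norm_pos_iff.1 (hz ▸ hR)
    have e1 : b z = z / R * (starRingEnd ℂ) (z - ρ) := by
      have : (starRingEnd ℂ) z * z = R^2 := by
        rw [mul_comm, Complex.mul_conj, Complex.normSq_eq_norm_sq, hz]; push_cast; ring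
      simp only [hbdef, map_sub]
      field_simp
      linear_combination -this
    rw [e1, norm_mul, norm_div, hz, RCLike.norm_conj]
    simp [abs_of_pos hR, hR.ne']
  have hg0 : g 0 ≠ 0 := by
    intro h; apply h0; rw [hFg 0, h, mul_zero]
  have hb0 : b 0 = R := by simp [hbdef]
  refine ⟨fun z => g z * b z, hgd.mul hbd, ?_, ?_, ?_, ?_⟩
  · intro z hz
    have := Complex.norm_le_of_forall_mem_frontier_norm_le (U := Metric.ball (0:ℂ) R) (C := B)
      (f := fun z => g z * b z) Metric.isBounded_ball (hgd.mul hbd).diffContOnCl (by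
        intro w hw
        rw [frontier_ball _ hR.ne', mem_sphere_zero_iff_norm] at hw
        rw [norm_mul, hbnorm w hw, mul_comm, ← norm_mul, ← hFg]
        exact hb w hw.le) (z := z) (by rw [closure_ball _ hR.ne']; simpa using hz)
    exact this
  · simp only [hb0, norm_mul, hFg 0, zero_sub, norm_neg]
    rw [Complex.norm_real, Real.norm_eq_abs, abs_of_pos hR]
    field_simp
  · intro z hz h
    rcases mul_eq_zero.1 h with h | h
    · rw [hFg, h, mul_zero]
    · exfalso
      have : (starRingEnd ℂ) ρ * z = R^2 := by
        simp only [hbdef] at h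
        field_simp at h
        linear_combination -h
      have h2 := congrArg norm this
      rw [norm_mul, RCLike.norm_conj, norm_pow, Complex.norm_real, Real.norm_eq_abs, abs_of_pos hR] at h2
      nlinarith [norm_nonneg z]
  · have d1 : deriv F 0 = g 0 - ρ * deriv g 0 := by
      have : F = fun z => (z - ρ) * g z := funext hFg
      have h3 : HasDerivAt (fun z => (z - ρ) * g z) (1 * g 0 + (0 - ρ) * deriv g 0) 0 :=
        ((hasDerivAt_id (0:ℂ)).sub_const ρ).mul hgd.differentiableAt.hasDerivAt
      rw [this, h3.deriv]; ring
    have d2 : deriv (fun z => g z * b z) 0 = deriv g 0 * R + g 0 * (-(starRingEnd ℂ) ρ / R) := by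
      have hb' : HasDerivAt b (-(starRingEnd ℂ) ρ / R) 0 := by
        have := (((hasDerivAt_id (0:ℂ)).const_mul ((starRingEnd ℂ) ρ)).div_const (R:ℂ)).const_sub (R:ℂ)
        exact this.congr_deriv (by ring)
      have := (hgd.differentiableAt (x := (0:ℂ))).hasDerivAt.mul hb'
      have h5 := this.deriv
      rw [hb0] at h5; exact h5
    rw [d1, d2, hFg 0]
    simp only [hb0]
    have e1 : (g 0 - ρ * deriv g 0) / ((0 - ρ) * g 0) = - ρ⁻¹ + deriv g 0 / g 0 := by field_simp; ring
    have e2 : (deriv g 0 * R + g 0 * (-(starRingEnd ℂ) ρ / R)) / (g 0 * R) =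
      deriv g 0 / g 0 - (starRingEnd ℂ) ρ / ((R^2 : ℝ) : ℂ) := by push_cast; field_simp; ring
    rw [e1, e2, Complex.add_re, Complex.sub_re, Complex.neg_re, Complex.inv_re, Complex.div_ofReal_re,
      Complex.conj_re, Complex.normSq_eq_norm_sq]
    ring

lemma neg_logDeriv_le_aux {R r B : ℝ} (hr : 0 < r) (hrR : r < R) (n : ℕ) :
    ∀ {F : ℂ → ℂ} {M : ℝ}, Differentiable ℂ F → 0 < M → F 0 ≠ 0 →
    (∀ z, ‖z‖ ≤ R → ‖F z‖ ≤ B) → B ≤ Real.exp M * ‖F 0‖ → (∀ z, ‖z‖ < R → F z = 0 → z.re ≤ 0) →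
    B < ‖F 0‖ * (R / r)^n → -(deriv F 0 / F 0).re ≤ 112 * M / r := by
  have hR : 0 < R := hr.trans hrR
  induction n with
  | zero =>
    intro F M hF hM h0 hb hB hz hn
    have := hb 0 (by simpa using hR.le)
    simp at hn; linarith
  | succ n ih =>
    intro F M hF hM h0 hb hB hz hn
    by_cases hex : ∃ ρ, ‖ρ‖ < r ∧ F ρ = 0
    · obtain ⟨ρ, hρr, hρ⟩ := hex
      have hρn : 0 < ‖ρ‖ := by
        rw [norm_pos_iff]; rintro rfl; exact h0 hρ
      obtain ⟨F1, hF1, hb1, hn1, hz1, hd⟩ := blaschke_step hF hR hb h0 hρ (hρr.trans hrR)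
      have hF0 : 0 < ‖F 0‖ := norm_pos_iff.2 h0
      have hge : ‖F 0‖ * (R / r) ≤ ‖F1 0‖ := by
        rw [hn1]; gcongr
      have hge1 : ‖F 0‖ ≤ ‖F1 0‖ := by
        refine le_trans ?_ hge
        have : 1 ≤ R / r := by rw [le_div_iff₀ hr]; linarith
        nlinarith
      have := ih (F := F1) (M := M) hF1 hM (norm_pos_iff.1 (hF0.trans_le hge1)) hb1
        (hB.trans (by gcongr)) (fun z hzz h => hz z hzz (hz1 z hzz h))
        (hn.trans_le (by rw [pow_succ, mul_comm ((R/r)^n), ← mul_assoc]; gcongr))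
      rw [hd]
      have h1 : ρ.re ≤ 0 := hz ρ (hρr.trans hrR) hρ
      have h2 : 0 ≤ 1 / ‖ρ‖^2 - 1/R^2 := by
        rw [sub_nonneg]
        apply one_div_le_one_div_of_le (by positivity)
        gcongr; linarith
      nlinarith
    · push Not at hex
      have := logDeriv_bound_zero_free (F := F) (z := 0) hr hM hF.differentiableOn
        (fun z hz => hex z (by simpa using hz))
        (fun z hz => (hb z (by have : ‖z‖ < r := by simpa using hz
                               linarith)).trans hB) (by simp; positivity)
      refine le_trans ?_ this
      exact (neg_le_abs _).trans (Complex.abs_re_le_norm _)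

lemma neg_logDeriv_le_zero {R M : ℝ} (hR : 0 < R) {F : ℂ → ℂ} (hF : Differentiable ℂ F) (hM : 0 < M)
    (h0 : F 0 ≠ 0) (hb : ∀ z, ‖z‖ ≤ R → ‖F z‖ ≤ Real.exp M * ‖F 0‖)
    (hz : ∀ z, ‖z‖ < R → F z = 0 → z.re ≤ 0) : -(deriv F 0 / F 0).re ≤ 224 * M / R := by
  obtain ⟨n, hn⟩ := pow_unbounded_of_one_lt (Real.exp M) (by norm_num : (1:ℝ) < 2)
  have hF0 : 0 < ‖F 0‖ := norm_pos_iff.2 h0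
  have := neg_logDeriv_le_aux (R := R) (r := R/2) (by positivity) (by linarith) n hF hM h0 hb le_rfl hz
    (by
      have : R / (R/2) = 2 := by field_simp
      rw [this]; nlinarith)
  refine this.trans (le_of_eq ?_)
  field_simp; norm_num

lemma neg_logDeriv_le {R M : ℝ} (hR : 0 < R) {f : ℂ → ℂ} (hf : Differentiable ℂ f) (hM : 0 < M) {s : ℂ}
    (h0 : f s ≠ 0) (hb : ∀ z, ‖z - s‖ ≤ R → ‖f z‖ ≤ Real.exp M * ‖f s‖)
    (hz : ∀ z, ‖z - s‖ < R → f z = 0 → z.re ≤ s.re) : -(deriv f s / f s).re ≤ 224 * M / R := by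
  have := neg_logDeriv_le_zero (F := fun z => f (z + s)) hR (by fun_prop) hM (by simpa using h0)
    (fun z hz => by simpa using hb (z + s) (by simpa using hz))
    (fun z hzz h => by simpa using hz (z + s) (by simpa using hzz) h)
  rw [deriv_comp_add_const] at this
  simpa using this

/-- with a zero extracted -/
lemma neg_logDeriv_le_of_zero {R M : ℝ} (hR : 0 < R) {f : ℂ → ℂ} (hf : Differentiable ℂ f) (hM : 0 < M) {s : ℂ}
    (h0 : f s ≠ 0) (hb : ∀ z, ‖z - s‖ ≤ R → ‖f z‖ ≤ Real.exp M * ‖f s‖)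
    (hz : ∀ z, ‖z - s‖ < R → f z = 0 → z.re ≤ s.re) {ρ : ℂ} (hρ : f ρ = 0) (hρR : ‖ρ - s‖ < R) :
    -(deriv f s / f s).re ≤ 224 * M / R - (s.re - ρ.re) * (1 / ‖ρ - s‖^2 - 1 / R^2) := by
  set F : ℂ → ℂ := fun z => f (z + s)
  have hF : Differentiable ℂ F := by fun_prop
  have hF0' : F 0 ≠ 0 := by simpa [F] using h0
  have hF0 : 0 < ‖F 0‖ := norm_pos_iff.2 hF0'
  have hρs : ρ - s ≠ 0 := by
    intro h; rw [sub_eq_zero] at h; exact h0 (h ▸ hρ)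
  have hρn := norm_pos_iff.2 hρs
  obtain ⟨F1, hF1, hb1, hn1, hz1, hd⟩ := blaschke_step (F := F) (ρ := ρ - s) hF hR
    (fun z hz => hb (z + s) (by simpa using hz)) hF0' (by simpa [F] using hρ) hρR
  have hge1 : ‖F 0‖ ≤ ‖F1 0‖ := by
    rw [hn1]
    have : 1 ≤ R / ‖ρ - s‖ := by rw [le_div_iff₀ hρn]; linarith
    nlinarith
  have := neg_logDeriv_le_zero (F := F1) hR hF1 hM (norm_pos_iff.1 (hF0.trans_le hge1))
    (fun z hz => (hb1 z hz).trans (by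
      have : ‖f s‖ = ‖F 0‖ := by simp [F]
      rw [this]; gcongr))
    (fun z hzz h => by simpa using hz (z + s) (by simpa using hzz) (hz1 z hzz h))
  have e : deriv F 0 / F 0 = deriv f s / f s := by
    simp only [F]; rw [deriv_comp_add_const]; simp
  rw [← e, hd]
  simp only [Complex.sub_re]
  linarith

lemma norm_logDeriv_le {r M : ℝ} (hr : 0 < r) {f : ℂ → ℂ} (hf : Differentiable ℂ f) (hM : 0 < M) {s z : ℂ}
    (h0 : ∀ z, ‖z - s‖ < r → f z ≠ 0) (hb : ∀ z, ‖z - s‖ < r → ‖f z‖ ≤ Real.exp M * ‖f s‖)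
    (hz : ‖z - s‖ ≤ 3 / 4 * r) : ‖deriv f z / f z‖ ≤ 112 * M / r := by
  have := logDeriv_bound_zero_free (F := fun z => f (z + s)) (z := z - s) hr hM
    (Differentiable.differentiableOn (by fun_prop))
    (fun z hz => h0 (z + s) (by simpa using hz))
    (fun z hz => by simpa using hb (z + s) (by simpa using hz)) hz
  rw [deriv_comp_add_const] at this
  simpa using this

end SW

namespace SW

noncomputable def errE (f : ℕ → ℂ) (κ : ℂ) : ℝ → ℂ :=
  Set.indicator (Set.Ioi 1) (fun t => (∑ k ∈ Finset.Icc 1 ⌊t⌋₊, f k) - κ * t)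

lemma measurable_errE (f : ℕ → ℂ) (κ : ℂ) : Measurable (errE f κ) := by
  refine Measurable.indicator ?_ measurableSet_Ioi
  refine Measurable.sub ?_ (by fun_prop)
  exact (measurable_from_nat (f := fun n => ∑ k ∈ Finset.Icc 1 n, f k)).comp Nat.measurable_floor

lemma norm_errE_le {f : ℕ → ℂ} {κ : ℂ} {K b : ℝ} (hK : 0 ≤ K)
    (h : ∀ t : ℝ, 1 < t → ‖(∑ k ∈ Finset.Icc 1 ⌊t⌋₊, f k) - κ * t‖ ≤ K * t ^ b) (t : ℝ) (ht : 0 < t) :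
    ‖errE f κ t‖ ≤ K * t ^ b := by
  unfold errE
  by_cases h1 : 1 < t
  · rw [Set.indicator_of_mem (by exact h1)]; exact h t h1
  · rw [Set.indicator_of_notMem (by simpa using h1), norm_zero]; positivity

lemma errE_loc {f : ℕ → ℂ} {κ : ℂ} {K b : ℝ} (hK : 0 ≤ K)
    (h : ∀ t : ℝ, 1 < t → ‖(∑ k ∈ Finset.Icc 1 ⌊t⌋₊, f k) - κ * t‖ ≤ K * t ^ b) :
    LocallyIntegrableOn (errE f κ) (Set.Ioi 0) := by
  have h1 : LocallyIntegrableOn (fun t : ℝ => K * t ^ b) (Set.Ioi 0) := by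
    apply ContinuousOn.locallyIntegrableOn _ measurableSet_Ioi
    intro t ht
    exact (continuousAt_const.mul (Real.continuousAt_rpow_const t b (Or.inl (ne_of_gt ht)))).continuousWithinAt
  intro x hx
  obtain ⟨s, hs, hi⟩ := h1 x hx
  refine ⟨s ∩ Set.Ioi 0, Filter.inter_mem hs self_mem_nhdsWithin, ?_⟩
  have hi' : IntegrableOn (fun t : ℝ => K * t ^ b) (s ∩ Set.Ioi 0) := hi.mono_set Set.inter_subset_left
  have hpos : ∀ᵐ t ∂(volume.restrict (s ∩ Set.Ioi 0)), t ∈ Set.Ioi (0:ℝ) := by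
    have : ∀ᵐ t ∂(volume.restrict (Set.Ioi (0:ℝ))), t ∈ Set.Ioi (0:ℝ) := ae_restrict_mem measurableSet_Ioi
    exact ae_mono (Measure.restrict_mono Set.inter_subset_right le_rfl) this
  refine hi'.mono' (measurable_errE f κ).aestronglyMeasurable ?_
  filter_upwards [hpos] with t ht
  exact norm_errE_le hK h t ht

lemma errE_top {f : ℕ → ℂ} {κ : ℂ} {K b : ℝ} (hK : 0 ≤ K)
    (h : ∀ t : ℝ, 1 < t → ‖(∑ k ∈ Finset.Icc 1 ⌊t⌋₊, f k) - κ * t‖ ≤ K * t ^ b) :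
    (errE f κ) =O[Filter.atTop] (fun t : ℝ => t ^ (-(-b))) := by
  apply Asymptotics.IsBigO.of_bound K
  filter_upwards [Filter.eventually_gt_atTop 0] with t ht
  rw [neg_neg, Real.norm_of_nonneg (Real.rpow_nonneg ht.le b)]
  exact norm_errE_le hK h t ht

lemma errE_bot {f : ℕ → ℂ} {κ : ℂ} (b : ℝ) :
    (errE f κ) =O[nhdsWithin 0 (Set.Ioi 0)] (fun t : ℝ => t ^ (-b)) := by
  apply Asymptotics.IsBigO.of_bound 1
  have : ∀ᶠ t in nhdsWithin (0:ℝ) (Set.Ioi 0), t < 1 :=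
    nhdsWithin_le_nhds (eventually_lt_nhds (by norm_num))
  filter_upwards [this] with t ht
  unfold errE
  rw [Set.indicator_of_notMem (by simpa using ht.le), norm_zero]; positivity

lemma errE_conv {f : ℕ → ℂ} {κ : ℂ} {K b : ℝ} (hK : 0 ≤ K)
    (h : ∀ t : ℝ, 1 < t → ‖(∑ k ∈ Finset.Icc 1 ⌊t⌋₊, f k) - κ * t‖ ≤ K * t ^ b) {s : ℂ} (hs : b < s.re) :
    MellinConvergent (errE f κ) (-s) :=
  mellinConvergent_of_isBigO_rpow (errE_loc hK h) (errE_top hK h) (by simpa using hs)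
    (errE_bot (-s.re - 1)) (by simp)

lemma errE_diff {f : ℕ → ℂ} {κ : ℂ} {K b : ℝ} (hK : 0 ≤ K)
    (h : ∀ t : ℝ, 1 < t → ‖(∑ k ∈ Finset.Icc 1 ⌊t⌋₊, f k) - κ * t‖ ≤ K * t ^ b) {s : ℂ} (hs : b < s.re) :
    DifferentiableAt ℂ (fun s => mellin (errE f κ) (-s)) s := by
  have := mellin_differentiableAt_of_isBigO_rpow (s := -s) (errE_loc hK h) (errE_top hK h)
    (by simpa using hs) (errE_bot (-s.re - 1)) (by simp)
  exact this.comp s differentiableAt_id.neg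

lemma errE_mellin_eq (f : ℕ → ℂ) (κ : ℂ) (s : ℂ) :
    mellin (errE f κ) (-s) =
      ∫ t in Set.Ioi (1:ℝ), ((∑ k ∈ Finset.Icc 1 ⌊t⌋₊, f k) - κ * t) * (t:ℂ) ^ (-(s+1)) := by
  unfold mellin errE
  have e : ∀ t : ℝ, (t:ℂ) ^ (-s - 1) • (Set.indicator (Set.Ioi 1) (fun t : ℝ => (∑ k ∈ Finset.Icc 1 ⌊t⌋₊, f k) - κ * t) t)
    = Set.indicator (Set.Ioi 1) (fun t : ℝ => ((∑ k ∈ Finset.Icc 1 ⌊t⌋₊, f k) - κ * t) * (t:ℂ) ^ (-(s+1))) t := by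
    intro t
    by_cases ht : t ∈ Set.Ioi (1:ℝ)
    · rw [Set.indicator_of_mem ht, Set.indicator_of_mem ht, smul_eq_mul, mul_comm, neg_add']
    · rw [Set.indicator_of_notMem ht, Set.indicator_of_notMem ht, smul_zero]
  simp_rw [e]
  rw [setIntegral_indicator measurableSet_Ioi]
  congr 2
  ext x; simp

lemma errE_norm {f : ℕ → ℂ} {κ : ℂ} {K b : ℝ} (hK : 0 ≤ K)
    (h : ∀ t : ℝ, 1 < t → ‖(∑ k ∈ Finset.Icc 1 ⌊t⌋₊, f k) - κ * t‖ ≤ K * t ^ b) {s : ℂ} (hs : b < s.re) :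
    ‖mellin (errE f κ) (-s)‖ ≤ K / (s.re - b) := by
  rw [errE_mellin_eq]
  have hIntg : IntegrableOn (fun t : ℝ => K * t ^ (b - s.re - 1)) (Set.Ioi 1) :=
    (integrableOn_Ioi_rpow_of_lt (by linarith) one_pos).const_mul K
  refine (norm_integral_le_of_norm_le hIntg ?_).trans (le_of_eq ?_)
  · filter_upwards [ae_restrict_mem measurableSet_Ioi] with t ht
    have ht1 : (1:ℝ) < t := ht
    have ht0 : 0 < t := by linarith
    rw [norm_mul, Complex.norm_cpow_eq_rpow_re_of_pos ht0]
    have : K * t ^ (b - s.re - 1) = K * t ^ b * t ^ (-(s+1)).re := by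
      rw [mul_assoc, ← Real.rpow_add ht0]; congr 2; simp; ring
    rw [this]
    gcongr
    exact h t ht1
  · rw [integral_const_mul, integral_Ioi_rpow_of_lt (by linarith) one_pos]
    have : s.re - b ≠ 0 := by linarith
    have h2 : b - s.re - 1 + 1 ≠ 0 := by intro h; apply this; linarith
    rw [Real.one_rpow]
    have h3: b - s.re - 1 + 1 = -(s.re - b) := by ring
    rw [h3]; field_simp

section chars
variable {q : ℕ} [NeZero q]

lemma sum_char_block {χ : DirichletCharacter ℂ q} (hχ : χ ≠ 1) (m : ℕ) :
    ∑ k ∈ Finset.range q, χ ((q * m + k : ℕ) : ZMod q) = 0 := by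
  have h1 : ∑ a, χ a = 0 := MulChar.sum_eq_zero_of_ne_one hχ
  rw [← h1]
  obtain ⟨n, rfl⟩ := Nat.exists_eq_succ_of_ne_zero (NeZero.ne q)
  rw [Finset.sum_range]
  refine Finset.sum_congr rfl fun i _ => ?_
  congr 1
  push_cast
  rw [ZMod.natCast_self' n |> fun h => (by exact_mod_cast ZMod.natCast_self (n+1) : ((n:ZMod (n+1)) + 1) = 0)]
  rw [zero_mul, zero_add]
  exact ZMod.natCast_zmod_val (n := n+1) i

lemma norm_sum_range_char_le {χ : DirichletCharacter ℂ q} (hχ : χ ≠ 1) (n : ℕ) :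
    ‖∑ k ∈ Finset.range n, χ (k : ZMod q)‖ ≤ q := by
  have hmul : ∀ m : ℕ, ∑ k ∈ Finset.range (q * m), χ (k : ZMod q) = 0 := by
    intro m
    induction m with
    | zero => simp
    | succ m ih => rw [Nat.mul_succ, Finset.sum_range_add, ih, zero_add, sum_char_block hχ]
  rw [← Nat.div_add_mod n q, Finset.sum_range_add, hmul, zero_add]
  refine (norm_sum_le _ _).trans ((Finset.sum_le_sum fun k _ => χ.norm_le_one _).trans ?_)
  simp
  exact (Nat.mod_lt n (NeZero.pos q)).le

lemma norm_sum_Icc_char_le {χ : DirichletCharacter ℂ q} (hχ : χ ≠ 1) (n : ℕ) :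
    ‖∑ k ∈ Finset.Icc 1 n, χ (k : ZMod q)‖ ≤ q := by
  have hq : 1 < q := by
    by_contra hq
    have : q = 1 := by have := NeZero.pos q; omega
    subst this
    exact hχ (DirichletCharacter.level_one χ)
  have h0 : χ ((0:ℕ) : ZMod q) = 0 := by
    have : Fact (1 < q) := ⟨hq⟩
    have h : ¬ IsUnit ((0:ℕ) : ZMod q) := by simp
    exact χ.map_nonunit h
  have : ∑ k ∈ Finset.Icc 1 n, χ (k : ZMod q) = ∑ k ∈ Finset.range (n+1), χ (k : ZMod q) := by
    rw [Finset.range_eq_Ico, Finset.sum_eq_sum_Ico_succ_bot (by omega), h0, zero_add]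
    rfl
  rw [this]; exact norm_sum_range_char_le hχ _

lemma char_sum_bound {χ : DirichletCharacter ℂ q} (hχ : χ ≠ 1) {a : ℝ} (ha : 0 ≤ a) (ha1 : a ≤ 1) :
    ∀ t : ℝ, 1 < t → ‖(∑ k ∈ Finset.Icc 1 ⌊t⌋₊, χ (k : ZMod q)) - 0 * (t:ℂ)‖ ≤ (q:ℝ)^a * t ^ (1 - a) := by
  intro t ht
  rw [zero_mul, sub_zero]
  set X := ‖∑ k ∈ Finset.Icc 1 ⌊t⌋₊, χ (k : ZMod q)‖ with hX
  have h1 : X ≤ q := norm_sum_Icc_char_le hχ _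
  have h2 : X ≤ t := by
    refine (norm_sum_le _ _).trans ((Finset.sum_le_sum fun k _ => χ.norm_le_one _).trans ?_)
    simp
    exact Nat.floor_le (by linarith)
  have h0 : 0 ≤ X := norm_nonneg _
  calc X = X ^ a * X ^ (1 - a) := by
        rcases h0.eq_or_lt with h | h
        · rw [← h]
          rcases eq_or_ne a 0 with h | h
          · simp [h]
          · rw [Real.zero_rpow h, zero_mul]
        · rw [← Real.rpow_add h]; simp
    _ ≤ _ := by
        gcongr

lemma LFunction_eq_mellin {χ : DirichletCharacter ℂ q} (hχ : χ ≠ 1) {s : ℂ} (hs : 0 < s.re) :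
    DirichletCharacter.LFunction χ s = s * mellin (errE (fun n : ℕ => χ (n : ZMod q)) 0) (-s) := by
  have hU : IsOpen {s : ℂ | 0 < s.re} := isOpen_lt continuous_const Complex.continuous_re
  have hb := char_sum_bound hχ (a := 1) (by norm_num) le_rfl
  simp only [sub_self] at hb
  have h1 : AnalyticOnNhd ℂ (DirichletCharacter.LFunction χ) {s : ℂ | 0 < s.re} :=
    (DirichletCharacter.differentiable_LFunction hχ).differentiableOn.analyticOnNhd hU
  have h2 : AnalyticOnNhd ℂ (fun s => s * mellin (errE (fun n : ℕ => χ (n : ZMod q)) 0) (-s)) {s : ℂ | 0 < s.re} := by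
    refine DifferentiableOn.analyticOnNhd (fun s hs => ?_) hU
    exact (differentiableAt_id.mul (errE_diff (by positivity) hb hs)).differentiableWithinAt
  have hconn : IsPreconnected {s : ℂ | 0 < s.re} := (convex_halfSpace_re_gt 0).isPreconnected
  refine h1.eqOn_of_preconnected_of_eventuallyEq h2 hconn (z₀ := 2) (by simp) ?_ hs
  have : ∀ᶠ z : ℂ in nhds 2, 1 < z.re :=
    (isOpen_lt continuous_const Complex.continuous_re).mem_nhds (by simp)
  filter_upwards [this] with z hz
  rw [DirichletCharacter.LFunction_eq_LSeries χ hz, errE_mellin_eq,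
    LSeries_eq_mul_integral (fun n : ℕ => χ (n : ZMod q)) (r := 0) le_rfl (by linarith)
      (DirichletCharacter.LSeriesSummable_of_one_lt_re χ hz)]
  · simp
  · apply Asymptotics.IsBigO.of_bound (q:ℝ)
    filter_upwards with n
    simpa using norm_sum_Icc_char_le hχ n

/-- growth of `L(s,χ)`. -/
lemma norm_LFunction_le {χ : DirichletCharacter ℂ q} (hχ : χ ≠ 1) {a : ℝ} (ha : 0 ≤ a) (ha1 : a ≤ 1)
    {s : ℂ} (hs : 1 - a < s.re) :
    ‖DirichletCharacter.LFunction χ s‖ ≤ ‖s‖ * ((q:ℝ)^a / (s.re - (1 - a))) := by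
  rw [LFunction_eq_mellin hχ (by linarith), norm_mul]
  gcongr
  exact errE_norm (by positivity) (char_sum_bound hχ ha ha1) hs

end chars

lemma floor_sum_bound : ∀ t : ℝ, 1 < t →
    ‖(∑ k ∈ Finset.Icc 1 ⌊t⌋₊, (1 : ℕ → ℂ) k) - 1 * (t:ℂ)‖ ≤ 1 * t ^ (0:ℝ) := by
  intro t ht
  have : (∑ k ∈ Finset.Icc 1 ⌊t⌋₊, (1 : ℕ → ℂ) k) - 1 * (t:ℂ) = ((⌊t⌋₊ - t : ℝ) : ℂ) := by simp
  rw [this, Complex.norm_real, Real.norm_eq_abs, abs_sub_comm, Real.rpow_zero, abs_le]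
  have h1 := Nat.floor_le (by linarith : 0 ≤ t)
  have h2 := Nat.lt_floor_add_one t
  constructor <;> linarith

lemma zeta_eq_mellin {s : ℂ} (hs : 1 < s.re) :
    riemannZeta s = s / (s - 1) + s * mellin (errE 1 1) (-s) := by
  rw [← LSeries_one_eq_riemannZeta hs, LSeries_eq_mul_integral 1 (r := 1) (by norm_num) hs
    (LSeriesSummable_one_iff.2 hs), errE_mellin_eq]
  · have hIntg := errE_conv zero_le_one floor_sum_bound (s := s) (by linarith)
    have hi2 : IntegrableOn (fun t : ℝ => (t:ℂ) ^ (-s)) (Set.Ioi 1) :=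
      integrableOn_Ioi_cpow_of_lt (by simpa using hs) one_pos
    have hi1 : IntegrableOn (fun t : ℝ => ((∑ k ∈ Finset.Icc 1 ⌊t⌋₊, (1 : ℕ → ℂ) k) - 1 * (t:ℂ)) * (t:ℂ) ^ (-(s+1))) (Set.Ioi 1) := by
      have := (hIntg.mono_set (s := Set.Ioi 1) (Set.Ioi_subset_Ioi zero_le_one))
      refine this.congr_fun (fun t ht => ?_) measurableSet_Ioi
      simp only [errE, Set.indicator_of_mem ht, smul_eq_mul, neg_add']
      ring
    have e : ∫ t in Set.Ioi (1:ℝ), (∑ k ∈ Finset.Icc 1 ⌊t⌋₊, (1 : ℕ → ℂ) k) * (t:ℂ) ^ (-(s+1))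
      = ∫ t in Set.Ioi (1:ℝ), (((∑ k ∈ Finset.Icc 1 ⌊t⌋₊, (1 : ℕ → ℂ) k) - 1 * (t:ℂ)) * (t:ℂ) ^ (-(s+1)) + (t:ℂ) ^ (-s)) := by
      refine setIntegral_congr_fun measurableSet_Ioi fun t ht => ?_
      have ht0 : (t:ℂ) ≠ 0 := by
        have : (1:ℝ) < t := ht
        exact_mod_cast (by linarith : t ≠ 0)
      have : (t:ℂ) ^ (-s) = t * (t:ℂ) ^ (-(s+1)) := by
        rw [show -s = 1 + (-(s+1)) by ring, Complex.cpow_add _ _ ht0, Complex.cpow_one]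
      simp only [this]; ring
    rw [e, integral_add hi1 hi2, integral_Ioi_cpow_of_lt (by simpa using hs) one_pos]
    have : s - 1 ≠ 0 := by
      intro h; have := congrArg Complex.re h; simp at this; linarith
    have h3 : -s + 1 ≠ 0 := by intro h; apply this; linear_combination -h
    simp only [Complex.ofReal_one, Complex.one_cpow]
    rw [show -1 / (-s + 1) = 1 / (s - 1) by rw [div_eq_div_iff h3 this]; ring]
    ring
  · apply Asymptotics.IsBigO.of_bound 1
    filter_upwards with n
    simp

lemma trivChar₁_one_eq {s : ℂ} (hs : 0 < s.re) :
    DirichletCharacter.LFunctionTrivChar₁ 1 s = s + (s - 1) * (s * mellin (errE 1 1) (-s)) := by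
  have hU : IsOpen {s : ℂ | 0 < s.re} := isOpen_lt continuous_const Complex.continuous_re
  have h1 : AnalyticOnNhd ℂ (DirichletCharacter.LFunctionTrivChar₁ 1) {s : ℂ | 0 < s.re} :=
    (DirichletCharacter.differentiable_LFunctionTrivChar₁ 1).differentiableOn.analyticOnNhd hU
  have h2 : AnalyticOnNhd ℂ (fun s => s + (s - 1) * (s * mellin (errE 1 1) (-s))) {s : ℂ | 0 < s.re} := by
    refine DifferentiableOn.analyticOnNhd (fun s hs => ?_) hU
    exact (differentiableAt_id.add ((differentiableAt_id.sub_const _).mul (differentiableAt_id.mul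
      (errE_diff zero_le_one floor_sum_bound hs)))).differentiableWithinAt
  have hconn : IsPreconnected {s : ℂ | 0 < s.re} := (convex_halfSpace_re_gt 0).isPreconnected
  refine h1.eqOn_of_preconnected_of_eventuallyEq h2 hconn (z₀ := 2) (by simp) ?_ hs
  have : ∀ᶠ z : ℂ in nhds 2, 1 < z.re :=
    (isOpen_lt continuous_const Complex.continuous_re).mem_nhds (by simp)
  filter_upwards [this] with z hz
  have hz1 : z ≠ 1 := by rintro rfl; simp at hz
  have hz2 : z - 1 ≠ 0 := sub_ne_zero.2 hz1
  rw [DirichletCharacter.LFunctionTrivChar₁, Function.update_of_ne hz1,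
    DirichletCharacter.LFunctionTrivChar_eq_mul_riemannZeta hz1, zeta_eq_mellin hz]
  simp
  field_simp

lemma norm_trivChar₁_le (q : ℕ) [NeZero q] {s : ℂ} (hs : 0 < s.re) :
    ‖DirichletCharacter.LFunctionTrivChar₁ q s‖ ≤ q * (‖s‖ + ‖s - 1‖ * ‖s‖ / s.re) := by
  have h1 : DirichletCharacter.LFunctionTrivChar₁ q s =
      (∏ p ∈ q.primeFactors, (1 - (p : ℂ) ^ (-s))) * DirichletCharacter.LFunctionTrivChar₁ 1 s := by
    by_cases h : s = 1
    · subst h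
      simp only [DirichletCharacter.LFunctionTrivChar₁, Function.update_self]
      simp [Complex.cpow_neg_one]
    · simp only [DirichletCharacter.LFunctionTrivChar₁, Function.update_of_ne h,
        DirichletCharacter.LFunctionTrivChar_eq_mul_riemannZeta h]
      simp; ring
  rw [h1, norm_mul, trivChar₁_one_eq hs]
  gcongr
  · rw [norm_prod]
    calc ∏ p ∈ q.primeFactors, ‖1 - (p : ℂ) ^ (-s)‖ ≤ ∏ p ∈ q.primeFactors, (p:ℝ) := by
          apply Finset.prod_le_prod (fun _ _ => norm_nonneg _)
          intro p hp
          have hp' := (Nat.prime_of_mem_primeFactors hp)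
          have h2 : (2:ℝ) ≤ p := by exact_mod_cast hp'.two_le
          have : ‖(p : ℂ) ^ (-s)‖ ≤ 1 := by
            rw [Complex.norm_natCast_cpow_of_pos hp'.pos]
            apply Real.rpow_le_one_of_one_le_of_nonpos (by linarith)
            simp; linarith
          calc _ ≤ ‖(1:ℂ)‖ + ‖(p : ℂ) ^ (-s)‖ := norm_sub_le _ _
            _ ≤ _ := by rw [norm_one]; linarith
      _ ≤ q := by
          rw [← Nat.cast_prod]
          exact_mod_cast Nat.le_of_dvd (NeZero.pos q) (Nat.prod_primeFactors_dvd q)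
  · refine (norm_add_le _ _).trans ?_
    rw [norm_mul, norm_mul, mul_div_assoc]
    gcongr
    rw [div_eq_mul_inv]
    gcongr
    have := errE_norm zero_le_one floor_sum_bound (s := s) hs
    simpa using this

lemma norm_zeta_real_le {σ : ℝ} (hσ : 1 < σ) : ‖riemannZeta σ‖ ≤ σ / (σ - 1) + 1 := by
  rw [zeta_eq_mellin (by simpa using hσ)]
  refine (norm_add_le _ _).trans ?_
  gcongr
  · rw [norm_div, show (σ:ℂ) - 1 = ((σ - 1 : ℝ) : ℂ) by push_cast; ring, Complex.norm_real, Complex.norm_real,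
      Real.norm_of_nonneg (by linarith), Real.norm_of_nonneg (by linarith)]
  · rw [norm_mul]
    have := errE_norm zero_le_one floor_sum_bound (s := (σ:ℂ)) (by simp; linarith)
    simp only [Complex.ofReal_re, sub_zero] at this
    rw [Complex.norm_real, Real.norm_of_nonneg (by linarith)]
    calc σ * _ ≤ σ * (1/σ) := by gcongr
      _ = 1 := by field_simp

lemma norm_LSeries_le_of_norm_le_one {f : ℕ → ℂ} (hf : ∀ n, ‖f n‖ ≤ 1) {s : ℂ} (hs : 1 < s.re) :
    ‖LSeries f s‖ ≤ s.re / (s.re - 1) + 1 := by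
  have hs' : 1 < ((s.re : ℝ) : ℂ).re := by simpa using hs
  refine le_trans ?_ (norm_zeta_real_le hs)
  rw [← LSeries_one_eq_riemannZeta hs']
  have hsum : LSeriesSummable 1 ((s.re : ℝ) : ℂ) := LSeriesSummable_one_iff.2 hs'
  have hn : ∀ n, LSeries.term 1 ((s.re : ℝ) : ℂ) n = ((‖LSeries.term 1 ((s.re : ℝ) : ℂ) n‖ : ℝ) : ℂ) := by
    intro n
    rcases eq_or_ne n 0 with rfl | hn
    · simp
    · rw [LSeries.norm_term_eq, LSeries.term_of_ne_zero hn]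
      simp only [hn, if_false, Pi.one_apply, norm_one, Complex.ofReal_re]
      rw [Complex.ofReal_div, Complex.ofReal_one, Complex.ofReal_cpow (Nat.cast_nonneg n)]
      simp
  have hbd : ∀ n, ‖LSeries.term f s n‖ ≤ ‖LSeries.term 1 ((s.re : ℝ) : ℂ) n‖ := by
    intro n
    rw [LSeries.norm_term_eq, LSeries.norm_term_eq]
    split_ifs with h
    · simp
    · simp only [Complex.ofReal_re, Pi.one_apply, norm_one]
      gcongr; exact hf n
  have hsn : Summable fun n => ‖LSeries.term 1 ((s.re : ℝ) : ℂ) n‖ := hsum.norm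
  have : LSeries 1 ((s.re : ℝ) : ℂ) = ((∑' n, ‖LSeries.term 1 ((s.re : ℝ) : ℂ) n‖ : ℝ) : ℂ) := by
    rw [Complex.ofReal_tsum]
    exact tsum_congr hn
  rw [this, Complex.norm_real, Real.norm_of_nonneg (tsum_nonneg fun _ => norm_nonneg _)]
  exact tsum_of_norm_bounded hsn.hasSum hbd

lemma norm_LFunction_ge {q : ℕ} [NeZero q] (χ : DirichletCharacter ℂ q) {s : ℂ} (hs : 1 < s.re) (hs2 : s.re ≤ 3) :
    (s.re - 1) / 5 ≤ ‖DirichletCharacter.LFunction χ s‖ := by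
  rw [DirichletCharacter.LFunction_eq_LSeries χ hs]
  have h := DirichletCharacter.LSeries.mul_mu_eq_one χ hs
  have h1 := congrArg norm h
  rw [norm_mul, norm_one] at h1
  have h2 : ‖LSeries ((fun n : ℕ => χ n) * fun n => ((ArithmeticFunction.moebius n : ℤ) : ℂ)) s‖ ≤ s.re / (s.re - 1) + 1 := by
    apply norm_LSeries_le_of_norm_le_one _ hs
    intro n
    rw [Pi.mul_apply, norm_mul]
    have e1 := χ.norm_le_one (n : ZMod q)
    have e2 : ‖((ArithmeticFunction.moebius n : ℤ) : ℂ)‖ ≤ 1 := by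
      rw [Complex.norm_intCast]
      exact_mod_cast ArithmeticFunction.abs_moebius_le_one
    exact mul_le_one₀ e1 (norm_nonneg _) e2
  have h3 : s.re / (s.re - 1) + 1 ≤ 5 / (s.re - 1) := by
    have : 0 < s.re - 1 := by linarith
    rw [div_add_one (by linarith)]
    gcongr; linarith
  have hpos : 0 < s.re - 1 := by linarith
  have h4 : 1 ≤ ‖LSeries (fun n : ℕ => χ n) s‖ * (5 / (s.re - 1)) := by
    calc (1:ℝ) = _ := h1.symm
      _ ≤ _ := by gcongr; exact h2.trans h3
  rw [← mul_div_assoc, le_div_iff₀ hpos] at h4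
  linarith

end SW

namespace SW

open DirichletCharacter

/-- entire normalisation of the L-function -/
noncomputable def fL {q : ℕ} [NeZero q] (χ : DirichletCharacter ℂ q) : ℂ → ℂ :=
  open Classical in if χ = 1 then LFunctionTrivChar₁ q else LFunction χ

section
variable {q : ℕ} [NeZero q]

lemma fL_one : fL (1 : DirichletCharacter ℂ q) = LFunctionTrivChar₁ q := by simp [fL]
lemma fL_ne {χ : DirichletCharacter ℂ q} (h : χ ≠ 1) : fL χ = LFunction χ := by simp [fL, h]

lemma differentiable_fL (χ : DirichletCharacter ℂ q) : Differentiable ℂ (fL χ) := by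
  by_cases h : χ = 1
  · subst h; rw [fL_one]; exact differentiable_LFunctionTrivChar₁ q
  · rw [fL_ne h]; exact differentiable_LFunction h

lemma fL_ne_zero (χ : DirichletCharacter ℂ q) {s : ℂ} (hs : 1 ≤ s.re) : fL χ s ≠ 0 := by
  by_cases h : χ = 1
  · subst h; rw [fL_one]
    by_cases h1 : s = 1
    · subst h1; exact LFunctionTrivChar₁_apply_one_ne_zero q
    · rw [LFunctionTrivChar₁, Function.update_of_ne h1]
      exact mul_ne_zero (sub_ne_zero.2 h1)
        (LFunction_ne_zero_of_one_le_re 1 (Or.inr h1) hs)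
  · rw [fL_ne h]; exact LFunction_ne_zero_of_one_le_re χ (Or.inl h) hs

lemma norm_fL_le (χ : DirichletCharacter ℂ q) {z : ℂ} {T : ℝ} (hz : 1 / 2 ≤ z.re) (hzT : ‖z‖ ≤ T) (hT : 2 ≤ T) :
    ‖fL χ z‖ ≤ 4 * q * T ^ 2 := by
  have hq : (1:ℝ) ≤ q := by exact_mod_cast NeZero.pos q
  have hr : 0 < z.re := by linarith
  by_cases h : χ = 1
  · subst h; rw [fL_one]
    refine (norm_trivChar₁_le q hr).trans ?_
    have h1 : ‖z - 1‖ ≤ T + 1 := (norm_sub_le _ _).trans (by rw [norm_one]; linarith)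
    have h2 : ‖z - 1‖ * ‖z‖ / z.re ≤ (T+1) * T / (1/2) := by gcongr
    have h3 : ‖z‖ + ‖z - 1‖ * ‖z‖ / z.re ≤ 4 * T^2 := by
      have : (T+1)*T/(1/2) = 2*T^2+2*T := by ring
      nlinarith
    calc _ ≤ q * (4 * T^2) := by gcongr
      _ = _ := by ring
  · rw [fL_ne h]
    refine (norm_LFunction_le h (a := 1) (by norm_num) le_rfl (by simpa using hr)).trans ?_
    simp only [sub_self, sub_zero, Real.rpow_one]
    calc ‖z‖ * (q / z.re) ≤ T * (q / (1/2)) := by gcongr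
      _ = q * (2 * T) := by ring
      _ ≤ q * (4 * T^2) := by
        apply mul_le_mul_of_nonneg_left _ (by linarith)
        nlinarith
      _ = _ := by ring

lemma norm_fL_ge (χ : DirichletCharacter ℂ q) {s : ℂ} {δ : ℝ} (hδ : 0 < δ) (hδ1 : δ ≤ 1) (hs : s.re = 1 + δ) :
    δ ^ 2 / 5 ≤ ‖fL χ s‖ := by
  have h1 := norm_LFunction_ge χ (s := s) (by linarith) (by linarith)
  rw [hs] at h1
  have e : 1 + δ - 1 = δ := by ring
  rw [e] at h1
  by_cases h : χ = 1
  · subst h; rw [fL_one]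
    have hs1 : s ≠ 1 := by rintro rfl; simp at hs; linarith
    rw [LFunctionTrivChar₁, Function.update_of_ne hs1, norm_mul]
    have h2 : δ ≤ ‖s - 1‖ := by
      refine le_trans ?_ (Complex.re_le_norm _); simp [hs]
    calc δ^2/5 = δ * (δ/5) := by ring
      _ ≤ _ := by gcongr
  · rw [fL_ne h]
    refine le_trans ?_ h1
    nlinarith

/-- the size parameter -/
noncomputable def LL (q : ℕ) (t δ : ℝ) : ℝ := Real.log (10 * q * (|t| + 3) / δ)

lemma LL_ge_one {t δ : ℝ} (hδ : 0 < δ) (hδ1 : δ ≤ 1) : 1 ≤ LL q t δ := by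
  have hq : (1:ℝ) ≤ q := by exact_mod_cast NeZero.pos q
  unfold LL
  rw [Real.le_log_iff_exp_le (by positivity)]
  have h1 := Real.exp_one_lt_d9
  rw [le_div_iff₀ hδ]
  have := abs_nonneg t
  have : Real.exp 1 * δ ≤ 3 := by nlinarith [Real.exp_pos 1]
  nlinarith

lemma fL_ratio (χ : DirichletCharacter ℂ q) {s : ℂ} {δ : ℝ} (hδ : 0 < δ) (hδ1 : δ ≤ 1) (hs : s.re = 1 + δ)
    {z : ℂ} (hz : ‖z - s‖ ≤ 1 / 2) : ‖fL χ z‖ ≤ Real.exp (2 * LL q s.im δ) * ‖fL χ s‖ := by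
  have hq : (1:ℝ) ≤ q := by exact_mod_cast NeZero.pos q
  have him := abs_nonneg s.im
  have h1 : 1/2 ≤ z.re := by
    have := (Complex.abs_re_le_norm (z - s)).trans hz
    rw [Complex.sub_re, abs_le] at this
    linarith
  have h2 : ‖z‖ ≤ |s.im| + 3 := by
    have e1 : ‖z‖ ≤ ‖z - s‖ + ‖s‖ := by simpa using norm_add_le (z - s) s
    have e2 := Complex.norm_le_abs_re_add_abs_im s
    rw [hs, abs_of_pos (by linarith)] at e2
    linarith
  have h3 := norm_fL_le χ h1 h2 (by linarith)
  have h4 := norm_fL_ge χ hδ hδ1 hs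
  refine h3.trans ?_
  have e : Real.exp (2 * LL q s.im δ) = (10 * q * (|s.im| + 3) / δ)^2 := by
    unfold LL
    rw [mul_comm, Real.exp_mul, Real.exp_log (by positivity)]
    exact_mod_cast rfl
  rw [e]
  calc 4 * q * (|s.im|+3)^2 ≤ (20 * q^2) * (|s.im|+3)^2 := by
        apply mul_le_mul_of_nonneg_right _ (by positivity)
        nlinarith
    _ = (10 * q * (|s.im| + 3) / δ)^2 * (δ^2/5) := by field_simp; norm_num
    _ ≤ _ := by gcongr

lemma fL_neg_logDeriv_le (χ : DirichletCharacter ℂ q) {s : ℂ} {δ : ℝ} (hδ : 0 < δ) (hδ1 : δ ≤ 1) (hs : s.re = 1 + δ) :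
    -(deriv (fL χ) s / fL χ s).re ≤ 896 * LL q s.im δ := by
  have := neg_logDeriv_le (R := 1/2) (M := 2 * LL q s.im δ) (by norm_num) (differentiable_fL χ)
    (by have := LL_ge_one (q := q) (t := s.im) hδ hδ1; linarith) (fL_ne_zero χ (s := s) (by linarith))
    (fun z hz => fL_ratio χ hδ hδ1 hs hz)
    (fun z _ h => by
      by_contra hc
      exact fL_ne_zero χ (by linarith) h)
  linarith

lemma fL_neg_logDeriv_le_of_zero (χ : DirichletCharacter ℂ q) {s : ℂ} {δ : ℝ} (hδ : 0 < δ) (hδ1 : δ ≤ 1 / 4) (hs : s.re = 1 + δ)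
    {ρ : ℂ} (hρ : fL χ ρ = 0) (him : ρ.im = s.im) (hre : 1 - 1 / 5 < ρ.re) :
    -(deriv (fL χ) s / fL χ s).re ≤ 896 * LL q s.im δ + 2 - 1 / (1 + δ - ρ.re) := by
  have hlt : ρ.re < 1 := by
    by_contra hc
    exact fL_ne_zero χ (by linarith) hρ
  have hn : ‖ρ - s‖ = 1 + δ - ρ.re := by
    have : ρ - s = ((ρ.re - s.re : ℝ) : ℂ) := by
      apply Complex.ext <;> simp [him]
    rw [this, Complex.norm_real, Real.norm_eq_abs, abs_of_neg (by linarith)]; linarith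
  have := neg_logDeriv_le_of_zero (R := 1/2) (M := 2 * LL q s.im δ) (by norm_num) (differentiable_fL χ)
    (by have := LL_ge_one (q := q) (t := s.im) hδ (by linarith); linarith) (fL_ne_zero χ (s := s) (by linarith))
    (fun z hz => fL_ratio χ hδ (by linarith) hs hz)
    (fun z _ h => by
      by_contra hc
      exact fL_ne_zero χ (by linarith) h) hρ (by rw [hn]; linarith)
  rw [hn, hs] at this
  have hx : 0 < 1 + δ - ρ.re := by linarith
  have e : (1 + δ - ρ.re) * (1 / (1 + δ - ρ.re)^2 - 1/(1/2)^2) = 1 / (1 + δ - ρ.re) - 4 * (1 + δ - ρ.re) := by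
    field_simp
    norm_num
  rw [e] at this
  linarith

/-- `D χ s = -L'/L` -/
noncomputable def DD (χ : DirichletCharacter ℂ q) (s : ℂ) : ℂ :=
  LSeries ((fun n : ℕ => χ n) * (fun n : ℕ => ((ArithmeticFunction.vonMangoldt n : ℝ) : ℂ))) s

lemma DD_eq (χ : DirichletCharacter ℂ q) {s : ℂ} (hs : 1 < s.re) :
    DD χ s = - deriv (LFunction χ) s / LFunction χ s := by
  unfold DD
  rw [deriv_LFunction_eq_deriv_LSeries χ hs, LFunction_eq_LSeries χ hs]
  exact LSeries_twist_vonMangoldt_eq χ hs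

lemma DD_ne {χ : DirichletCharacter ℂ q} (hχ : χ ≠ 1) {s : ℂ} (hs : 1 < s.re) :
    DD χ s = - (deriv (fL χ) s / fL χ s) := by
  rw [DD_eq χ hs, fL_ne hχ, neg_div]

lemma DD_one {s : ℂ} (hs : 1 < s.re) :
    DD (1 : DirichletCharacter ℂ q) s = - (deriv (fL (1 : DirichletCharacter ℂ q)) s / fL (1 : DirichletCharacter ℂ q) s) + 1 / (s - 1) := by
  have hs1 : s ≠ 1 := by rintro rfl; simp at hs
  have h1 : s - 1 ≠ 0 := sub_ne_zero.2 hs1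
  have h2 : LFunctionTrivChar q s ≠ 0 := LFunction_ne_zero_of_one_le_re 1 (Or.inr hs1) hs.le
  rw [DD_eq _ hs, fL_one, deriv_LFunctionTrivChar₁_apply_of_ne_one q hs1, LFunctionTrivChar₁,
    Function.update_of_ne hs1]
  change - deriv (LFunctionTrivChar q) s / LFunctionTrivChar q s = _
  field_simp
  ring

lemma three_four_one (χ : DirichletCharacter ℂ q) {σ t : ℝ} (hσ : 1 < σ) :
    0 ≤ 3 * (DD (1 : DirichletCharacter ℂ q) σ).re + 4 * (DD χ (σ + t * Complex.I)).re
      + (DD (χ^2) (σ + 2 * t * Complex.I)).re := by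
  have hs1 : LSeriesSummable _ _ := LSeriesSummable_twist_vonMangoldt (1 : DirichletCharacter ℂ q) (s := (σ:ℂ)) (by simpa using hσ)
  have hs2 : LSeriesSummable _ _ := LSeriesSummable_twist_vonMangoldt χ (s := (σ + t * Complex.I)) (by simpa using hσ)
  have hs3 : LSeriesSummable _ _ := LSeriesSummable_twist_vonMangoldt (χ^2) (s := (σ + 2 * t * Complex.I)) (by simpa using hσ)
  have h1 := Complex.hasSum_re hs1.hasSum
  have h2 := Complex.hasSum_re hs2.hasSum
  have h3 := Complex.hasSum_re hs3.hasSum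
  have h := ((h1.mul_left 3).add (h2.mul_left 4)).add h3
  refine h.nonneg fun n => ?_
  rcases eq_or_ne n 0 with rfl | hn
  · simp
  have hn0 : (n:ℂ) ≠ 0 := by exact_mod_cast hn
  have hnpos : (0:ℝ) < n := by positivity
  simp only [LSeries.term_of_ne_zero hn, Pi.mul_apply]
  set v : ℂ := χ (n : ZMod q) / (n:ℂ) ^ (t * Complex.I) with hv
  set x : ℝ := ArithmeticFunction.vonMangoldt n / (n:ℝ)^σ with hx
  have hx0 : 0 ≤ x := div_nonneg ArithmeticFunction.vonMangoldt_nonneg (by positivity)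
  have hp : (n:ℂ)^(σ:ℂ) = (((n:ℝ)^σ : ℝ) : ℂ) := by rw [Complex.ofReal_cpow hnpos.le]; simp
  have hnt : (n:ℂ) ^ (t * Complex.I) ≠ 0 := by simp [Complex.cpow_eq_zero_iff, hn0]
  have hnσ : (n:ℂ) ^ (σ:ℂ) ≠ 0 := by simp [Complex.cpow_eq_zero_iff, hn0]
  have e2 : χ (n : ZMod q) * ((ArithmeticFunction.vonMangoldt n : ℝ) : ℂ) / (n:ℂ) ^ (σ + t * Complex.I) = (x:ℂ) * v := by
    rw [Complex.cpow_add _ _ hn0, hx, hv, Complex.ofReal_div, ← hp]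
    field_simp
  have e3 : (χ^2) (n : ZMod q) * ((ArithmeticFunction.vonMangoldt n : ℝ) : ℂ) / (n:ℂ) ^ (σ + 2 * t * Complex.I) = (x:ℂ) * v^2 := by
    rw [Complex.cpow_add _ _ hn0, hx, hv, Complex.ofReal_div, ← hp, MulChar.pow_apply' _ (by norm_num),
      show (2 * (t:ℂ) * Complex.I) = t * Complex.I + t * Complex.I by ring, Complex.cpow_add _ _ hn0]
    field_simp
  have e1 : (1 : DirichletCharacter ℂ q) (n : ZMod q) * ((ArithmeticFunction.vonMangoldt n : ℝ) : ℂ) / (n:ℂ) ^ (σ:ℂ) = (x:ℂ) * (1 : DirichletCharacter ℂ q) (n : ZMod q) := by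
    rw [hx, Complex.ofReal_div, ← hp]; field_simp
  rw [e1, e2, e3, Complex.re_ofReal_mul, Complex.re_ofReal_mul, Complex.re_ofReal_mul]
  by_cases hu : IsUnit (n : ZMod q)
  · have hv1 : ‖v‖ = 1 := by
      have e4 : ‖χ (n : ZMod q)‖ = 1 := by
        obtain ⟨u, hu⟩ := hu
        rw [← hu]; exact χ.unit_norm_eq_one u
      rw [hv, norm_div, e4, Complex.norm_natCast_cpow_of_pos (by omega)]
      simp
    have h5 : v.re^2 + v.im^2 = 1 := by
      have := Complex.sq_norm v
      rw [hv1, Complex.normSq_apply] at this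
      linarith
    have e6 : (v^2).re = v.re^2 - v.im^2 := by rw [sq, Complex.mul_re]; ring
    have e7 : ((1 : DirichletCharacter ℂ q) (n : ZMod q)).re = 1 := by
      rw [MulChar.one_apply hu]; simp
    rw [e6, e7]
    have : v.re^2 - v.im^2 = 2 * v.re^2 - 1 := by linarith
    rw [this]
    nlinarith [mul_nonneg hx0 (sq_nonneg (1 + v.re))]
  · have : v = 0 := by rw [hv, χ.map_nonunit hu, zero_div]
    rw [this, MulChar.map_nonunit _ hu]; simp

lemma DD_re_le_ne {χ : DirichletCharacter ℂ q} (hχ : χ ≠ 1) {s : ℂ} {δ : ℝ} (hδ : 0 < δ) (hδ1 : δ ≤ 1) (hs : s.re = 1 + δ) :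
    (DD χ s).re ≤ 896 * LL q s.im δ := by
  rw [DD_ne hχ (by linarith), Complex.neg_re]; exact fL_neg_logDeriv_le χ hδ hδ1 hs

lemma re_one_div {s : ℂ} {δ : ℝ} (hs : s.re = 1 + δ) :
    (1 / (s - 1)).re = δ / (δ^2 + s.im^2) := by
  rw [one_div, Complex.inv_re, Complex.normSq_apply]
  simp [hs]
  ring

lemma DD_re_le_one {s : ℂ} {δ : ℝ} (hδ : 0 < δ) (hδ1 : δ ≤ 1) (hs : s.re = 1 + δ) :
    (DD (1 : DirichletCharacter ℂ q) s).re ≤ 896 * LL q s.im δ + δ / (δ^2 + s.im^2) := by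
  rw [DD_one (by linarith), Complex.add_re, Complex.neg_re, re_one_div hs]
  have := fL_neg_logDeriv_le (1 : DirichletCharacter ℂ q) hδ hδ1 hs
  linarith

lemma LL_mono {t t' δ : ℝ} (hδ : 0 < δ) (h : |t| ≤ |t'|) : LL q t δ ≤ LL q t' δ := by
  have hq : (1:ℝ) ≤ q := by exact_mod_cast NeZero.pos q
  unfold LL
  apply Real.log_le_log
  · have := abs_nonneg t; positivity
  · gcongr

/-- zero-free region away from the real axis or for complex characters. -/
lemma zero_free (χ : DirichletCharacter ℂ q) {ρ : ℂ} {δ : ℝ} (hδ : 0 < δ)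
    (hδL : δ * LL q (2 * ρ.im) δ ≤ 1 / 40000)
    (h : χ^2 ≠ 1 ∨ 4 * δ ≤ |ρ.im|) (hre : 1 - δ / 7 ≤ ρ.re) (hδ1 : δ ≤ 1) : fL χ ρ ≠ 0 := by
  intro hρ
  have hL1 := LL_ge_one (q := q) (t := 2 * ρ.im) hδ hδ1
  have hδ4 : δ ≤ 1 / 4 := by nlinarith
  have hlt : ρ.re < 1 := by
    by_contra hc
    exact fL_ne_zero χ (by linarith) hρ
  have h341 := three_four_one χ (σ := 1 + δ) (t := ρ.im) (by linarith)
  have b1 := DD_re_le_one (q := q) (s := ((1 + δ : ℝ) : ℂ)) hδ hδ1 (by simp)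
  have b1' : LL q ((1 + δ : ℝ) : ℂ).im δ ≤ LL q (2 * ρ.im) δ := LL_mono hδ (by simp)
  have e1 : δ / (δ^2 + ((1 + δ : ℝ) : ℂ).im^2) = 1 / δ := by simp; field_simp
  rw [e1] at b1
  set s2 : ℂ := ((1 + δ : ℝ) : ℂ) + ρ.im * Complex.I with hs2
  set s3 : ℂ := ((1 + δ : ℝ) : ℂ) + 2 * ρ.im * Complex.I with hs3
  have r2 : s2.re = 1 + δ := by simp [hs2]
  have r3 : s3.re = 1 + δ := by simp [hs3]
  have i2 : s2.im = ρ.im := by simp [hs2]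
  have i3 : s3.im = 2 * ρ.im := by simp [hs3]
  have b2 : -(deriv (fL χ) s2 / fL χ s2).re ≤ 896 * LL q s2.im δ + 2 - 1 / (1 + δ - ρ.re) :=
    fL_neg_logDeriv_le_of_zero χ hδ hδ4 r2 hρ i2.symm (by linarith)
  have b2' : LL q s2.im δ ≤ LL q (2 * ρ.im) δ := LL_mono hδ (by
    rw [i2, abs_mul]; have := abs_nonneg ρ.im; norm_num; linarith)
  have small : ∀ y : ℝ, 4 * δ ≤ |y| → δ / (δ^2 + y^2) ≤ 1 / (17 * δ) := by
    intro y hy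
    rw [div_le_div_iff₀ (by positivity) (by positivity)]
    have : 16 * δ^2 ≤ y^2 := by
      have := mul_self_le_mul_self (by positivity) hy
      rw [abs_mul_abs_self] at this; nlinarith
    nlinarith
  have b2'' : (DD χ s2).re ≤ 896 * LL q (2 * ρ.im) δ + 2 - 1 / (1 + δ - ρ.re) + 1 / (17 * δ) := by
    by_cases hχ : χ = 1
    · subst hχ
      rw [DD_one (by linarith), Complex.add_re, Complex.neg_re, re_one_div r2, i2]
      have := small ρ.im (by rcases h with h | h
                             · simp at h
                             · exact h)
      linarith
    · rw [DD_ne hχ (by linarith), Complex.neg_re]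
      have : 0 < 1 / (17 * δ) := by positivity
      linarith
  have b3 : (DD (χ^2) s3).re ≤ 896 * LL q (2 * ρ.im) δ + 1 / (17 * δ) := by
    by_cases hχ : χ^2 = 1
    · have := DD_re_le_one (q := q) hδ hδ1 r3
      rw [hχ]
      have h4 := small s3.im (by
        rw [i3, abs_mul]; rcases h with h | h
        · exact absurd hχ h
        · norm_num; have := abs_nonneg ρ.im; linarith)
      rw [← i3]; linarith
    · have := DD_re_le_ne hχ hδ hδ1 r3
      have h5 : 0 < 1 / (17 * δ) := by positivity
      rw [← i3]; linarith
  have hfin : 4 * (1 / (1 + δ - ρ.re)) ≤ 3 * (1 / δ) + 5 * (1 / (17 * δ)) + 7176 * LL q (2 * ρ.im) δ := by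
    have e : 0 ≤ 3 * (DD (1 : DirichletCharacter ℂ q) ((1 + δ : ℝ) : ℂ)).re + 4 * (DD χ s2).re + (DD (χ^2) s3).re := h341
    linarith
  have e5 : 5 * (1 / (17 * δ)) = (5 / 17) * (1 / δ) := by field_simp
  have e6 : LL q (2 * ρ.im) δ ≤ (1/40000) * (1/δ) := by
    rw [mul_one_div, le_div_iff₀ hδ]; linarith
  rw [e5] at hfin
  have h7 : 7 / 8 * (1/δ) ≤ 1 / (1 + δ - ρ.re) := by
    rw [mul_one_div, div_le_div_iff₀ hδ (by linarith)]
    linarith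
  have h8 : 0 < 1 / δ := by positivity
  linarith

end

end SW

namespace SW

open DirichletCharacter

section
open scoped ComplexOrder

lemma alternating_of_logDeriv {F : ℂ → ℂ} {a : ℕ → ℂ} (ha : 0 ≤ a)
    (hab : LSeries.abscissaOfAbsConv a < (2:ℝ)) (hF : AnalyticAt ℂ F 2)
    (hd : deriv F =ᶠ[nhds 2] fun s => - (F s * LSeries a s)) (h0 : 0 ≤ F 2) (m : ℕ) :
    0 ≤ (-1 : ℂ)^m * iteratedDeriv m F 2 := by
  have hLa : AnalyticAt ℂ (LSeries a) 2 := by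
    apply LSeries_analyticOnNhd a
    simpa using hab
  induction m using Nat.strong_induction_on with
  | _ m ih =>
    cases m with
    | zero => simpa using h0
    | succ m =>
      rw [iteratedDeriv_succ', hd.iteratedDeriv_eq m]
      have e : iteratedDeriv m (fun s => -(F s * LSeries a s)) 2 = - iteratedDeriv m (F * LSeries a) 2 := by
        rw [show (fun s => -(F s * LSeries a s)) = -(F * LSeries a) from rfl]
        exact iteratedDeriv_neg m _ _
      rw [e, iteratedDeriv_mul (hF.contDiffAt) (hLa.contDiffAt), pow_succ]
      have : (-1:ℂ)^m * -1 * -∑ i ∈ Finset.range (m+1), (m.choose i : ℂ) * iteratedDeriv i F 2 * iteratedDeriv (m - i) (LSeries a) 2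
        = ∑ i ∈ Finset.range (m+1), (m.choose i : ℂ) * (((-1)^i * iteratedDeriv i F 2) * ((-1)^(m-i) * iteratedDeriv (m - i) (LSeries a) 2)) := by
        rw [mul_neg, mul_neg_one, neg_mul, neg_neg, Finset.mul_sum]
        refine Finset.sum_congr rfl fun i hi => ?_
        have hi' : i ≤ m := by simp at hi; omega
        have : (-1:ℂ)^m = (-1)^i * (-1)^(m-i) := by rw [← pow_add]; congr 1; omega
        rw [this]; ring
      rw [this]
      refine Finset.sum_nonneg fun i hi => ?_
      have hi' : i ≤ m := by simp at hi; omega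
      have h2 := LSeries.iteratedDeriv_alternating ha hab (m - i)
      have h2' : 0 ≤ (-1:ℂ)^(m-i) * iteratedDeriv (m - i) (LSeries a) 2 := by simpa using h2
      exact mul_nonneg (by exact_mod_cast Nat.zero_le _) (mul_nonneg (ih i (by omega)) h2')

lemma iteratedDeriv_inv_sub_one (m : ℕ) :
    iteratedDeriv m (fun s : ℂ => (s - 1)⁻¹) 2 = (-1)^m * (m.factorial : ℂ) := by
  have h1 := congrFun (iteratedDeriv_comp_sub_const (𝕜 := ℂ) m (fun x : ℂ => x⁻¹) 1) 2
  rw [h1, iteratedDeriv_eq_iterate]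
  have := iter_deriv_inv m (2 - 1 : ℂ)
  rw [show (fun x : ℂ => x⁻¹) = Inv.inv from rfl, this]
  norm_num

lemma estermann {F1 : ℂ → ℂ} (hF1 : Differentiable ℂ F1)
    (hpos : ∀ m, 0 ≤ (-1 : ℂ)^m * iteratedDeriv m (fun s => F1 s * (s - 1)⁻¹) 2) {B : ℝ}
    (hB : ∀ z : ℂ, ‖z - 2‖ ≤ 4 / 3 → ‖F1 z‖ ≤ B) :
    (0 ≤ (F1 1).re ∧ (F1 1).im = 0) ∧
    (∀ σ : ℝ, 7 / 8 ≤ σ → σ < 1 → (F1 σ).im = 0) ∧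
    (∀ (σ : ℝ) (M : ℕ), 1 ≤ M → 7 / 8 ≤ σ → σ < 1 → 0 ≤ (F1 σ).re →
      (F1 2).re ≤ (F1 1).re * ((2 - σ)^M / (1 - σ)) + 42 * B * (27 / 32)^M) := by
  set lam := F1 1 with hlam
  set G := dslope F1 1 with hG
  have hGd : Differentiable ℂ G := by
    have := (Complex.differentiableOn_dslope (s := Set.univ) (c := (1:ℂ)) (f := F1) Filter.univ_mem).2
      hF1.differentiableOn
    exact differentiableOn_univ.1 this
  have hFG : ∀ z, F1 z = lam + (z - 1) * G z := by
    intro z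
    have := sub_smul_dslope F1 1 z
    rw [smul_eq_mul] at this
    rw [this]; ring
  have hB0 : 0 ≤ B := (norm_nonneg _).trans (hB 2 (by norm_num))
  have hlamB : ‖lam‖ ≤ B := hB 1 (by norm_num)
  have hGB : ∀ z ∈ Metric.sphere (2:ℂ) (4/3), ‖G z‖ ≤ 6 * B := by
    intro z hz
    rw [mem_sphere_iff_norm] at hz
    have h1 : 1/3 ≤ ‖z - 1‖ := by
      have : ‖z - 2‖ ≤ ‖z - 1‖ + 1 := by
        have := norm_sub_le (z - 1) 1
        rw [norm_one] at this
        rw [show z - 2 = z - 1 - 1 by ring]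
        exact this
      linarith
    have h2 : (z - 1) * G z = F1 z - lam := by rw [hFG z]; ring
    have h3 : ‖z - 1‖ * ‖G z‖ ≤ 2 * B := by
      rw [← norm_mul, h2]
      refine (norm_sub_le _ _).trans ?_
      have := hB z hz.le
      linarith
    nlinarith [norm_nonneg (G z)]
  -- Taylor coefficients
  set g : ℕ → ℂ := fun m => (-1)^m * ((m.factorial : ℂ)⁻¹ * iteratedDeriv m G 2) with hg
  have hgB : ∀ m, ‖g m‖ ≤ 6 * B * (3/4)^m := by
    intro m
    have := Complex.norm_iteratedDeriv_le_of_forall_mem_sphere_norm_le m (by norm_num : (0:ℝ) < 4/3)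
      hGd.diffContOnCl hGB
    simp only [hg, norm_mul, norm_pow, norm_neg, norm_one, one_pow, one_mul, norm_inv, Complex.norm_natCast]
    have hf : (0:ℝ) < m.factorial := by exact_mod_cast Nat.factorial_pos m
    rw [inv_mul_le_iff₀ hf]
    refine this.trans (le_of_eq ?_)
    rw [div_pow, div_pow]; field_simp
  have hsum : ∀ σ : ℝ, HasSum (fun m => g m * ((2 - σ : ℝ) : ℂ)^m) (G σ) := by
    intro σ
    have := Complex.hasSum_taylorSeries_of_entire hGd 2 σ
    refine this.congr_fun (fun m => ?_) |> fun h => h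
    simp only [hg, smul_eq_mul]
    have : ((σ:ℂ) - 2)^m = (-1)^m * ((2 - σ : ℝ) : ℂ)^m := by
      rw [← mul_pow]; push_cast; ring
    rw [this]; ring
  have hb : ∀ m, 0 ≤ lam + g m := by
    intro m
    have h1 := hpos m
    have e : (fun s => F1 s * (s - 1)⁻¹) =ᶠ[nhds 2] (fun s => lam * (s - 1)⁻¹) + G := by
      have : ∀ᶠ s : ℂ in nhds 2, s ≠ 1 := isOpen_ne.mem_nhds (by norm_num)
      filter_upwards [this] with s hs
      have := sub_ne_zero.2 hs
      rw [hFG s, Pi.add_apply]; field_simp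
    have hc : ContDiffAt ℂ m (fun s : ℂ => (s - 1)⁻¹) 2 := by
      apply ContDiffAt.inv
      · exact contDiffAt_id.sub contDiffAt_const
      · norm_num
    have hinv : ContDiffAt ℂ m (fun s : ℂ => lam * (s - 1)⁻¹) 2 := contDiffAt_const.mul hc
    rw [e.iteratedDeriv_eq m, iteratedDeriv_add hinv hGd.contDiff.contDiffAt,
      iteratedDeriv_const_mul_field, iteratedDeriv_inv_sub_one] at h1
    have hf : (m.factorial : ℂ) ≠ 0 := by exact_mod_cast Nat.factorial_ne_zero m
    have h2 : 0 ≤ (m.factorial : ℂ)⁻¹ := by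
      have : (m.factorial : ℂ)⁻¹ = (((m.factorial:ℝ)⁻¹ : ℝ) : ℂ) := by push_cast; rfl
      rw [this]
      exact_mod_cast (by positivity : (0:ℝ) ≤ (m.factorial:ℝ)⁻¹)
    have h3 := mul_nonneg h2 h1
    have : (m.factorial : ℂ)⁻¹ * ((-1)^m * (lam * ((-1)^m * (m.factorial : ℂ)) + iteratedDeriv m G 2)) = lam + g m := by
      have hs : ((-1:ℂ)^m) * (-1)^m = 1 := by rw [← mul_pow]; norm_num
      simp only [hg]
      have : (m.factorial : ℂ)⁻¹ * ((-1)^m * (lam * ((-1)^m * (m.factorial : ℂ)) + iteratedDeriv m G 2)) =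
        (((-1:ℂ)^m) * (-1)^m) * lam * ((m.factorial : ℂ)⁻¹ * m.factorial) + (-1)^m * ((m.factorial : ℂ)⁻¹ * iteratedDeriv m G 2) := by ring
      rw [this, hs, inv_mul_cancel₀ hf]; ring
    rwa [this] at h3
  have hg0 : Filter.Tendsto g Filter.atTop (nhds 0) := by
    apply squeeze_zero_norm hgB
    have := (tendsto_pow_atTop_nhds_zero_of_lt_one (by norm_num : (0:ℝ) ≤ 3/4) (by norm_num)).const_mul (6*B)
    simpa using this
  have hlam0 : 0 ≤ lam := by
    have : Filter.Tendsto (fun m => lam + g m) Filter.atTop (nhds (lam + 0)) := hg0.const_add lam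
    rw [add_zero] at this
    have hre : Filter.Tendsto (fun m => (lam + g m).re) Filter.atTop (nhds lam.re) :=
      (Complex.continuous_re.tendsto _).comp this
    have him : Filter.Tendsto (fun m => (lam + g m).im) Filter.atTop (nhds lam.im) :=
      (Complex.continuous_im.tendsto _).comp this
    rw [Complex.nonneg_iff]
    constructor
    · exact ge_of_tendsto' hre fun m => (Complex.nonneg_iff.1 (hb m)).1
    · have : (fun m => (lam + g m).im) = fun _ => 0 := funext fun m => (Complex.nonneg_iff.1 (hb m)).2.symm
      rw [this] at him
      exact tendsto_nhds_unique tendsto_const_nhds him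
  have hl := Complex.nonneg_iff.1 hlam0
  have hgim : ∀ m, (g m).im = 0 := by
    intro m
    have := (Complex.nonneg_iff.1 (hb m)).2
    rw [Complex.add_im, ← hl.2] at this
    linarith
  have hgre : ∀ m, -lam.re ≤ (g m).re := by
    intro m
    have := (Complex.nonneg_iff.1 (hb m)).1
    rw [Complex.add_re] at this
    linarith
  have hterm : ∀ (σ : ℝ) m, g m * ((2 - σ : ℝ) : ℂ)^m = (((g m).re * (2 - σ)^m : ℝ) : ℂ) := by
    intro σ m
    have : g m = ((g m).re : ℂ) := by apply Complex.ext <;> simp [hgim m]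
    rw [this]; push_cast; simp
  have hGim : ∀ σ : ℝ, (G σ).im = 0 := by
    intro σ
    have h1 := Complex.hasSum_im (hsum σ)
    have : (fun m => (g m * ((2 - σ : ℝ) : ℂ)^m).im) = fun _ => 0 := by
      ext m; rw [hterm, Complex.ofReal_im]
    rw [this] at h1
    exact h1.unique hasSum_zero
  refine ⟨⟨hl.1, hl.2.symm⟩, ?_, ?_⟩
  · intro σ _ _
    rw [hFG, Complex.add_im, ← hl.2, show (σ:ℂ) - 1 = ((σ - 1 : ℝ) : ℂ) by push_cast; ring, Complex.im_ofReal_mul, hGim]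
    ring
  · intro σ M hM h78 h1 hF0
    have hGre : HasSum (fun m => (g m).re * (2 - σ)^m) (G σ).re := by
      have h1 := Complex.hasSum_re (hsum σ)
      refine h1.congr_fun (fun m => ?_) |> fun h => h
      rw [hterm, Complex.ofReal_re]
    have hx : 0 < 1 - σ := by linarith
    -- F(σ) ≤ 0
    have hFσ : (G σ).re ≤ lam.re / (1 - σ) := by
      rw [hFG, Complex.add_re, show (σ:ℂ) - 1 = ((σ - 1 : ℝ) : ℂ) by push_cast; ring, Complex.re_ofReal_mul] at hF0
      rw [le_div_iff₀ hx]; linarith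
    have hsplit := hGre.summable.sum_add_tsum_nat_add M
    rw [hGre.tsum_eq] at hsplit
    -- tail
    have htail : -(42 * B * (27/32)^M) ≤ ∑' i, (g (i + M)).re * (2 - σ)^(i + M) := by
      have hgeo : HasSum (fun i : ℕ => 6 * B * (27/32:ℝ)^M * (27/32:ℝ)^i) (6 * B * (27/32:ℝ)^M * (1 - 27/32)⁻¹) :=
        (hasSum_geometric_of_lt_one (by norm_num) (by norm_num)).mul_left _
      have hle : ∀ i, ‖(g (i + M)).re * (2 - σ)^(i + M)‖ ≤ 6 * B * (27/32:ℝ)^M * (27/32:ℝ)^i := by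
        intro i
        rw [norm_mul, norm_pow, Real.norm_eq_abs, Real.norm_eq_abs, abs_of_pos (by linarith : 0 < 2 - σ)]
        calc |(g (i+M)).re| * (2 - σ)^(i+M) ≤ (6 * B * (3/4)^(i+M)) * (9/8)^(i+M) := by
              refine mul_le_mul ((Complex.abs_re_le_norm _).trans (hgB _))
                (pow_le_pow_left₀ (by linarith) (by linarith) _) (pow_nonneg (by linarith) _) (by positivity)
          _ = 6 * B * (27/32)^(i+M) := by rw [mul_assoc, ← mul_pow]; norm_num
          _ = _ := by rw [pow_add]; ring
      have := tsum_of_norm_bounded hgeo hle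
      have h2 := neg_abs_le (∑' i, (g (i + M)).re * (2 - σ)^(i + M))
      rw [Real.norm_eq_abs] at this
      have h3 : 6 * B * (27/32:ℝ)^M * (1 - 27/32)⁻¹ ≤ 42 * B * (27/32)^M := by
        have : 0 ≤ B * (27/32:ℝ)^M := by positivity
        norm_num
        nlinarith
      linarith
    -- head
    have hhead : (F1 2).re - lam.re * (((2 - σ)^M - 1) / (1 - σ)) ≤ ∑ i ∈ Finset.range M, (g i).re * (2 - σ)^i := by
      have hgeom : ((2 - σ)^M - 1) / (1 - σ) = ∑ i ∈ Finset.range M, (2 - σ)^i := by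
        have := geom_sum_eq (show (2 - σ) ≠ 1 by linarith) M
        rw [this]; congr 1; ring
      rw [hgeom, Finset.mul_sum]
      have hF12 : (F1 2).re = lam.re + (g 0).re := by
        rw [hFG 2]; simp [hg]; norm_num
      obtain ⟨M', rfl⟩ : ∃ M', M = M' + 1 := ⟨M - 1, by omega⟩
      rw [Finset.sum_range_succ', Finset.sum_range_succ' (fun i => (g i).re * (2 - σ)^i), hF12]
      have : ∑ i ∈ Finset.range M', -(lam.re * (2 - σ)^(i+1)) ≤ ∑ i ∈ Finset.range M', (g (i+1)).re * (2 - σ)^(i+1) := by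
        refine Finset.sum_le_sum fun i _ => ?_
        have := hgre (i+1)
        have h4 : 0 ≤ (2 - σ)^(i+1) := by have : 0 ≤ 2 - σ := by linarith
                                          positivity
        nlinarith
      rw [Finset.sum_neg_distrib] at this
      simp only [pow_zero, mul_one]
      linarith
    have e : (F1 1).re * ((2 - σ)^M / (1 - σ)) = lam.re / (1 - σ) + lam.re * (((2 - σ)^M - 1) / (1 - σ)) := by
      field_simp; ring
    rw [e]; linarith

end
end SW

namespace SW

open DirichletCharacter

section
open scoped ComplexOrder
variable {q : ℕ} [NeZero q]

lemma trivChar₁_euler (s : ℂ) : LFunctionTrivChar₁ q s =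
      (∏ p ∈ q.primeFactors, (1 - (p : ℂ) ^ (-s))) * LFunctionTrivChar₁ 1 s := by
  by_cases h : s = 1
  · subst h
    simp only [DirichletCharacter.LFunctionTrivChar₁, Function.update_self]
    simp [Complex.cpow_neg_one]
  · simp only [DirichletCharacter.LFunctionTrivChar₁, Function.update_of_ne h,
      DirichletCharacter.LFunctionTrivChar_eq_mul_riemannZeta h]
    simp; ring

lemma hasDerivAt_LF (χ : DirichletCharacter ℂ q) {s : ℂ} (hs : 1 < s.re) :
    HasDerivAt (LFunction χ) (-(DD χ s * LFunction χ s)) s := by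
  have hs1 : s ≠ 1 := by rintro rfl; simp at hs
  have h2 : LFunction χ s ≠ 0 := LFunction_ne_zero_of_one_le_re χ (Or.inr hs1) hs.le
  have hd : DifferentiableAt ℂ (LFunction χ) s := differentiableAt_LFunction χ s (Or.inl hs1)
  refine hd.hasDerivAt.congr_deriv ?_
  rw [DD_eq χ hs]; field_simp

lemma real_val {ψ : DirichletCharacter ℂ q} (h : ψ^2 = 1) (n : ZMod q) : ψ n = 0 ∨ ψ n = 1 ∨ ψ n = -1 :=
  MulChar.isQuadratic_iff_sq_eq_one.2 h n

lemma LF_two {ψ : DirichletCharacter ℂ q} (h : ψ^2 = 1) :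
    ∃ x : ℝ, 1/3 ≤ x ∧ LFunction ψ 2 = x := by
  rw [LFunction_eq_LSeries ψ (by simp)]
  have hs : LSeriesSummable (fun n : ℕ => ψ n) 2 := LSeriesSummable_of_one_lt_re ψ (by simp)
  have hsum := hs.hasSum
  have hterm : ∀ n : ℕ, LSeries.term (fun n : ℕ => ψ n) 2 n = (((ψ n).re / (n:ℝ)^2 : ℝ) : ℂ) := by
    intro n
    rcases eq_or_ne n 0 with rfl | hn
    · simp
    · rw [LSeries.term_of_ne_zero hn]
      have : ((n:ℂ) ^ (2:ℂ)) = (n:ℂ)^2 := by norm_cast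
      rw [this]
      have : ψ n = ((ψ n).re : ℂ) := by
        rcases real_val h n with h | h | h <;> simp [h]
      push_cast
      rw [← this]
  have e : LSeries (fun n : ℕ => ψ n) 2 = ((∑' n : ℕ, (ψ n).re / (n:ℝ)^2 : ℝ) : ℂ) := by
    rw [LSeries, Complex.ofReal_tsum]
    exact tsum_congr hterm
  refine ⟨_, ?_, e⟩
  have hsr : Summable (fun n : ℕ => (ψ n).re / (n:ℝ)^2) := by
    have := Complex.hasSum_re hsum
    refine this.summable.congr fun n => ?_
    rw [hterm, Complex.ofReal_re]
  have hz := hasSum_zeta_two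
  have hadd := hsr.hasSum.add hz
  have h1 := le_hasSum hadd 1 (by
    intro j _
    rcases real_val h j with h | h | h <;> simp [h]
    rw [neg_div, one_div]; linarith)
  have h11 : (ψ (1:ℕ)).re = 1 := by simp
  rw [h11] at h1
  norm_num at h1
  have := Real.pi_lt_d2
  have := Real.pi_pos
  nlinarith

noncomputable def SF (ψ₁ ψ₂ : DirichletCharacter ℂ q) (s : ℂ) : ℂ :=
  fL (1 : DirichletCharacter ℂ q) s * LFunction ψ₁ s * LFunction ψ₂ s * LFunction (ψ₁ * ψ₂) s

lemma SF_diff {ψ₁ ψ₂ : DirichletCharacter ℂ q} (h1 : ψ₁ ≠ 1) (h2 : ψ₂ ≠ 1) (h3 : ψ₁ * ψ₂ ≠ 1) :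
    Differentiable ℂ (SF ψ₁ ψ₂) :=
  (((differentiable_fL 1).mul (differentiable_LFunction h1)).mul (differentiable_LFunction h2)).mul
    (differentiable_LFunction h3)

lemma SF_eq (ψ₁ ψ₂ : DirichletCharacter ℂ q) {s : ℂ} (hs : s ≠ 1) :
    SF ψ₁ ψ₂ s * (s - 1)⁻¹ = LFunction (1 : DirichletCharacter ℂ q) s * LFunction ψ₁ s * LFunction ψ₂ s * LFunction (ψ₁ * ψ₂) s := by
  have := sub_ne_zero.2 hs
  rw [SF, fL_one, LFunctionTrivChar₁, Function.update_of_ne hs, LFunctionTrivChar]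
  field_simp

lemma SF_two {ψ₁ ψ₂ : DirichletCharacter ℂ q} (h1 : ψ₁^2 = 1) (h2 : ψ₂^2 = 1) :
    ∃ x : ℝ, 1/81 ≤ x ∧ SF ψ₁ ψ₂ 2 = x := by
  obtain ⟨x0, hx0, e0⟩ := LF_two (q := q) (ψ := 1) (by simp)
  obtain ⟨x1, hx1, e1⟩ := LF_two h1
  obtain ⟨x2, hx2, e2⟩ := LF_two h2
  obtain ⟨x3, hx3, e3⟩ := LF_two (ψ := ψ₁ * ψ₂) (by rw [mul_pow, h1, h2, one_mul])
  refine ⟨x0 * x1 * x2 * x3, ?_, ?_⟩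
  · calc (1:ℝ)/81 = 1/3 * (1/3) * (1/3) * (1/3) := by norm_num
      _ ≤ _ := by gcongr
  · have := SF_eq ψ₁ ψ₂ (s := 2) (by norm_num)
    rw [e0, e1, e2, e3] at this
    push_cast; rw [← this]; norm_num

lemma SF_pos {ψ₁ ψ₂ : DirichletCharacter ℂ q} (h1 : ψ₁^2 = 1) (h2 : ψ₂^2 = 1) (m : ℕ) :
    0 ≤ (-1 : ℂ)^m * iteratedDeriv m (fun s => SF ψ₁ ψ₂ s * (s - 1)⁻¹) 2 := by
  set P : ℂ → ℂ := fun s => LFunction (1 : DirichletCharacter ℂ q) s * LFunction ψ₁ s * LFunction ψ₂ s * LFunction (ψ₁ * ψ₂) s with hP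
  have e : (fun s => SF ψ₁ ψ₂ s * (s - 1)⁻¹) =ᶠ[nhds 2] P := by
    have : ∀ᶠ s : ℂ in nhds 2, s ≠ 1 := isOpen_ne.mem_nhds (by norm_num)
    filter_upwards [this] with s hs
    exact SF_eq _ _ hs
  rw [e.iteratedDeriv_eq]
  let Λ : ℕ → ℂ := fun n => ((ArithmeticFunction.vonMangoldt n : ℝ) : ℂ)
  let b : DirichletCharacter ℂ q → ℕ → ℂ := fun χ => (fun n : ℕ => χ n) * Λ
  have hbs : ∀ χ {s : ℂ}, 1 < s.re → LSeriesSummable (b χ) s := fun χ s hs => LSeriesSummable_twist_vonMangoldt χ hs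
  set a : ℕ → ℂ := b 1 + b ψ₁ + b ψ₂ + b (ψ₁ * ψ₂) with ha
  have hU : ∀ᶠ s : ℂ in nhds 2, 1 < s.re :=
    (isOpen_lt continuous_const Complex.continuous_re).mem_nhds (by simp)
  have has : ∀ s : ℂ, 1 < s.re → LSeriesSummable a s := fun s hs =>
    (((hbs 1 hs).add (hbs ψ₁ hs)).add (hbs ψ₂ hs)).add (hbs (ψ₁ * ψ₂) hs)
  have hderiv : ∀ s : ℂ, 1 < s.re → HasDerivAt P (-(P s * LSeries a s)) s := by
    intro s hs
    have hL : LSeries a s = DD (1 : DirichletCharacter ℂ q) s + DD ψ₁ s + DD ψ₂ s + DD (ψ₁ * ψ₂) s := by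
      rw [ha, LSeries_add (((hbs 1 hs).add (hbs ψ₁ hs)).add (hbs ψ₂ hs)) (hbs (ψ₁ * ψ₂) hs),
        LSeries_add ((hbs 1 hs).add (hbs ψ₁ hs)) (hbs ψ₂ hs), LSeries_add (hbs 1 hs) (hbs ψ₁ hs)]
      rfl
    refine ((((hasDerivAt_LF 1 hs).mul (hasDerivAt_LF ψ₁ hs)).mul (hasDerivAt_LF ψ₂ hs)).mul
      (hasDerivAt_LF (ψ₁ * ψ₂) hs)).congr_deriv ?_
    simp only [hP, hL, Pi.mul_apply]; ring
  apply alternating_of_logDeriv (a := a)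
  · intro n
    have : a n = Λ n * ((1 : DirichletCharacter ℂ q) n + ψ₁ n + ψ₂ n + ψ₁ n * ψ₂ n) := by
      simp only [ha, b, Pi.add_apply, Pi.mul_apply, MulChar.mul_apply]; ring
    rw [this]
    refine mul_nonneg ?_ ?_
    · exact Complex.zero_le_real.2 ArithmeticFunction.vonMangoldt_nonneg
    · by_cases hu : IsUnit (n : ZMod q)
      · rw [MulChar.one_apply hu]
        rcases real_val h1 n with h | h | h <;> rcases real_val h2 n with h' | h' | h' <;> rw [h, h'] <;> norm_num
      · simp [MulChar.map_nonunit _ hu]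
  · refine lt_of_le_of_lt (LSeriesSummable.abscissaOfAbsConv_le (s := (3/2:ℝ)) (has _ ?_)) ?_
    · rw [Complex.ofReal_re]; norm_num
    · rw [Complex.ofReal_re]; exact_mod_cast (by norm_num : (3/2:ℝ) < 2)
  · have : DifferentiableOn ℂ P {s | 1 < s.re} := fun s hs => (hderiv s hs).differentiableAt.differentiableWithinAt
    exact this.analyticAt hU
  · filter_upwards [hU] with s hs
    exact (hderiv s hs).deriv
  · obtain ⟨x, hx, e2⟩ := SF_two h1 h2
    have := SF_eq ψ₁ ψ₂ (s := 2) (by norm_num)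
    simp only [hP]
    rw [← this, e2]
    norm_num
    linarith


lemma SF_lower_exists : ∃ c : ℝ, 0 < c ∧ ∀ (Q : ℕ) [NeZero Q] (ψ₁ ψ₂ : DirichletCharacter ℂ Q),
    ψ₁^2 = 1 → ψ₂^2 = 1 → ψ₁ ≠ 1 → ψ₂ ≠ 1 → ψ₁ * ψ₂ ≠ 1 →
    0 ≤ (SF ψ₁ ψ₂ 1).re ∧ (SF ψ₁ ψ₂ 1).im = 0 ∧ (∀ σ : ℝ, 7 / 8 ≤ σ → σ < 1 → (SF ψ₁ ψ₂ σ).im = 0) ∧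
    ∀ σ : ℝ, 7/8 ≤ σ → σ < 1 → 0 ≤ (SF ψ₁ ψ₂ σ).re →
      c * (1 - σ) * (Q:ℝ) ^ (-(24 * (1 - σ))) ≤ (SF ψ₁ ψ₂ 1).re := by
  set K0 : ℝ := 6 * Real.log (6804 * 64^4) + 1 with hK0
  refine ⟨1 / (162 * Real.exp K0), by positivity, ?_⟩
  intro Q _ ψ₁ ψ₂ h1 h2 n1 n2 n3
  have hQ : (1:ℝ) ≤ Q := by exact_mod_cast NeZero.pos Q
  have hQ0 : (0:ℝ) < Q := by linarith
  set B : ℝ := (64 * Q)^4 with hB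
  have hB1 : 0 < B := by positivity
  have hbd : ∀ z : ℂ, ‖z - 2‖ ≤ 4 / 3 → ‖SF ψ₁ ψ₂ z‖ ≤ B := by
    intro z hz
    have hre : 1/2 ≤ z.re := by
      have := (Complex.abs_re_le_norm (z - 2)).trans hz
      rw [Complex.sub_re, Complex.re_ofNat, abs_le] at this
      linarith [this.1]
    have hz4 : ‖z‖ ≤ 4 := by
      have := norm_add_le (z - 2) 2
      rw [sub_add_cancel, Complex.norm_ofNat] at this
      linarith
    have hb : ∀ χ : DirichletCharacter ℂ Q, ‖fL χ z‖ ≤ 64 * Q := by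
      intro χ
      have := norm_fL_le χ hre hz4 (by norm_num)
      linarith
    rw [SF, ← fL_ne n1, ← fL_ne n2, ← fL_ne n3, norm_mul, norm_mul, norm_mul, hB]
    calc _ ≤ (64 * (Q:ℝ)) * (64 * Q) * (64 * Q) * (64 * Q) := by
          gcongr <;> exact hb _
      _ = _ := by ring
  obtain ⟨hA, hI, hE⟩ := estermann (SF_diff n1 n2 n3) (SF_pos h1 h2) hbd
  refine ⟨hA.1, hA.2, hI, ?_⟩
  intro σ hσ hσ1 hF
  set y : ℝ := 6 * Real.log (6804 * B) with hy
  have h68 : 1 ≤ 6804 * B := by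
    have : (1:ℝ) ≤ (64 * Q)^4 := one_le_pow₀ (by linarith)
    linarith
  have hy0 : 0 ≤ y := by have := Real.log_nonneg h68; positivity
  have hE' := hE σ (⌈y⌉₊ + 1) (by omega) hσ hσ1 hF
  obtain ⟨x, hx, ex⟩ := SF_two h1 h2
  rw [ex, Complex.ofReal_re] at hE'
  set M := ⌈y⌉₊ + 1 with hM
  have hMy : y ≤ M := by rw [hM]; push_cast; linarith [Nat.le_ceil y]
  have hMy2 : (M:ℝ) ≤ y + 2 := by rw [hM]; push_cast; linarith [Nat.ceil_lt_add_one hy0]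
  have h27 : (27/32:ℝ)^M ≤ (6804 * B)⁻¹ := by
    have h32 : Real.exp (1/6) ≤ 32/27 := by
      have h6 : Real.exp (1/6) ^ 6 = Real.exp 1 := by rw [← Real.exp_nat_mul]; norm_num
      have := Real.exp_one_lt_d9
      by_contra hc
      push Not at hc
      have : (32/27:ℝ)^6 ≤ Real.exp (1/6)^6 := pow_le_pow_left₀ (by norm_num) hc.le _
      rw [h6] at this
      norm_num at this
      linarith
    have h33 : (27/32:ℝ) ≤ Real.exp (-(1/6)) := by
      rw [Real.exp_neg, le_inv_comm₀ (by norm_num) (Real.exp_pos _)]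
      norm_num at h32 ⊢; exact h32
    calc (27/32:ℝ)^M ≤ Real.exp (-(1/6)) ^ M := pow_le_pow_left₀ (by norm_num) h33 _
      _ = Real.exp (-(M/6)) := by rw [← Real.exp_nat_mul]; congr 1; ring
      _ ≤ Real.exp (-(Real.log (6804 * B))) := by
          apply Real.exp_le_exp.2; linarith
      _ = _ := by rw [Real.exp_neg, Real.exp_log (by linarith)]
  have h2 : 42 * B * (27/32:ℝ)^M ≤ 1/162 := by
    calc 42 * B * (27/32:ℝ)^M ≤ 42 * B * (6804 * B)⁻¹ := by gcongr
      _ = 1/162 := by field_simp; norm_num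
  have hτ : 0 < 1 - σ := by linarith
  have h3 : (2 - σ)^M ≤ Real.exp K0 * (Q:ℝ)^(24 * (1 - σ)) := by
    have hlog : Real.log (6804 * B) = Real.log (6804 * 64^4) + 4 * Real.log Q := by
      rw [hB, mul_pow, ← mul_assoc, Real.log_mul (by norm_num) (by positivity), Real.log_pow]; push_cast; ring
    have hK00 : 0 ≤ Real.log (6804 * 64^4) := Real.log_nonneg (by norm_num)
    have hlQ : 0 ≤ Real.log Q := Real.log_nonneg hQ
    calc (2 - σ)^M ≤ (Real.exp (1 - σ))^M := by
          apply pow_le_pow_left₀ (by linarith)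
          linarith [Real.add_one_le_exp (1 - σ)]
      _ = Real.exp (M * (1 - σ)) := by rw [← Real.exp_nat_mul]
      _ ≤ Real.exp (K0 + Real.log Q * (24 * (1 - σ))) := by
          apply Real.exp_le_exp.2
          have : (M:ℝ) * (1 - σ) ≤ (y + 2) * (1 - σ) := by gcongr
          rw [hy, hlog] at this
          nlinarith
      _ = _ := by rw [Real.exp_add, Real.rpow_def_of_pos hQ0]
  have h4 : 1/162 ≤ (SF ψ₁ ψ₂ 1).re * ((Real.exp K0 * (Q:ℝ)^(24 * (1 - σ))) / (1 - σ)) := by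
    have : (SF ψ₁ ψ₂ 1).re * ((2 - σ)^M / (1 - σ)) ≤ (SF ψ₁ ψ₂ 1).re * ((Real.exp K0 * (Q:ℝ)^(24 * (1 - σ))) / (1 - σ)) := by
      apply mul_le_mul_of_nonneg_left _ hA.1
      gcongr
    linarith
  have hQp : 0 < (Q:ℝ)^(24 * (1 - σ)) := Real.rpow_pos_of_pos hQ0 _
  rw [Real.rpow_neg hQ0.le]
  have h5 : (SF ψ₁ ψ₂ 1).re * ((Real.exp K0 * (Q:ℝ)^(24 * (1 - σ))) / (1 - σ)) = (SF ψ₁ ψ₂ 1).re / ((1 - σ) / (Real.exp K0 * (Q:ℝ)^(24 * (1 - σ)))) := by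
    field_simp
  rw [h5, le_div_iff₀ (by positivity)] at h4
  refine le_trans (le_of_eq ?_) h4
  field_simp

end
end SW

namespace SW

open DirichletCharacter

lemma euler_ne {q : ℕ} (χ : DirichletCharacter ℂ q) {p : ℕ} (hp : p.Prime) {s : ℂ} (hs : 0 < s.re) :
    1 - χ p * (p:ℂ)^(-s) ≠ 0 := by
  intro h
  have h1 : χ p * (p:ℂ)^(-s) = 1 := (sub_eq_zero.1 h).symm
  have h2 : ‖χ p * (p:ℂ)^(-s)‖ < 1 := by
    rw [norm_mul, Complex.norm_natCast_cpow_of_pos hp.pos]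
    have h3 : ‖χ p‖ ≤ 1 := χ.norm_le_one p
    have h4 : (p:ℝ)^(-s).re < 1 := by
      apply Real.rpow_lt_one_of_one_lt_of_neg
      · exact_mod_cast hp.one_lt
      · simpa using hs
    have h5 : 0 ≤ (p:ℝ)^(-s).re := by positivity
    nlinarith [norm_nonneg (χ p)]
  rw [h1, norm_one] at h2
  exact lt_irrefl _ h2

lemma triv_near_one : ∃ r : ℝ, 0 < r ∧ r ≤ 1/2 ∧ ∀ (q : ℕ) [NeZero q] (s : ℂ), ‖s - 1‖ ≤ r →
    fL (1 : DirichletCharacter ℂ q) s ≠ 0 := by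
  have hc : ContinuousAt (LFunctionTrivChar₁ 1) 1 := (differentiable_LFunctionTrivChar₁ 1).continuous.continuousAt
  have h := hc.eventually_ne (LFunctionTrivChar₁_apply_one_ne_zero 1)
  obtain ⟨r, hr, hb⟩ := Metric.eventually_nhds_iff_ball.1 h
  refine ⟨min (r/2) (1/2), by positivity, min_le_right _ _, ?_⟩
  intro q _ s hs
  rw [fL_one, trivChar₁_euler]
  refine mul_ne_zero ?_ ?_
  · refine Finset.prod_ne_zero_iff.2 fun p hp => ?_
    have hre : 0 < s.re := by
      have := (Complex.abs_re_le_norm (s - 1)).trans (hs.trans (min_le_right _ _))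
      rw [Complex.sub_re, Complex.one_re, abs_le] at this
      linarith [this.1]
    have := euler_ne (1 : DirichletCharacter ℂ 1) (Nat.prime_of_mem_primeFactors hp) hre
    rwa [MulChar.one_apply (isUnit_of_subsingleton _), one_mul] at this
  · apply hb
    rw [mem_ball_iff_norm]
    exact lt_of_le_of_lt (hs.trans (min_le_left _ _)) (by linarith)

lemma norm_triv_one_le (q : ℕ) [NeZero q] : ‖fL (1 : DirichletCharacter ℂ q) 1‖ ≤ 1 := by
  rw [fL_one, LFunctionTrivChar₁, Function.update_self, norm_prod]
  refine Finset.prod_le_one (fun _ _ => norm_nonneg _) fun p hp => ?_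
  have hp1 : (1:ℝ) ≤ p := by exact_mod_cast (Nat.prime_of_mem_primeFactors hp).one_lt.le
  have : (1 - (p:ℂ)⁻¹) = ((1 - (p:ℝ)⁻¹ : ℝ) : ℂ) := by push_cast; rfl
  rw [this, Complex.norm_real, Real.norm_eq_abs, abs_le]
  have := inv_le_one_of_one_le₀ hp1
  have : 0 ≤ (p:ℝ)⁻¹ := by positivity
  constructor <;> linarith

/-- zero free disc around `1` from a lower bound at `1`. -/
lemma LF_ne_near_one {Q : ℕ} [NeZero Q] {ψ : DirichletCharacter ℂ Q} (hψ : ψ ≠ 1) {η : ℝ} (hη : 0 < η) (hη1 : η ≤ 1/2)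
    {s : ℂ} (hs : ‖s - 1‖ < η) (h : 5 * (Q:ℝ)^(2*η) / η^2 * ‖s - 1‖ < ‖LFunction ψ 1‖) : LFunction ψ s ≠ 0 := by
  have hQ : (1:ℝ) ≤ Q := by exact_mod_cast NeZero.pos Q
  have hb : ∀ z ∈ Metric.ball (1:ℂ) η, ‖LFunction ψ z‖ ≤ 2 * ((Q:ℝ)^(2*η) / η) := by
    intro z hz
    rw [mem_ball_iff_norm] at hz
    have hre : 1 - η ≤ z.re := by
      have := (Complex.abs_re_le_norm (z - 1)).trans hz.le
      rw [Complex.sub_re, Complex.one_re, abs_le] at this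
      linarith [this.1]
    have hz2 : ‖z‖ ≤ 2 := by
      have := norm_add_le (z - 1) 1
      rw [sub_add_cancel, norm_one] at this
      linarith
    refine (norm_LFunction_le hψ (a := 2 * η) (by linarith) (by linarith) (by linarith)).trans ?_
    have h5 : η ≤ z.re - (1 - 2 * η) := by linarith
    have h6 : (Q:ℝ)^(2*η) / (z.re - (1 - 2 * η)) ≤ (Q:ℝ)^(2*η) / η := by gcongr
    have h7 : 0 ≤ (Q:ℝ)^(2*η) / (z.re - (1 - 2 * η)) := div_nonneg (by positivity) (by linarith)
    exact mul_le_mul hz2 h6 h7 (by norm_num)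
  have hm : Set.MapsTo (LFunction ψ) (Metric.ball 1 η) (Metric.closedBall (LFunction ψ 1) (4 * ((Q:ℝ)^(2*η) / η))) := by
    intro z hz
    rw [mem_closedBall_iff_norm]
    refine (norm_sub_le _ _).trans ?_
    have h1 := hb z hz
    have h2 := hb 1 (by simpa using hη)
    linarith
  have := Complex.dist_le_div_mul_dist_of_mapsTo_ball ((differentiable_LFunction hψ).differentiableOn) hm
    (mem_ball_iff_norm.2 hs)
  intro h0
  rw [h0, dist_zero_left, dist_eq_norm] at this
  have h2 : 4 * ((Q:ℝ)^(2*η) / η) / η * ‖s - 1‖ ≤ 5 * (Q:ℝ)^(2*η) / η^2 * ‖s - 1‖ := by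
    apply mul_le_mul_of_nonneg_right _ (norm_nonneg _)
    rw [mul_div_assoc', div_div, ← pow_two]
    gcongr
    norm_num
  linarith

lemma siegel_aux {σ₀ : ℝ} (hσ₀ : 7/8 ≤ σ₀) (hσ₁ : σ₀ < 1)
    (hz : ∀ (q : ℕ) [NeZero q] (σ : ℝ), σ₀ ≤ σ → σ ≤ 1 → fL (1 : DirichletCharacter ℂ q) σ ≠ 0)
    (hex : ∃ (q₁ : ℕ) (_ : NeZero q₁) (χ₁ : DirichletCharacter ℂ q₁), χ₁^2 = 1 ∧ χ₁ ≠ 1) :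
    ∃ (q₁ : ℕ) (_ : NeZero q₁) (χ₁ : DirichletCharacter ℂ q₁) (σ : ℝ), χ₁^2 = 1 ∧ χ₁ ≠ 1 ∧ σ₀ ≤ σ ∧ σ < 1 ∧
      ∀ (Q : ℕ) [NeZero Q] (h : q₁ ∣ Q) (ψ : DirichletCharacter ℂ Q), ψ^2 = 1 → ψ ≠ 1 → changeLevel h χ₁ * ψ ≠ 1 →
        0 ≤ (SF (changeLevel h χ₁) ψ σ).re := by
  by_cases hA : ∃ (q₁ : ℕ) (_ : NeZero q₁) (χ₁ : DirichletCharacter ℂ q₁) (σ : ℝ), χ₁^2 = 1 ∧ χ₁ ≠ 1 ∧ σ₀ ≤ σ ∧ σ < 1 ∧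
      LFunction χ₁ σ = 0
  · obtain ⟨q₁, i, χ₁, σ, h1, h2, h3, h4, h5⟩ := hA
    refine ⟨q₁, i, χ₁, σ, h1, h2, h3, h4, ?_⟩
    intro Q _ h ψ _ _ _
    rw [SF, LFunction_changeLevel h χ₁ (Or.inl h2), h5]
    simp
  · obtain ⟨q₁, i, χ₁, h1, h2⟩ := hex
    refine ⟨q₁, i, χ₁, σ₀, h1, h2, le_rfl, hσ₁, ?_⟩
    intro Q _ h ψ hψ hψ1 h12
    push Not at hA
    set φ := changeLevel h χ₁ with hφ
    have hφ1 : φ ≠ 1 := fun h' => h2 ((changeLevel_eq_one_iff h).1 h')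
    have hφ2 : φ^2 = 1 := by rw [hφ, ← map_pow, h1, map_one]
    have hne : ∀ σ : ℝ, σ₀ ≤ σ → σ ≤ 1 → SF φ ψ σ ≠ 0 := by
      intro σ ha hb
      have hall : ∀ χ : DirichletCharacter ℂ Q, χ^2 = 1 → χ ≠ 1 → LFunction χ σ ≠ 0 := by
        intro χ hx hx1
        rcases eq_or_lt_of_le hb with rfl | hb
        · exact_mod_cast LFunction_apply_one_ne_zero hx1
        · exact hA Q _ χ σ hx hx1 ha hb
      exact mul_ne_zero (mul_ne_zero (mul_ne_zero (hz Q σ ha hb) (hall _ hφ2 hφ1)) (hall _ hψ hψ1))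
        (hall _ (by rw [mul_pow, hφ2, hψ, one_mul]) h12)
    obtain ⟨c, _, hc⟩ := SF_lower_exists
    obtain ⟨hp, hp0, him, _⟩ := hc Q φ ψ hφ2 hψ hφ1 hψ1 h12
    by_contra hneg
    push Not at hneg
    have hcont : ContinuousOn (fun σ : ℝ => (SF φ ψ σ).re) (Set.Icc σ₀ 1) :=
      (Complex.continuous_re.comp ((SF_diff hφ1 hψ1 h12).continuous.comp Complex.continuous_ofReal)).continuousOn
    have := intermediate_value_Icc hσ₁.le hcont
    obtain ⟨σ, hσ, hσ0⟩ := this (show (0:ℝ) ∈ Set.Icc _ _ from ⟨hneg.le, by simpa using hp⟩)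
    apply hne σ hσ.1 hσ.2
    apply Complex.ext
    · exact hσ0
    · rcases eq_or_lt_of_le hσ.2 with rfl | hb
      · simpa using hp0
      · exact him σ (by linarith [hσ.1]) hb

theorem siegel {ε : ℝ} (hε : 0 < ε) : ∃ c : ℝ, 0 < c ∧ ∀ (q : ℕ) [NeZero q] (χ : DirichletCharacter ℂ q), χ^2 = 1 → χ ≠ 1 →
    ∀ s : ℂ, ‖s - 1‖ ≤ c * (q:ℝ)^(-ε) → LFunction χ s ≠ 0 := by
  by_cases hex : ∃ (q₁ : ℕ) (_ : NeZero q₁) (χ₁ : DirichletCharacter ℂ q₁), χ₁^2 = 1 ∧ χ₁ ≠ 1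
  swap
  · refine ⟨1, one_pos, ?_⟩
    intro q i χ h1 h2
    exact absurd ⟨q, i, χ, h1, h2⟩ hex
  obtain ⟨r, hr, hr2, hrz⟩ := triv_near_one
  set τ : ℝ := min (min r (1/8)) (ε / 48) with hτ
  have hτ0 : 0 < τ := by positivity
  have hτr : τ ≤ r := (min_le_left _ _).trans (min_le_left _ _)
  have hτ8 : τ ≤ 1/8 := (min_le_left _ _).trans (min_le_right _ _)
  have hτε : τ ≤ ε/48 := min_le_right _ _
  obtain ⟨q₁, i, χ₁, σ, h1, h2, h3, h4, hσ⟩ := siegel_aux (σ₀ := 1 - τ) (by linarith) (by linarith) (by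
    intro q _ σ h1 h2
    apply hrz
    rw [show (σ:ℂ) - 1 = ((σ - 1 : ℝ) : ℂ) by push_cast; ring, Complex.norm_real, Real.norm_eq_abs, abs_le]
    constructor <;> linarith) hex
  obtain ⟨c, hc0, hc⟩ := SF_lower_exists
  -- disc for χ₁
  have hcont : ContinuousAt (LFunction χ₁) 1 := (differentiable_LFunction h2).continuous.continuousAt
  obtain ⟨r₁, hr₁, hb₁⟩ := Metric.eventually_nhds_iff_ball.1 (hcont.eventually_ne (LFunction_apply_one_ne_zero h2))
  set η : ℝ := min (1/2) (ε/8) with hη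
  have hη0 : 0 < η := by positivity
  have hη2 : η ≤ 1/2 := min_le_left _ _
  have hηε : η ≤ ε/8 := min_le_right _ _
  have hq1 : (1:ℝ) ≤ q₁ := by exact_mod_cast NeZero.pos q₁
  set cc : ℝ := c * (1 - σ) * η^2 with hcc
  have hcc0 : 0 < cc := by have : 0 < 1 - σ := by linarith
                           positivity
  set C1 : ℝ := cc * η^2 / 10 * (q₁:ℝ)^(-ε) with hC1
  have hC10 : 0 < C1 := by positivity
  refine ⟨min (min (r₁/2) (η/2)) C1, by positivity, ?_⟩
  intro q _ χ hχ hχ1 s hs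
  have hq : (1:ℝ) ≤ q := by exact_mod_cast NeZero.pos q
  have hqe : (q:ℝ)^(-ε) ≤ 1 := Real.rpow_le_one_of_one_le_of_nonpos hq (by linarith)
  have hqe0 : 0 < (q:ℝ)^(-ε) := by positivity
  set m := min (min (r₁/2) (η/2)) C1 with hm
  have hm0 : 0 < m := by positivity
  have hsm : ‖s - 1‖ ≤ m := hs.trans (by nlinarith)
  have hsr : ‖s - 1‖ < r₁ := by have := hsm.trans ((min_le_left _ _).trans (min_le_left _ _)); linarith
  have hsη : ‖s - 1‖ < η := by have := hsm.trans ((min_le_left _ _).trans (min_le_right _ _)); linarith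
  have hsC : ‖s - 1‖ ≤ C1 * (q:ℝ)^(-ε) := hs.trans (mul_le_mul_of_nonneg_right (min_le_right _ _) hqe0.le)
  have hre : 0 < s.re := by
    have := (Complex.abs_re_le_norm (s - 1)).trans hsη.le
    rw [Complex.sub_re, Complex.one_re, abs_le] at this
    linarith [this.1]
  have hd1 : q₁ ∣ q₁ * q := dvd_mul_right _ _
  have hd2 : q ∣ q₁ * q := dvd_mul_left _ _
  set ψ := changeLevel hd2 χ with hψ
  set φ := changeLevel hd1 χ₁ with hφ
  have hφ1 : φ ≠ 1 := fun h' => h2 ((changeLevel_eq_one_iff hd1).1 h')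
  have hφ2 : φ^2 = 1 := by rw [hφ, ← map_pow, h1, map_one]
  have hψ1 : ψ ≠ 1 := fun h' => hχ1 ((changeLevel_eq_one_iff hd2).1 h')
  have hψ2 : ψ^2 = 1 := by rw [hψ, ← map_pow, hχ, map_one]
  intro hzero
  have hψ0 : LFunction ψ s = 0 := by
    rw [hψ, LFunction_changeLevel hd2 χ (Or.inl hχ1), hzero, zero_mul]
  by_cases hprod : φ * ψ = 1
  · have : φ = ψ := by
      rw [pow_two] at hψ2
      calc φ = φ * (ψ * ψ) := by rw [hψ2, mul_one]
        _ = ψ := by rw [← mul_assoc, hprod, one_mul]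
    rw [← this, hφ, LFunction_changeLevel hd1 χ₁ (Or.inl h2)] at hψ0
    rcases mul_eq_zero.1 hψ0 with h | h
    · exact hb₁ s (mem_ball_iff_norm.2 hsr) h
    · rw [Finset.prod_eq_zero_iff] at h
      obtain ⟨p, hp, h⟩ := h
      exact euler_ne χ₁ (Nat.prime_of_mem_primeFactors hp) hre h
  · refine LF_ne_near_one hψ1 hη0 hη2 hsη ?_ hψ0
    obtain ⟨_, _, _, hl⟩ := hc (q₁ * q) φ ψ hφ2 hψ2 hφ1 hψ1 hprod
    have hl := hl σ (by linarith) h4 (hσ _ hd1 ψ hψ2 hψ1 hprod)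
    set Q : ℝ := ((q₁ * q : ℕ) : ℝ) with hQ
    have hQ1 : 1 ≤ Q := by rw [hQ]; exact_mod_cast NeZero.pos (q₁ * q)
    have hQ0 : 0 < Q := by linarith
    have hub : ∀ χ : DirichletCharacter ℂ (q₁ * q), χ ≠ 1 → ‖LFunction χ 1‖ ≤ Q^η / η := by
      intro χ hχ
      have := norm_LFunction_le hχ (a := η) (s := 1) hη0.le (by linarith) (by simpa using hη0)
      rw [norm_one, one_mul, Complex.one_re, sub_sub_cancel] at this
      exact this
    have hup : (SF φ ψ 1).re ≤ (Q^η / η)^2 * ‖LFunction ψ 1‖ := by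
      refine (Complex.re_le_norm _).trans ?_
      rw [SF, norm_mul, norm_mul, norm_mul]
      calc _ ≤ 1 * (Q^η / η) * ‖LFunction ψ 1‖ * (Q^η / η) := by
            gcongr
            · exact norm_triv_one_le _
            · exact hub _ hφ1
            · exact hub _ hprod
        _ = _ := by ring
    have hQε : Q^(-ε) = (q₁:ℝ)^(-ε) * (q:ℝ)^(-ε) := by
      rw [hQ]; push_cast; rw [Real.mul_rpow (by positivity) (by positivity)]
    have hsC' : ‖s - 1‖ ≤ cc * η^2 / 10 * Q^(-ε) := by
      rw [hQε]; refine hsC.trans (le_of_eq ?_); rw [hC1]; ring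
    have hlow : cc * Q^(-(24 * (1 - σ)) - 2 * η) ≤ ‖LFunction ψ 1‖ := by
      have h5 := hl.trans hup
      have e1 : (Q^η / η)^2 = Q^(2*η) / η^2 := by
        rw [div_pow, two_mul, Real.rpow_add hQ0, pow_two (Q^η)]
      rw [e1] at h5
      rw [Real.rpow_sub hQ0, hcc]
      have hQη : 0 < Q^(2*η) := by positivity
      have : c * (1 - σ) * η ^ 2 * (Q ^ (-(24 * (1 - σ))) / Q ^ (2 * η)) = (c * (1 - σ) * Q ^ (-(24 * (1 - σ)))) * (η^2 / Q^(2*η)) := by ring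
      rw [this]
      calc _ ≤ (Q^(2*η) / η^2 * ‖LFunction ψ 1‖) * (η^2 / Q^(2*η)) := by gcongr
        _ = _ := by field_simp
    refine lt_of_lt_of_le ?_ hlow
    calc 5 * Q^(2*η) / η^2 * ‖s - 1‖ ≤ 5 * Q^(2*η) / η^2 * (cc * η^2 / 10 * Q^(-ε)) := by gcongr
      _ = cc / 2 * Q^(2*η - ε) := by
          rw [sub_eq_add_neg, Real.rpow_add hQ0]; field_simp; norm_num
      _ ≤ cc / 2 * Q^(-(24 * (1 - σ)) - 2 * η) := by
          gcongr 2
          linarith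
      _ < cc * Q^(-(24 * (1 - σ)) - 2 * η) := by
          have : 0 < Q^(-(24 * (1 - σ)) - 2 * η) := by positivity
          nlinarith

end SW

namespace SW

open DirichletCharacter

lemma LL_le {B L d t : ℝ} (hL : 1 ≤ L) (hd : 0 < d) {q : ℕ} [NeZero q] (hq : (q:ℝ) ≤ L ^ B)
    (ht : |t| ≤ 2 * Real.exp L + 4) : LL q t (d / L) ≤ L + (B + 1) * Real.log L + Real.log (100 / d) := by
  have hL0 : 0 < L := by linarith
  have hq1 : (1:ℝ) ≤ q := by exact_mod_cast NeZero.pos q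
  have hE : 1 + 1 ≤ Real.exp L := (by linarith : (1:ℝ) + 1 ≤ L + 1).trans (Real.add_one_le_exp L)
  have hp : 0 < L^B := by positivity
  unfold LL
  have e : L + (B + 1) * Real.log L + Real.log (100 / d) = Real.log (Real.exp L * L^(B+1) * (100 / d)) := by
    rw [Real.log_mul (by positivity) (by positivity), Real.log_mul (by positivity) (by positivity),
      Real.log_exp, Real.log_rpow hL0]
  rw [e]
  have := abs_nonneg t
  apply Real.log_le_log (by positivity)
  rw [Real.rpow_add_one hL0.ne']
  have h1 : 10 * (q:ℝ) * (|t| + 3) ≤ 10 * L^B * (10 * Real.exp L) := by gcongr; linarith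
  calc 10 * (q:ℝ) * (|t| + 3) / (d / L) ≤ 10 * L^B * (10 * Real.exp L) / (d / L) := by gcongr
    _ = _ := by field_simp; norm_num

lemma ev_log (A K : ℝ) : ∀ᶠ L : ℝ in Filter.atTop, A * Real.log L + K ≤ L := by
  have h1 : (fun L : ℝ => A * Real.log L + K) =o[Filter.atTop] (fun L : ℝ => L) := by
    refine Asymptotics.IsLittleO.add (Real.isLittleO_log_id_atTop.const_mul_left A) ?_
    exact Asymptotics.isLittleO_const_id_atTop K
  filter_upwards [h1.def one_pos, Filter.eventually_ge_atTop 0] with L h hL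
  rw [Real.norm_eq_abs, Real.norm_eq_abs, abs_of_nonneg hL, one_mul] at h
  exact (le_abs_self _).trans h

theorem zero_free_region {B : ℝ} (hB : 0 < B) : ∃ w L₀ : ℝ, 0 < w ∧ w ≤ 1 ∧ 1 ≤ L₀ ∧
    ∀ L : ℝ, L₀ ≤ L → ∀ (q : ℕ) [NeZero q], (q:ℝ) ≤ L^B → ∀ (χ : DirichletCharacter ℂ q) (s : ℂ),
      |s.im| ≤ Real.exp L + 2 → 1 - w / L ≤ s.re → fL χ s ≠ 0 := by
  obtain ⟨r, hr, hr2, hrz⟩ := triv_near_one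
  obtain ⟨c, hc, hS⟩ := siegel (ε := 1 / (2 * B)) (by positivity)
  set κ : ℝ := 1/80000 with hκ
  have ev1 := ev_log (B+1) (Real.log (100/κ))
  have ev2 : ∀ᶠ L : ℝ in Filter.atTop, 1 / r ≤ L := Filter.eventually_ge_atTop _
  have ev3 : ∀ᶠ L : ℝ in Filter.atTop, 1 / c^2 ≤ L := Filter.eventually_ge_atTop _
  have ev4 : ∀ᶠ L : ℝ in Filter.atTop, 1 ≤ L := Filter.eventually_ge_atTop _
  obtain ⟨L₀, h⟩ := Filter.eventually_atTop.1 (ev1.and (ev2.and (ev3.and ev4)))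
  refine ⟨κ / 7, max L₀ 1, by positivity, by norm_num [hκ], le_max_right _ _, ?_⟩
  intro L hL q _ hq χ s him hre
  obtain ⟨h1, h2, h3, h4⟩ := h L ((le_max_left _ _).trans hL)
  have hL0 : 0 < L := by linarith
  by_cases hs1 : 1 ≤ s.re
  · exact fL_ne_zero χ hs1
  push Not at hs1
  have hδ1 : κ / L ≤ 1 := by rw [div_le_one hL0]; norm_num [hκ]; linarith
  have key : (χ^2 ≠ 1 ∨ 4 * (κ / L) ≤ |s.im|) → fL χ s ≠ 0 := by
    intro hh
    refine zero_free χ (δ := κ / L) (by positivity) ?_ hh (by rw [div_right_comm]; exact hre) hδ1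
    have : LL q (2 * s.im) (κ / L) ≤ 2 * L := by
      refine (LL_le h4 (by norm_num [hκ]) hq ?_).trans (by linarith)
      rw [abs_mul, abs_two]; linarith
    calc κ / L * LL q (2 * s.im) (κ / L) ≤ κ / L * (2 * L) := by gcongr
      _ = 1/40000 := by field_simp; norm_num [hκ]
  by_cases hχ2 : χ^2 = 1
  swap
  · exact key (Or.inl hχ2)
  by_cases him2 : 4 * (κ / L) ≤ |s.im|
  · exact key (Or.inr him2)
  push Not at him2
  have hnorm : ‖s - 1‖ ≤ 1 / L := by
    refine (Complex.norm_le_abs_re_add_abs_im _).trans ?_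
    rw [Complex.sub_re, Complex.sub_im, Complex.one_re, Complex.one_im, sub_zero, abs_of_neg (by linarith)]
    have e1 : κ / 7 / L = κ / L / 7 := by ring
    rw [e1] at hre
    have e2 : 5 * (κ / L) ≤ 1 / L := by rw [mul_div_assoc']; gcongr; norm_num [hκ]
    have e3 : 0 < κ / L := by positivity
    linarith
  by_cases hχ : χ = 1
  · subst hχ
    apply hrz
    refine hnorm.trans ?_
    rw [div_le_iff₀ hL0]; rw [div_le_iff₀ hr] at h2; linarith
  · rw [fL_ne hχ]
    apply hS q χ hχ2 hχ
    refine hnorm.trans ?_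
    have hq1 : (1:ℝ) ≤ q := by exact_mod_cast NeZero.pos q
    have h5 : (L:ℝ)^(-(1/2:ℝ)) ≤ (q:ℝ)^(-(1/(2*B))) := by
      have e : (L:ℝ)^(-(1/2:ℝ)) = (L^B)^(-(1/(2*B))) := by
        rw [← Real.rpow_mul hL0.le]; congr 1; field_simp
      rw [e]
      exact Real.rpow_le_rpow_of_nonpos (by linarith) hq (by rw [neg_nonpos]; positivity)
    have h6 : 1 / L ≤ c * L^(-(1/2:ℝ)) := by
      rw [Real.rpow_neg hL0.le, ← Real.sqrt_eq_rpow, ← div_eq_mul_inv]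
      have hsq : 0 < Real.sqrt L := Real.sqrt_pos.2 hL0
      have hss := Real.mul_self_sqrt hL0.le
      rw [div_le_div_iff₀ hL0 hsq]
      have h7 : 1 / c ≤ Real.sqrt L := by
        apply Real.le_sqrt_of_sq_le
        rw [div_pow, one_pow]; exact h3
      rw [div_le_iff₀ hc] at h7
      nlinarith
    exact h6.trans (by gcongr)

theorem logDeriv_bound {B : ℝ} (hB : 0 < B) : ∃ w L₀ C : ℝ, 0 < w ∧ w ≤ 1/8 ∧ 1 ≤ L₀ ∧ 0 < C ∧
    ∀ L : ℝ, L₀ ≤ L → ∀ (q : ℕ) [NeZero q], (q:ℝ) ≤ L^B → ∀ (χ : DirichletCharacter ℂ q) (s : ℂ),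
      |s.im| ≤ Real.exp L + 1 → 1 - w / L ≤ s.re → s.re ≤ 1 + w / L →
        fL χ s ≠ 0 ∧ ‖deriv (fL χ) s / fL χ s‖ ≤ C * L^2 := by
  obtain ⟨w, L₀, hw, hw1, hL₀, hz⟩ := zero_free_region hB
  set d := w / 4 with hd
  have hd0 : 0 < d := by positivity
  obtain ⟨L₁, h⟩ := Filter.eventually_atTop.1 (ev_log (B+1) (Real.log (100/d)))
  refine ⟨w / 8, max L₀ L₁, 112 * 4 / (2 * d), by positivity, by linarith, le_max_of_le_left hL₀, by positivity, ?_⟩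
  intro L hL q _ hq χ s him hre hre2
  have hL0 := (le_max_left _ _).trans hL
  have hL1 := h L ((le_max_right _ _).trans hL)
  have hLp : 1 ≤ L := hL₀.trans hL0
  have hLpos : 0 < L := by linarith
  have hx : 0 < w / L := by positivity
  have hx1 : w / L ≤ 1 := by rw [div_le_one hLpos]; linarith
  have e8 : w / 8 / L = w / L / 8 := by ring
  rw [e8] at hre hre2
  have ed : d / L = w / L / 4 := by rw [hd]; ring
  refine ⟨hz L hL0 q hq χ s (by linarith) (by linarith), ?_⟩
  set s₀ : ℂ := ⟨1 + d / L, s.im⟩ with hs₀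
  have hLL : LL q s.im (d / L) ≤ 2 * L := by
    refine (LL_le hLp hd0 hq ?_).trans (by linarith)
    have := Real.exp_pos L
    linarith
  have hLL1 := LL_ge_one (q := q) (t := s.im) (δ := d / L) (by positivity) (by linarith)
  have hmain := norm_logDeriv_le (r := 2 * (d / L)) (M := 2 * LL q s.im (d / L)) (by positivity) (differentiable_fL χ) (by linarith)
    (s := s₀) (z := s) ?_ ?_ ?_
  · refine hmain.trans ?_
    calc 112 * (2 * LL q s.im (d/L)) / (2 * (d / L)) ≤ 112 * (2 * (2 * L)) / (2 * (d / L)) := by gcongr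
      _ = _ := by field_simp; norm_num
  · intro z hzz
    have a1 := (Complex.abs_re_le_norm (z - s₀)).trans hzz.le
    have a2 := (Complex.abs_im_le_norm (z - s₀)).trans hzz.le
    rw [Complex.sub_re, abs_le] at a1
    rw [Complex.sub_im] at a2
    simp only [hs₀] at a1 a2
    apply hz L hL0 q hq χ z
    · have := abs_sub_abs_le_abs_sub z.im s.im
      linarith
    · linarith [a1.1]
  · intro z hzz
    have := fL_ratio χ (s := s₀) (δ := d / L) (by positivity) (by linarith) rfl (z := z) (by linarith)
    exact this
  · have : s - s₀ = ((s.re - (1 + d / L) : ℝ) : ℂ) := by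
      apply Complex.ext <;> simp [hs₀]
    rw [this, Complex.norm_real, Real.norm_eq_abs, abs_le]
    constructor <;> linarith

end SW

namespace SW

open Complex in
/-- kernel bound -/
lemma ker1_le {c : ℝ} (hc : 1 ≤ c) (t : ℝ) : ‖1 / (((c:ℂ) + t * I) * ((c:ℂ) + t * I + 1))‖ ≤ (1 + t^2)⁻¹ := by
  have h1 : 1 + t^2 ≤ ‖((c:ℂ) + t * I) * ((c:ℂ) + t * I + 1)‖ := by
    have a1 : ‖(c:ℂ) + t * I‖^2 = c^2 + t^2 := by
      rw [← normSq_eq_norm_sq, normSq_add_mul_I]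
    have a2 : ‖(c:ℂ) + t * I + 1‖^2 = (c+1)^2 + t^2 := by
      rw [show (c:ℂ) + t * I + 1 = ((c + 1 : ℝ) : ℂ) + t * I by push_cast; ring, ← normSq_eq_norm_sq, normSq_add_mul_I]
    rw [norm_mul]
    have h0 := norm_nonneg ((c:ℂ) + t * I)
    have h0' := norm_nonneg ((c:ℂ) + t * I + 1)
    have : ‖(c:ℂ) + t * I‖ ≤ ‖(c:ℂ) + t * I + 1‖ := by
      apply le_of_sq_le_sq _ h0'; rw [a1, a2]; nlinarith
    nlinarith
  rw [norm_div, norm_one, one_div]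
  apply inv_anti₀ (by positivity) h1

noncomputable def f1 (t : ℝ) : ℂ := Set.indicator (Set.Ioc 0 1) (fun _ => (1:ℂ)) t - Set.indicator (Set.Ioc 0 1) (fun t : ℝ => (t:ℂ)^(1:ℂ)) t

noncomputable def f2 (t : ℝ) : ℂ := (1/2:ℂ) * Set.indicator (Set.Ioc 0 1) (fun t : ℝ => (t:ℂ)^(-1:ℂ)) t -
  Set.indicator (Set.Ioc 0 1) (fun _ => (1:ℂ)) t + (1/2:ℂ) * Set.indicator (Set.Ioc 0 1) (fun t : ℝ => (t:ℂ)^(1:ℂ)) t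

lemma f1_mellin {s : ℂ} (hs : 0 < s.re) : HasMellin f1 s (1 / (s * (s + 1))) := by
  have h1 := hasMellin_one_Ioc hs
  have h2 := hasMellin_cpow_Ioc 1 (s := s) (by simp; linarith)
  have := hasMellin_sub h1.1 h2.1
  rw [h1.2, h2.2] at this
  have n1 : s ≠ 0 := by rintro rfl; simp at hs
  have n2 : s + 1 ≠ 0 := by intro h; have := congrArg Complex.re h; simp at this; linarith
  have e : 1 / (s * (s + 1)) = 1 / s - 1 / (s + 1) := by field_simp; ring
  rw [e]; exact this

lemma f2_mellin {s : ℂ} (hs : 1 < s.re) : HasMellin f2 s (1 / ((s - 1) * s * (s + 1))) := by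
  have h1 := hasMellin_one_Ioc (s := s) (by linarith)
  have h2 := hasMellin_cpow_Ioc 1 (s := s) (by simp; linarith)
  have h3 := hasMellin_cpow_Ioc (-1) (s := s) (by simp; linarith)
  have h2' : HasMellin (fun t => (1/2:ℂ) * Set.indicator (Set.Ioc 0 1) (fun t : ℝ => (t:ℂ)^(1:ℂ)) t) s ((1/2) * (1 / (s+1))) :=
    ⟨h2.1.const_smul (1/2:ℂ), by have := mellin_const_smul (Set.indicator (Set.Ioc 0 1) (fun t : ℝ => (t:ℂ)^(1:ℂ))) s (1/2:ℂ)
                                 rw [h2.2] at this; exact this⟩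
  have h3' : HasMellin (fun t => (1/2:ℂ) * Set.indicator (Set.Ioc 0 1) (fun t : ℝ => (t:ℂ)^(-1:ℂ)) t) s ((1/2) * (1 / (s+ -1))) :=
    ⟨h3.1.const_smul (1/2:ℂ), by have := mellin_const_smul (Set.indicator (Set.Ioc 0 1) (fun t : ℝ => (t:ℂ)^(-1:ℂ))) s (1/2:ℂ)
                                 rw [h3.2] at this; exact this⟩
  have h4 := hasMellin_sub h3'.1 h1.1
  have h5 := hasMellin_add h4.1 h2'.1
  rw [h4.2, h3'.2, h1.2, h2'.2] at h5
  have n1 : s ≠ 0 := by rintro rfl; simp at hs; linarith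
  have n2 : s + 1 ≠ 0 := by intro h; have := congrArg Complex.re h; simp at this; linarith
  have n3 : s - 1 ≠ 0 := by intro h; have := congrArg Complex.re h; simp at this; linarith
  have e : 1 / ((s - 1) * s * (s + 1)) = 1 / 2 * (1 / (s + -1)) - 1 / s + 1 / 2 * (1 / (s + 1)) := by
    rw [← sub_eq_add_neg]; field_simp; ring
  rw [e]; exact h5

lemma f1_eq {t : ℝ} (ht : 0 < t) : f1 t = ((max (1 - t) 0 : ℝ) : ℂ) := by
  unfold f1
  by_cases h : t ≤ 1
  · have hm : t ∈ Set.Ioc (0:ℝ) 1 := ⟨ht, h⟩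
    rw [Set.indicator_of_mem hm, Set.indicator_of_mem hm, Complex.cpow_one, max_eq_left (by linarith)]
    push_cast; rfl
  · have : t ∉ Set.Ioc (0:ℝ) 1 := fun h' => h h'.2
    rw [Set.indicator_of_notMem this, Set.indicator_of_notMem this, max_eq_right (by push Not at h; linarith)]
    simp

lemma f2_eq {t : ℝ} (ht : 0 < t) : f2 t = (((max (1 - t) 0)^2 / (2 * t) : ℝ) : ℂ) := by
  unfold f2
  by_cases h : t ≤ 1
  · have hm : t ∈ Set.Ioc (0:ℝ) 1 := ⟨ht, h⟩
    rw [Set.indicator_of_mem hm, Set.indicator_of_mem hm, Set.indicator_of_mem hm, Complex.cpow_one,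
      Complex.cpow_neg_one, max_eq_left (by linarith)]
    have : (t:ℂ) ≠ 0 := by exact_mod_cast ht.ne'
    push_cast
    field_simp; ring
  · have : t ∉ Set.Ioc (0:ℝ) 1 := fun h' => h h'.2
    rw [Set.indicator_of_notMem this, Set.indicator_of_notMem this, Set.indicator_of_notMem this,
      max_eq_right (by push Not at h; linarith)]
    simp

lemma cont_of_eq {f : ℝ → ℂ} {g : ℝ → ℝ} (h : ∀ t, 0 < t → f t = g t) {x : ℝ} (hx : 0 < x) (hg : ContinuousAt g x) :
    ContinuousAt f x := by
  have : f =ᶠ[nhds x] fun t => (g t : ℂ) := by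
    filter_upwards [lt_mem_nhds hx] with t ht
    exact h t ht
  exact (Complex.continuous_ofReal.continuousAt.comp hg).congr this.symm

lemma line_ker1_int {c : ℝ} (hc : 1 ≤ c) : Integrable (fun t : ℝ => 1 / (((c:ℂ) + t * Complex.I) * ((c:ℂ) + t * Complex.I + 1))) := by
  refine (integrable_inv_one_add_sq).mono' ?_ (Filter.Eventually.of_forall fun t => ker1_le hc t)
  refine Continuous.aestronglyMeasurable ?_
  refine continuous_const.div (by fun_prop) ?_
  intro t h
  rcases mul_eq_zero.1 h with h | h <;> (have := congrArg Complex.re h; simp at this; linarith)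

lemma perron1 {c : ℝ} (hc : 1 ≤ c) {y : ℝ} (hy : 0 < y) :
    ∫ t : ℝ, (y:ℂ)^(-((c:ℂ) + t * Complex.I)) * (1 / (((c:ℂ) + t * Complex.I) * ((c:ℂ) + t * Complex.I + 1))) =
      2 * Real.pi * ((max (1 - y) 0 : ℝ) : ℂ) := by
  have hre : ∀ t : ℝ, 0 < ((c:ℂ) + t * Complex.I).re := by intro t; simp; linarith
  have hm : ∀ t : ℝ, mellin f1 ((c:ℂ) + t * Complex.I) = 1 / (((c:ℂ) + t * Complex.I) * ((c:ℂ) + t * Complex.I + 1)) :=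
    fun t => (f1_mellin (hre t)).2
  have h := mellinInv_mellin_eq c f1 hy (f1_mellin (s := c) (by simp; linarith)).1 (by
    refine (line_ker1_int hc).congr ?_
    exact Filter.Eventually.of_forall fun t => (hm t).symm)
    (cont_of_eq (fun t => f1_eq) hy (by fun_prop))
  rw [f1_eq hy, mellinInv] at h
  simp only [hm, smul_eq_mul] at h
  rw [← h]
  rw [Complex.real_smul, ← mul_assoc]
  have h2 : (2 * (Real.pi:ℂ)) * ((1 / (2 * Real.pi) : ℝ) : ℂ) = 1 := by
    have : (Real.pi : ℂ) ≠ 0 := by exact_mod_cast Real.pi_ne_zero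
    push_cast; field_simp
  rw [h2, one_mul]

lemma perron2 {c : ℝ} (hc : 1 < c) {y : ℝ} (hy : 0 < y) :
    Integrable (fun t : ℝ => 1 / (((c:ℂ) + t * Complex.I - 1) * ((c:ℂ) + t * Complex.I) * ((c:ℂ) + t * Complex.I + 1))) ∧
    ∫ t : ℝ, (y:ℂ)^(-((c:ℂ) + t * Complex.I)) * (1 / (((c:ℂ) + t * Complex.I - 1) * ((c:ℂ) + t * Complex.I) * ((c:ℂ) + t * Complex.I + 1))) =
      2 * Real.pi * (((max (1 - y) 0)^2 / (2 * y) : ℝ) : ℂ) := by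
  have hre : ∀ t : ℝ, 1 < ((c:ℂ) + t * Complex.I).re := by intro t; simp; linarith
  have hm : ∀ t : ℝ, mellin f2 ((c:ℂ) + t * Complex.I) = 1 / (((c:ℂ) + t * Complex.I - 1) * ((c:ℂ) + t * Complex.I) * ((c:ℂ) + t * Complex.I + 1)) :=
    fun t => (f2_mellin (hre t)).2
  have hIntg : Integrable (fun t : ℝ => 1 / (((c:ℂ) + t * Complex.I - 1) * ((c:ℂ) + t * Complex.I) * ((c:ℂ) + t * Complex.I + 1))) := by
    refine ((integrable_inv_one_add_sq).const_mul (c - 1)⁻¹).mono' ?_ (Filter.Eventually.of_forall fun t => ?_)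
    · refine Continuous.aestronglyMeasurable ?_
      refine continuous_const.div (by fun_prop) ?_
      intro t h
      rcases mul_eq_zero.1 h with h | h
      · rcases mul_eq_zero.1 h with h | h <;> (have := congrArg Complex.re h; simp at this; linarith)
      · have := congrArg Complex.re h; simp at this; linarith
    · have h1 := ker1_le hc.le t
      have h2 : c - 1 ≤ ‖(c:ℂ) + t * Complex.I - 1‖ := by
        refine le_trans ?_ (Complex.re_le_norm _)
        simp
      rw [mul_assoc, one_div, mul_inv, norm_mul, ← one_div, ← one_div, norm_div, norm_one, one_div]
      refine mul_le_mul ?_ h1 (norm_nonneg _) (inv_nonneg.2 (by linarith))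
      exact inv_anti₀ (by linarith) h2
  refine ⟨hIntg, ?_⟩
  have h := mellinInv_mellin_eq c f2 hy (f2_mellin (s := c) (by simp; linarith)).1 (by
    refine hIntg.congr ?_
    exact Filter.Eventually.of_forall fun t => (hm t).symm)
    (cont_of_eq (fun t => f2_eq) hy (by
      refine ContinuousAt.div (by fun_prop) (by fun_prop) (by positivity)))
  rw [f2_eq hy, mellinInv] at h
  simp only [hm, smul_eq_mul] at h
  rw [← h]
  rw [Complex.real_smul, ← mul_assoc]
  have h2 : (2 * (Real.pi:ℂ)) * ((1 / (2 * Real.pi) : ℝ) : ℂ) = 1 := by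
    have : (Real.pi : ℂ) ≠ 0 := by exact_mod_cast Real.pi_ne_zero
    push_cast; field_simp
  rw [h2, one_mul]

end SW

namespace SW

open Complex ArithmeticFunction.vonMangoldt

/-- the coefficients -/
noncomputable def rc {q : ℕ} (b : ZMod q) (n : ℕ) : ℂ := ((residueClass b n : ℝ) : ℂ)

noncomputable def VV {q : ℕ} [NeZero q] (b : ZMod q) (s : ℂ) : ℂ :=
  (q.totient : ℂ)⁻¹ * ∑ χ : DirichletCharacter ℂ q, χ b⁻¹ * (-(deriv (fL χ) s / fL χ s))

lemma VV_eq {q : ℕ} [NeZero q] {b : ZMod q} (hb : IsUnit b) {s : ℂ} (hs : 1 < s.re) :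
    VV b s = LSeries (rc b) s - (q.totient : ℂ)⁻¹ / (s - 1) := by
  have h := eqOn_LFunctionResidueClassAux hb (Set.mem_ofPred.mpr hs)
  simp only at h
  rw [show LSeries (rc b) s = LSeries (fun n => ((residueClass b n : ℝ) : ℂ)) s from rfl, ← h]
  have ha' : IsUnit b⁻¹ := isUnit_of_dvd_one ⟨b, (ZMod.inv_mul_of_unit b hb).symm⟩
  classical
  rw [VV, LFunctionResidueClassAux, Fintype.sum_eq_add_sum_compl 1, MulChar.one_apply ha', fL_one]
  congr 1
  rw [sub_eq_add_neg, ← Finset.sum_neg_distrib]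
  congr 1
  · ring
  · apply Finset.sum_congr
    · ext; simp
    · intro χ hχ
      have : χ ≠ 1 := by simpa using hχ
      rw [fL_ne this]; ring

lemma norm_VV_le {q : ℕ} [NeZero q] (b : ZMod q) (s : ℂ) {K : ℝ}
    (h : ∀ χ : DirichletCharacter ℂ q, ‖deriv (fL χ) s / fL χ s‖ ≤ K) : ‖VV b s‖ ≤ K := by
  rw [VV, norm_mul, norm_inv, norm_natCast]
  have hφ : 0 < (q.totient : ℝ) := mod_cast Nat.totient_pos.mpr q.pos_of_neZero
  rw [inv_mul_le_iff₀ hφ]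
  calc _ ≤ ∑ χ : DirichletCharacter ℂ q, K := by
        apply norm_sum_le_of_le
        intro χ _
        rw [norm_mul, norm_neg]
        have := DirichletCharacter.norm_le_one χ b⁻¹
        have h2 := norm_nonneg (χ b⁻¹)
        have := h χ
        have h3 := norm_nonneg (deriv (fL χ) s / fL χ s)
        nlinarith
    _ = _ := by
        rw [Finset.sum_const, nsmul_eq_mul, Finset.card_univ, ← Nat.card_eq_fintype_card,
          DirichletCharacter.card_eq_totient_of_hasEnoughRootsOfUnity]

lemma rc_summable {q : ℕ} (b : ZMod q) {s : ℂ} (hs : 1 < s.re) : LSeriesSummable (rc b) s :=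
  LSeriesSummable_of_abscissaOfAbsConv_lt_re <|
      (abscissaOfAbsConv_residueClass_le_one b).trans_lt <| by exact_mod_cast hs

lemma rc_norm {q : ℕ} (b : ZMod q) (n : ℕ) : ‖rc b n‖ ≤ Real.log n := by
  rw [rc, norm_real, Real.norm_of_nonneg (residueClass_nonneg b n)]
  exact (residueClass_le b n).trans ArithmeticFunction.vonMangoldt_le_log

lemma rc_LSeries_bound {q : ℕ} (b : ZMod q) {s : ℂ} (hs : 1 < s.re) (hs2 : s.re ≤ 2) :
    ‖LSeries (rc b) s‖ ≤ 10 / (s.re - 1)^2 := by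
  set e : ℝ := (s.re - 1) / 2 with he
  have he0 : 0 < e := by rw [he]; linarith
  let f : ℕ → ℂ := fun n => e * rc b n * (n:ℂ)^(-(e:ℂ))
  have hf : ∀ n, ‖f n‖ ≤ 1 := by
    intro n
    rcases Nat.eq_zero_or_pos n with rfl | hn
    · simp [f, rc]
    · have hn' : (0:ℝ) < n := by exact_mod_cast hn
      have h1 := Real.log_le_rpow_div hn'.le he0
      have h2 := rc_norm b n
      simp only [f, norm_mul, norm_real, Real.norm_of_nonneg he0.le]
      rw [show ((n:ℂ)) = ((n:ℝ):ℂ) by simp, norm_cpow_eq_rpow_re_of_pos hn']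
      simp only [neg_re, ofReal_re]
      rw [Real.rpow_neg hn'.le, ← div_eq_mul_inv, div_le_one (by positivity)]
      rw [le_div_iff₀ he0] at h1
      nlinarith
  have h3 := norm_LSeries_le_of_norm_le_one hf (s := s - e) (by simp; rw [he]; linarith)
  have h4 : LSeries f (s - e) = e * LSeries (rc b) s := by
    rw [LSeries, LSeries, ← tsum_mul_left]
    apply tsum_congr
    intro n
    rcases Nat.eq_zero_or_pos n with rfl | hn
    · simp
    · rw [LSeries.term_of_ne_zero hn.ne', LSeries.term_of_ne_zero hn.ne']
      have hn0 : (n:ℂ) ≠ 0 := by exact_mod_cast hn.ne'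
      simp only [f]
      rw [cpow_sub _ _ hn0, cpow_neg]
      have h5 := cpow_ne_zero_iff_of_exponent_ne_zero (x := (n:ℂ)) (y := (e:ℂ)) (by exact_mod_cast he0.ne') |>.mpr hn0
      field_simp
  rw [h4, norm_mul, norm_real, Real.norm_of_nonneg he0.le] at h3
  have h5 : (s - e).re = 1 + e := by simp; rw [he]; ring
  rw [h5] at h3
  have h6 : s.re - 1 = 2 * e := by rw [he]; ring
  rw [h6]
  have he1 : e ≤ 1/2 := by rw [he]; linarith
  rw [le_div_iff₀ (by positivity)]
  have h7 : (1 + e) / (1 + e - 1) + 1 = (1 + 2 * e)/e := by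
    rw [show 1 + e - 1 = e by ring]; field_simp; ring
  rw [h7, le_div_iff₀ he0] at h3
  have := norm_nonneg (LSeries (rc b) s)
  nlinarith

lemma line_cont {q : ℕ} (b : ZMod q) {c : ℝ} (hc : 1 < c) :
    Continuous (fun t : ℝ => LSeries (rc b) ((c:ℂ) + t * I)) := by
  rw [continuous_iff_continuousAt]
  intro t
  have h : DifferentiableAt ℂ (LSeries (rc b)) ((c:ℂ) + t * I) := by
    apply (LSeries_hasDerivAt _).differentiableAt
    refine (abscissaOfAbsConv_residueClass_le_one b).trans_lt ?_
    simp; exact_mod_cast hc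
  exact h.continuousAt.comp (f := fun t : ℝ => (c:ℂ) + t * I) (by fun_prop)

lemma xs_norm {x : ℝ} (hx : 0 < x) (c t : ℝ) : ‖(x:ℂ)^((c:ℂ) + t * I)‖ = x^c := by
  rw [norm_cpow_eq_rpow_re_of_pos hx]; simp

lemma xs_cont {x : ℝ} (hx : 0 < x) (c : ℝ) : Continuous (fun t : ℝ => (x:ℂ)^((c:ℂ) + t * I)) := by
  apply Continuous.const_cpow (by fun_prop)
  left; exact_mod_cast hx.ne'

lemma perron_sum {q : ℕ} (b : ZMod q) {c x : ℝ} (hc : 1 < c) (hc2 : c ≤ 2) (hx : 0 < x) :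
    Integrable (fun t : ℝ => LSeries (rc b) ((c:ℂ) + t * I) * ((x:ℂ)^((c:ℂ) + t * I) *
      (1 / (((c:ℂ) + t * I) * ((c:ℂ) + t * I + 1))))) ∧
    ∫ t : ℝ, LSeries (rc b) ((c:ℂ) + t * I) * ((x:ℂ)^((c:ℂ) + t * I) *
      (1 / (((c:ℂ) + t * I) * ((c:ℂ) + t * I + 1)))) =
      ∑' n : ℕ, rc b n * (2 * Real.pi * ((max (1 - n / x) 0 : ℝ) : ℂ)) := by
  have hk := line_ker1_int hc.le
  have hxk : Integrable (fun t : ℝ => (x:ℂ)^((c:ℂ) + t * I) *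
      (1 / (((c:ℂ) + t * I) * ((c:ℂ) + t * I + 1)))) := by
    apply hk.bdd_mul (c := x^c) (xs_cont hx c).aestronglyMeasurable
    filter_upwards with t
    rw [xs_norm hx]
  constructor
  · apply hxk.bdd_mul (c := 10 / (c-1)^2) (line_cont b hc).aestronglyMeasurable
    filter_upwards with t
    have := rc_LSeries_bound b (s := (c:ℂ) + t * I) (by simpa using hc) (by simpa using hc2)
    simpa using this
  · let F : ℕ → ℝ → ℂ := fun n t => LSeries.term (rc b) ((c:ℂ) + t * I) n * ((x:ℂ)^((c:ℂ) + t * I) *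
      (1 / (((c:ℂ) + t * I) * ((c:ℂ) + t * I + 1))))
    have hterm : ∀ n (t:ℝ), ‖LSeries.term (rc b) ((c:ℂ) + t * I) n‖ = ‖LSeries.term (rc b) (c:ℂ) n‖ := by
      intro n t; rw [LSeries.norm_term_eq, LSeries.norm_term_eq]; simp
    have hcont : ∀ n, Continuous (fun t:ℝ => LSeries.term (rc b) ((c:ℂ) + t * I) n) := by
      intro n
      rcases Nat.eq_zero_or_pos n with rfl | hn
      · simp; exact continuous_const
      · simp only [LSeries.term_of_ne_zero hn.ne']
        have hn0 : (0:ℝ) < n := by exact_mod_cast hn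
        have := xs_cont hn0 c
        apply Continuous.div continuous_const (by simpa using this)
        intro t
        rw [show ((n:ℂ)) = ((n:ℝ):ℂ) by simp, ← norm_ne_zero_iff, xs_norm hn0]
        positivity
    have hFi : ∀ n, Integrable (F n) := by
      intro n
      apply hxk.bdd_mul (c := ‖LSeries.term (rc b) (c:ℂ) n‖) (hcont n).aestronglyMeasurable
      filter_upwards with t
      rw [hterm]
    have hS : Summable (fun n => ∫ t, ‖F n t‖) := by
      have : (fun n => ∫ t, ‖F n t‖) = fun n => ‖LSeries.term (rc b) (c:ℂ) n‖ * ∫ t:ℝ, ‖(x:ℂ)^((c:ℂ) + t * I) *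
      (1 / (((c:ℂ) + t * I) * ((c:ℂ) + t * I + 1)))‖ := by
        ext n
        rw [← integral_const_mul]
        congr 1; ext t
        simp only [F]
        rw [norm_mul, hterm]
      rw [this]
      apply Summable.mul_right
      exact (rc_summable b (s := (c:ℂ)) (by simpa using hc)).norm
    have h := (hasSum_integral_of_summable_integral_norm hFi hS).tsum_eq
    have h2 : ∀ t : ℝ, ∑' n, F n t = LSeries (rc b) ((c:ℂ) + t * I) * ((x:ℂ)^((c:ℂ) + t * I) *
      (1 / (((c:ℂ) + t * I) * ((c:ℂ) + t * I + 1)))) := by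
      intro t; simp only [F]; rw [tsum_mul_right]; rfl
    simp_rw [h2] at h
    rw [← h]
    apply tsum_congr
    intro n
    rcases Nat.eq_zero_or_pos n with rfl | hn
    · simp [F, rc]
    · have hn0 : (0:ℝ) < n := by exact_mod_cast hn
      rw [← perron1 hc.le (div_pos hn0 hx), ← integral_const_mul]
      congr 1; ext t
      simp only [F]
      rw [LSeries.term_of_ne_zero hn.ne', cpow_neg]
      push_cast
      rw [show ((n:ℂ)) = ((n:ℝ):ℂ) by simp, div_cpow_ofReal_nonneg hn0.le hx.le]
      have : ((n:ℝ):ℂ)^((c:ℂ) + t * I) ≠ 0 := by rw [← norm_ne_zero_iff, xs_norm hn0]; positivity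
      have : (x:ℂ)^((c:ℂ) + t * I) ≠ 0 := by rw [← norm_ne_zero_iff, xs_norm hx]; positivity
      field_simp

/-- the smoothed remainder -/
noncomputable def RR {q : ℕ} (b : ZMod q) (x : ℝ) : ℝ :=
  (∑' n : ℕ, residueClass b n * max (1 - n / x) 0) - (q.totient : ℝ)⁻¹ * ((max (1 - x⁻¹) 0)^2 * x / 2)

lemma perron_VV {q : ℕ} [NeZero q] {b : ZMod q} (hb : IsUnit b) {c x : ℝ} (hc : 1 < c) (hc2 : c ≤ 2) (hx : 0 < x) :
    Integrable (fun t : ℝ => VV b ((c:ℂ) + t * I) * ((x:ℂ)^((c:ℂ) + t * I) *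
      (1 / (((c:ℂ) + t * I) * ((c:ℂ) + t * I + 1))))) ∧
    ∫ t : ℝ, VV b ((c:ℂ) + t * I) * ((x:ℂ)^((c:ℂ) + t * I) *
      (1 / (((c:ℂ) + t * I) * ((c:ℂ) + t * I + 1)))) = ((2 * Real.pi * RR b x : ℝ) : ℂ) := by
  obtain ⟨h1, h2⟩ := perron_sum b hc hc2 hx
  obtain ⟨h3, h4⟩ := perron2 hc (inv_pos.mpr hx)
  have h5 : ∀ t : ℝ, VV b ((c:ℂ) + t * I) * ((x:ℂ)^((c:ℂ) + t * I) *
      (1 / (((c:ℂ) + t * I) * ((c:ℂ) + t * I + 1)))) = LSeries (rc b) ((c:ℂ) + t * I) * ((x:ℂ)^((c:ℂ) + t * I) *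
      (1 / (((c:ℂ) + t * I) * ((c:ℂ) + t * I + 1)))) - (q.totient : ℂ)⁻¹ * (((x⁻¹:ℝ):ℂ)^(-((c:ℂ) + t * I)) *
      (1 / (((c:ℂ) + t * I - 1) * ((c:ℂ) + t * I) * ((c:ℂ) + t * I + 1)))) := by
    intro t
    rw [VV_eq hb (by simpa using hc), ofReal_inv, cpow_neg, inv_cpow _ _ (by
      rw [arg_ofReal_of_nonneg hx.le]; exact Real.pi_pos.ne), inv_inv]
    have e1 : (c:ℂ) + t * I - 1 ≠ 0 := by
      intro h; have := congrArg re h; simp at this; linarith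
    have e2 : (c:ℂ) + t * I ≠ 0 := by
      intro h; have := congrArg re h; simp at this; linarith
    have e3 : (c:ℂ) + t * I + 1 ≠ 0 := by
      intro h; have := congrArg re h; simp at this; linarith
    generalize LSeries (rc b) ((c:ℂ) + t * I) = Lv
    generalize (x:ℂ)^((c:ℂ) + t * I) = xv
    generalize hv : (c:ℂ) + t * I = v at *
    field_simp
  have h6 : Integrable (fun t : ℝ => (q.totient : ℂ)⁻¹ * (((x⁻¹:ℝ):ℂ)^(-((c:ℂ) + t * I)) *
      (1 / (((c:ℂ) + t * I - 1) * ((c:ℂ) + t * I) * ((c:ℂ) + t * I + 1))))) := by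
    apply Integrable.const_mul
    apply h3.bdd_mul (c := (x⁻¹)^(-c))
    · apply Continuous.aestronglyMeasurable
      apply Continuous.const_cpow (by fun_prop)
      left; exact_mod_cast (inv_pos.mpr hx).ne'
    · filter_upwards with t
      rw [norm_cpow_eq_rpow_re_of_pos (inv_pos.mpr hx)]; simp
  constructor
  · simp_rw [h5]; exact h1.sub h6
  · simp_rw [h5]
    rw [integral_sub h1 h6, h2, integral_const_mul, h4, RR]
    push_cast
    have : ∑' n : ℕ, rc b n * (2 * Real.pi * ((max (1 - n / x) 0 : ℝ) : ℂ)) =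
      2 * Real.pi * ∑' n : ℕ, ((residueClass b n : ℝ) : ℂ) * ((max (1 - n / x) 0 : ℝ) : ℂ) := by
      rw [← tsum_mul_left]; apply tsum_congr; intro n; rw [rc]; ring
    rw [this]
    have : (x:ℂ) ≠ 0 := by exact_mod_cast hx.ne'
    field_simp

end SW

namespace SW

open Complex

lemma arctan_le' {y : ℝ} (hy : 0 ≤ y) : Real.arctan y ≤ y := by
  have := Real.le_tan (Real.arctan_nonneg.mpr hy) (Real.arctan_lt_pi_div_two y)
  rwa [Real.tan_arctan] at this

lemma contour {f : ℂ → ℂ} {σ c T A D E : ℝ} (hT : 0 < T) (hσ : σ ≤ c) (hA : 0 ≤ A) (hD : 0 ≤ D)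
    (hf : ∀ s : ℂ, σ ≤ s.re → s.re ≤ c → |s.im| ≤ T → DifferentiableAt ℂ f s)
    (hi : Integrable (fun t : ℝ => f ((c:ℂ) + t * I)))
    (hr : ∀ t : ℝ, ‖f ((c:ℂ) + t * I)‖ ≤ A * (1 + t^2)⁻¹)
    (hl : ∀ t : ℝ, |t| ≤ T → ‖f ((σ:ℂ) + t * I)‖ ≤ D * (1 + t^2)⁻¹)
    (hh : ∀ x t : ℝ, σ ≤ x → x ≤ c → |t| = T → ‖f ((x:ℂ) + t * I)‖ ≤ E) :
    ‖∫ t : ℝ, f ((c:ℂ) + t * I)‖ ≤ 2 * A / T + Real.pi * D + 2 * (E * (c - σ)) := by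
  have t1 : ‖∫ t in Set.Ioi T, f ((c:ℂ) + t * I)‖ ≤ A / T := by
    calc _ ≤ ∫ t in Set.Ioi T, A * (1 + t^2)⁻¹ :=
          norm_integral_le_of_norm_le (integrable_inv_one_add_sq.const_mul A).integrableOn (by
            filter_upwards with t using hr t)
      _ = A * Real.arctan T⁻¹ := by
          rw [integral_const_mul, integral_Ioi_inv_one_add_sq, Real.arctan_inv_of_pos hT]
      _ ≤ A * T⁻¹ := mul_le_mul_of_nonneg_left (arctan_le' (by positivity)) hA
      _ = _ := by rw [div_eq_mul_inv]
  have t2 : ‖∫ t in Set.Iic (-T), f ((c:ℂ) + t * I)‖ ≤ A / T := by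
    calc _ ≤ ∫ t in Set.Iic (-T), A * (1 + t^2)⁻¹ :=
          norm_integral_le_of_norm_le (integrable_inv_one_add_sq.const_mul A).integrableOn (by
            filter_upwards with t using hr t)
      _ = A * Real.arctan T⁻¹ := by
          rw [integral_const_mul, integral_Iic_inv_one_add_sq, Real.arctan_inv_of_pos hT, Real.arctan_neg]; ring
      _ ≤ A * T⁻¹ := mul_le_mul_of_nonneg_left (arctan_le' (by positivity)) hA
      _ = _ := by rw [div_eq_mul_inv]
  have e1 := intervalIntegral.integral_Iic_add_Ioi (b := -T) hi.integrableOn hi.integrableOn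
  have e2 := intervalIntegral.integral_Ioi_sub_Ioi (a := -T) (b := T) hi.integrableOn (by linarith)
  have e3 := integral_boundary_rect_eq_zero_of_differentiableOn f ((σ:ℂ) + (-T:ℝ) * I) ((c:ℂ) + T * I) (by
    intro s hs
    simp only [mem_reProdIm, add_re, ofReal_re, mul_re, I_re, mul_zero, ofReal_im, I_im, mul_one, sub_self, add_zero,
      add_im, mul_im, zero_add, zero_mul] at hs
    rw [Set.uIcc_of_le hσ, Set.uIcc_of_le (by linarith)] at hs
    exact (hf s hs.1.1 hs.1.2 (abs_le.mpr hs.2)).differentiableWithinAt)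
  simp only [add_re, ofReal_re, mul_re, I_re, mul_zero, ofReal_im, I_im, mul_one, sub_self, add_zero,
      add_im, mul_im, zero_add, zero_mul] at e3
  have h1 : ‖∫ x in σ..c, f ((x:ℂ) + (-T:ℝ) * I)‖ ≤ E * (c - σ) := by
    have := intervalIntegral.norm_integral_le_of_norm_le_const (a := σ) (b := c) (f := fun x:ℝ => f ((x:ℂ) + (-T:ℝ) * I)) (C := E) (by
      intro x hx
      rw [Set.uIoc_of_le hσ] at hx
      exact hh x (-T) hx.1.le hx.2 (by rw [abs_neg, abs_of_pos hT]))
    rwa [abs_of_nonneg (by linarith)] at this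
  have h2 : ‖∫ x in σ..c, f ((x:ℂ) + T * I)‖ ≤ E * (c - σ) := by
    have := intervalIntegral.norm_integral_le_of_norm_le_const (a := σ) (b := c) (f := fun x:ℝ => f ((x:ℂ) + T * I)) (C := E) (by
      intro x hx
      rw [Set.uIoc_of_le hσ] at hx
      exact hh x T hx.1.le hx.2 (by rw [abs_of_pos hT]))
    rwa [abs_of_nonneg (by linarith)] at this
  have h3 : ‖∫ t in (-T)..T, f ((σ:ℂ) + t * I)‖ ≤ Real.pi * D := by
    calc _ ≤ ∫ t in (-T)..T, D * (1 + t^2)⁻¹ := by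
          apply intervalIntegral.norm_integral_le_of_norm_le (by linarith)
          · filter_upwards with t ht using hl t (abs_le.mpr ⟨ht.1.le, ht.2⟩)
          · exact (integrable_inv_one_add_sq.const_mul D).intervalIntegrable
      _ ≤ ∫ t, D * (1 + t^2)⁻¹ := by
          rw [intervalIntegral.integral_of_le (by linarith)]
          apply setIntegral_le_integral (integrable_inv_one_add_sq.const_mul D)
          filter_upwards with t
          have : 0 ≤ D * (1 + t^2)⁻¹ := by positivity
          exact this
      _ = _ := by rw [integral_const_mul, integral_univ_inv_one_add_sq]; ring
  have h4 : ‖∫ t in (-T)..T, f ((c:ℂ) + t * I)‖ ≤ Real.pi * D + 2 * (E * (c - σ)) := by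
    have : I • (∫ t in (-T)..T, f ((c:ℂ) + t * I)) = I • (∫ t in (-T)..T, f ((σ:ℂ) + t * I)) +
       ((∫ x in σ..c, f ((x:ℂ) + T * I)) - ∫ x in σ..c, f ((x:ℂ) + (-T:ℝ) * I)) := by linear_combination e3
    have h5 := congrArg norm this
    rw [norm_smul, norm_I, one_mul] at h5
    rw [h5]
    refine (norm_add_le _ _).trans ?_
    rw [norm_smul, norm_I, one_mul]
    have := norm_sub_le (∫ x in σ..c, f ((x:ℂ) + T * I)) (∫ x in σ..c, f ((x:ℂ) + (-T:ℝ) * I))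
    linarith
  have : ∫ t : ℝ, f ((c:ℂ) + t * I) = (∫ t in Set.Iic (-T), f ((c:ℂ) + t * I)) +
     ((∫ t in (-T)..T, f ((c:ℂ) + t * I)) + ∫ t in Set.Ioi T, f ((c:ℂ) + t * I)) := by
    linear_combination -e1 + e2
  rw [this]
  refine (norm_add_le _ _).trans ?_
  have := norm_add_le (∫ t in (-T)..T, f ((c:ℂ) + t * I)) (∫ t in Set.Ioi T, f ((c:ℂ) + t * I))
  have h6 : 2 * A / T = A / T + A / T := by ring
  linarith

lemma ker_half {σ : ℝ} (hσ : 1/2 ≤ σ) (t : ℝ) : ‖1 / (((σ:ℂ) + t * I) * ((σ:ℂ) + t * I + 1))‖ ≤ 4 * (1 + t^2)⁻¹ := by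
  have h1 : (1 + t^2)/4 ≤ ‖((σ:ℂ) + t * I) * ((σ:ℂ) + t * I + 1)‖ := by
    have a1 : ‖(σ:ℂ) + t * I‖^2 = σ^2 + t^2 := by
      rw [← normSq_eq_norm_sq, normSq_add_mul_I]
    have a2 : ‖(σ:ℂ) + t * I + 1‖^2 = (σ+1)^2 + t^2 := by
      rw [show (σ:ℂ) + t * I + 1 = ((σ + 1 : ℝ) : ℂ) + t * I by push_cast; ring, ← normSq_eq_norm_sq, normSq_add_mul_I]
    rw [norm_mul]
    have h0 := norm_nonneg ((σ:ℂ) + t * I)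
    have h0' := norm_nonneg ((σ:ℂ) + t * I + 1)
    have : ‖(σ:ℂ) + t * I‖ ≤ ‖(σ:ℂ) + t * I + 1‖ := by
      apply le_of_sq_le_sq _ h0'; rw [a1, a2]; nlinarith
    nlinarith
  rw [norm_div, norm_one, show 4 * (1 + t^2)⁻¹ = 1 / ((1+t^2)/4) by field_simp]
  apply one_div_le_one_div_of_le (by positivity) h1

lemma ker_hor {σ T : ℝ} (hT : 0 < T) (t : ℝ) (ht : |t| = T) : ‖1 / (((σ:ℂ) + t * I) * ((σ:ℂ) + t * I + 1))‖ ≤ 1 / T^2 := by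
  rw [norm_div, norm_one]
  apply one_div_le_one_div_of_le (by positivity)
  rw [norm_mul, sq]
  have a1 := abs_im_le_norm ((σ:ℂ) + t * I)
  have a2 := abs_im_le_norm ((σ:ℂ) + t * I + 1)
  simp [ht] at a1 a2
  exact mul_le_mul a1 a2 hT.le (norm_nonneg _)

/-- bound for the smoothed remainder -/
lemma RR_bound {q : ℕ} [NeZero q] {b : ZMod q} (hb : IsUnit b) {σ c x T K : ℝ} (hσ : 1/2 ≤ σ) (hσ1 : σ ≤ 1)
    (hc : 1 < c) (hc2 : c ≤ 3/2) (hx : 1 ≤ x) (hT : 0 < T) (hK : 0 ≤ K)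
    (h : ∀ χ : DirichletCharacter ℂ q, ∀ s : ℂ, σ ≤ s.re → s.re ≤ c → |s.im| ≤ T →
      fL χ s ≠ 0 ∧ ‖deriv (fL χ) s / fL χ s‖ ≤ K) :
    |RR b x| ≤ 11 / (c-1)^2 * x^c / T + 4 * K * x^σ + K * x^c / T^2 := by
  have hx0 : 0 < x := by linarith
  obtain ⟨p1, p2⟩ := perron_VV hb hc (by linarith) hx0
  have hV1 : ∀ t : ℝ, ‖VV b ((c:ℂ) + t * I)‖ ≤ 11 / (c-1)^2 := by
    intro t
    rw [VV_eq hb (by simpa using hc)]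
    refine (norm_sub_le _ _).trans ?_
    have h1 := rc_LSeries_bound b (s := (c:ℂ) + t * I) (by simpa using hc) (by simp; linarith)
    simp at h1
    have h2 : ‖(q.totient : ℂ)⁻¹ / ((c:ℂ) + t * I - 1)‖ ≤ 1 / (c-1)^2 := by
      rw [norm_div, norm_inv, norm_natCast]
      have a1 := abs_re_le_norm ((c:ℂ) + t * I - 1)
      simp at a1
      rw [abs_of_pos (by linarith)] at a1
      have hφ : 1 ≤ (q.totient : ℝ) := mod_cast Nat.totient_pos.mpr q.pos_of_neZero
      apply div_le_div₀ zero_le_one (inv_le_one_of_one_le₀ hφ) (by have : 0 < c - 1 := by linarith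
                                                                   positivity)
      have : (c-1)^2 ≤ c - 1 := by nlinarith
      linarith
    have : 11 / (c-1)^2 = 10 / (c-1)^2 + 1/(c-1)^2 := by ring
    linarith
  have hVK : ∀ s : ℂ, σ ≤ s.re → s.re ≤ c → |s.im| ≤ T → ‖VV b s‖ ≤ K := by
    intro s h1 h2 h3
    exact norm_VV_le b s (fun χ => (h χ s h1 h2 h3).2)
  have key := contour (f := fun s => VV b s * ((x:ℂ)^s * (1 / (s * (s + 1))))) (σ := σ) (c := c) (T := T)
    (A := 11 / (c-1)^2 * x^c) (D := K * x^σ * 4) (E := K * (x^c * (1/T^2))) hT (by linarith) (by positivity) (by positivity) ?_ p1 ?_ ?_ ?_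
  · rw [p2, norm_real, Real.norm_eq_abs, abs_mul, abs_of_pos (by positivity)] at key
    have hE : 0 ≤ K * (x^c * (1/T^2)) := by positivity
    have hπ := Real.pi_gt_three
    have hA : 0 ≤ 11 / (c-1)^2 * x^c / T := by positivity
    have e1 : 2 * (11 / (c-1)^2 * x^c) / T = 2 * (11 / (c-1)^2 * x^c / T) := by ring
    have e2 : K * x^c / T^2 = K * (x^c * (1/T^2)) := by ring
    rw [e2]
    rw [e1] at key
    set u := 11 / (c-1)^2 * x^c / T
    set v := K * (x^c * (1/T^2))
    set y := K * x^σ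
    have hy : 0 ≤ y := by positivity
    have e3 : 4 * K * x^σ = 4 * y := by simp only [y]; ring
    rw [e3]
    have : c - σ ≤ 1 := by linarith
    have hv : v * (c - σ) ≤ v := by nlinarith
    have : 2 * Real.pi * |RR b x| ≤ 2 * Real.pi * (u + 4 * y + v) := by
      nlinarith [mul_nonneg (by linarith : 0 ≤ Real.pi - 1) hA, mul_nonneg (by linarith : 0 ≤ Real.pi - 1) hE, mul_nonneg (by linarith : 0 ≤ Real.pi) hy]
    exact le_of_mul_le_mul_left this (by positivity)
  · intro s h1 h2 h3
    have n1 : s ≠ 0 := by intro h; rw [h] at h1; simp at h1; linarith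
    have n2 : s + 1 ≠ 0 := by intro h; have := congrArg re h; simp at this; linarith
    have d1 : DifferentiableAt ℂ (VV b) s := by
      unfold VV
      apply DifferentiableAt.const_mul
      apply DifferentiableAt.fun_sum
      intro χ _
      apply DifferentiableAt.const_mul
      apply DifferentiableAt.neg
      have := (differentiable_fL χ)
      refine DifferentiableAt.div ?_ this.differentiableAt (h χ s h1 h2 h3).1
      exact this.analyticAt s |>.deriv.differentiableAt
    have d2 : DifferentiableAt ℂ (fun s : ℂ => (x:ℂ)^s) s := by
      apply DifferentiableAt.const_cpow differentiableAt_id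
      left; exact_mod_cast hx0.ne'
    refine d1.mul (d2.mul ?_)
    refine DifferentiableAt.div (by fun_prop) (by fun_prop) (mul_ne_zero n1 n2)
  · intro t
    rw [norm_mul, norm_mul]
    rw [xs_norm hx0, mul_assoc]
    have := ker1_le hc.le t
    exact mul_le_mul (hV1 t) (mul_le_mul_of_nonneg_left this (by positivity)) (by positivity) (by positivity)
  · intro t ht
    rw [norm_mul, norm_mul]
    rw [xs_norm hx0, mul_assoc, mul_assoc]
    have := ker_half hσ t
    exact mul_le_mul (hVK _ (by simp) (by simp; linarith) (by simpa using ht)) (mul_le_mul_of_nonneg_left this (by positivity)) (by positivity) (by positivity)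
  · intro y t h1 h2 ht
    rw [norm_mul, norm_mul]
    rw [xs_norm hx0]
    have := ker_hor (σ := y) hT t ht
    refine mul_le_mul (hVK _ (by simpa using h1) (by simpa using h2) (by simpa using ht.le)) ?_ (by positivity) (by positivity)
    exact mul_le_mul (Real.rpow_le_rpow_of_exponent_le hx h2) this (by positivity) (by positivity)

lemma RR_small {B : ℝ} (hB : 0 < B) : ∃ a L₀ C : ℝ, 0 < a ∧ 1 ≤ L₀ ∧ 0 < C ∧ ∀ L, L₀ ≤ L → ∀ (q : ℕ) [NeZero q],
    (q:ℝ) ≤ L^B → ∀ b : ZMod q, IsUnit b → ∀ x : ℝ, 1 ≤ x → x ≤ 3 * Real.exp (L^2) →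
    |RR b x| ≤ C * Real.exp (L^2) * Real.exp (-(a * L)) := by
  obtain ⟨w, L₀, C, hw, hw8, hL₀, hC, H⟩ := logDeriv_bound hB
  set a := w / 2 with ha
  have ha0 : 0 < a := by positivity
  set M := 24 / a^4 with hM
  refine ⟨a, max (max L₀ (1/w)) 2, (11 + 5 * C) * Real.exp 5 * M, ha0, ?_, by positivity, ?_⟩
  · exact le_max_of_le_right (by norm_num)
  intro L hL q _ hq b hb x hx hx3
  have hL1 : L₀ ≤ L := (le_max_left _ _).trans ((le_max_left _ _).trans hL)
  have hL2 : 1/w ≤ L := (le_max_right _ _).trans ((le_max_left _ _).trans hL)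
  have hL3 : 2 ≤ L := (le_max_right _ _).trans hL
  have hL0 : 0 < L := by linarith
  have hx0 : 0 < x := by linarith
  have hwL : 1 ≤ w * L := by rw [div_le_iff₀ hw] at hL2; linarith
  have hinv : 1 / L^2 ≤ 1/4 := by
    rw [div_le_div_iff₀ (by positivity) (by norm_num)]; nlinarith
  have hwdiv : w / L ≤ 1/16 := by rw [div_le_iff₀ hL0]; nlinarith
  have h1 := RR_bound hb (σ := 1 - w/L) (c := 1 + 1/L^2) (x := x) (T := Real.exp L) (K := C * L^2)
    (by linarith) (by have : 0 < w / L := by positivity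
                      linarith) (by have : 0 < 1/L^2 := by positivity
                                    linarith) (by linarith) hx (Real.exp_pos _) (by positivity) (by
      intro χ s s1 s2 s3
      refine H L hL1 q hq χ s (by linarith) s1 (s2.trans ?_)
      have : 1 / L^2 ≤ w / L := by
        rw [div_le_div_iff₀ (by positivity) hL0]; nlinarith
      linarith)
  refine h1.trans ?_
  have hxe : x ≤ Real.exp (L^2 + 2) := by
    rw [Real.exp_add]
    have : (3:ℝ) ≤ Real.exp 2 := by have := Real.add_one_le_exp (2:ℝ); linarith
    nlinarith [Real.exp_pos (L^2)]
  have hxc : x^(1 + 1/L^2) ≤ Real.exp (L^2 + 5) := by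
    calc x^(1 + 1/L^2) ≤ (Real.exp (L^2+2))^(1 + 1/L^2) := Real.rpow_le_rpow hx0.le hxe (by positivity)
      _ = Real.exp ((L^2+2) * (1 + 1/L^2)) := by rw [← Real.exp_mul]
      _ ≤ _ := by
        apply Real.exp_le_exp.mpr
        have : (L^2+2) * (1 + 1/L^2) = L^2 + 3 + 2 * (1/L^2) := by field_simp; ring
        linarith
  have hxs : x^(1 - w/L) ≤ Real.exp (L^2 + 5 - w * L) := by
    calc x^(1 - w/L) ≤ (Real.exp (L^2+2))^(1 - w/L) := Real.rpow_le_rpow hx0.le hxe (by linarith)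
      _ = Real.exp ((L^2+2) * (1 - w/L)) := by rw [← Real.exp_mul]
      _ ≤ _ := by
        apply Real.exp_le_exp.mpr
        have : (L^2+2) * (1 - w/L) = L^2 + 2 - w * L - 2 * (w/L) := by field_simp; ring
        have : 0 < w / L := by positivity
        linarith
  have hL4 : L^4 ≤ M * Real.exp (a * L) := by
    have := Real.pow_div_factorial_le_exp (a * L) (by positivity) 4
    rw [hM, div_mul_eq_mul_div, le_div_iff₀ (by positivity)]
    rw [show (Nat.factorial 4 : ℝ) = 24 by norm_num [Nat.factorial], div_le_iff₀ (by norm_num)] at this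
    linarith [mul_pow a L 4]
  have hL2' : L^2 ≤ M * Real.exp (a * L) := by
    refine le_trans ?_ hL4
    exact pow_le_pow_right₀ (by linarith) (by norm_num)
  have hM0 : 0 < M := by positivity
  have haw : w = 2 * a := by rw [ha]; ring
  have t1 : 11 / (1 + 1/L^2 - 1)^2 * x^(1 + 1/L^2) / Real.exp L ≤ 11 * M * Real.exp (L^2 + 5 - a * L) := by
    have e : 11 / (1 + 1/L^2 - 1)^2 = 11 * L^4 := by
      rw [show 1 + 1/L^2 - 1 = 1/L^2 by ring]; field_simp
    rw [e, div_le_iff₀ (Real.exp_pos _)]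
    calc 11 * L^4 * x^(1 + 1/L^2) ≤ 11 * (M * Real.exp (a*L)) * Real.exp (L^2 + 5) := by
          refine mul_le_mul (by linarith) hxc (by positivity) (by positivity)
      _ = 11 * M * Real.exp (a * L + (L^2 + 5)) := by rw [Real.exp_add (a*L)]; ring
      _ ≤ 11 * M * Real.exp (L^2 + 5 - a * L + L) := by
          apply mul_le_mul_of_nonneg_left _ (by positivity)
          apply Real.exp_le_exp.mpr; nlinarith
      _ = _ := by rw [Real.exp_add]; ring
  have t2 : 4 * (C * L^2) * x^(1 - w/L) ≤ 4 * C * M * Real.exp (L^2 + 5 - a * L) := by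
    calc 4 * (C * L^2) * x^(1 - w/L) ≤ 4 * (C * (M * Real.exp (a * L))) * Real.exp (L^2 + 5 - w * L) := by
          refine mul_le_mul ?_ hxs (by positivity) (by positivity)
          apply mul_le_mul_of_nonneg_left _ (by norm_num)
          apply mul_le_mul_of_nonneg_left hL2' hC.le
      _ = 4 * C * M * Real.exp (a * L + (L^2 + 5 - w * L)) := by rw [Real.exp_add]; ring
      _ = _ := by congr 2; rw [haw]; ring
  have t3 : C * L^2 * x^(1 + 1/L^2) / Real.exp L^2 ≤ C * M * Real.exp (L^2 + 5 - a * L) := by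
    rw [div_le_iff₀ (by positivity)]
    calc C * L^2 * x^(1 + 1/L^2) ≤ C * (M * Real.exp (a*L)) * Real.exp (L^2 + 5) := by
          refine mul_le_mul (mul_le_mul_of_nonneg_left hL2' hC.le) hxc (by positivity) (by positivity)
      _ = C * M * Real.exp (a * L + (L^2 + 5)) := by rw [Real.exp_add (a*L)]; ring
      _ ≤ C * M * Real.exp (L^2 + 5 - a * L + (L + L)) := by
          apply mul_le_mul_of_nonneg_left _ (by positivity)
          apply Real.exp_le_exp.mpr; nlinarith
      _ = _ := by rw [Real.exp_add, Real.exp_add L]; ring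
  have e : Real.exp (L^2 + 5 - a * L) = Real.exp 5 * Real.exp (L^2) * Real.exp (-(a*L)) := by
    rw [← Real.exp_add, ← Real.exp_add]; congr 1; ring
  calc _ ≤ (11 + 5 * C) * M * Real.exp (L^2 + 5 - a * L) := by linarith
    _ = _ := by rw [e]; ring

end SW

namespace SW

open ArithmeticFunction.vonMangoldt

lemma x_RR {q : ℕ} (b : ZMod q) {x : ℝ} (hx : 1 ≤ x) {M : ℕ} (hM : x ≤ M) :
    x * RR b x = (∑ n ∈ Finset.range M, residueClass b n * max (x - n) 0) - (q.totient:ℝ)⁻¹ * ((x-1)^2/2) := by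
  have hx0 : 0 < x := by linarith
  have hmax : ∀ n : ℕ, x * max (1 - n/x) 0 = max (x - n) 0 := by
    intro n
    rw [mul_max_of_nonneg _ _ hx0.le, mul_zero]
    congr 1; field_simp
  have h1 : ∑' n : ℕ, residueClass b n * max (1 - n / x) 0 = ∑ n ∈ Finset.range M, residueClass b n * max (1 - n / x) 0 := by
    apply tsum_eq_sum
    intro n hn
    rw [Finset.mem_range, not_lt] at hn
    have : x ≤ n := hM.trans (by exact_mod_cast hn)
    rw [max_eq_right, mul_zero]
    have := (one_le_div hx0).mpr this
    linarith
  have h2 : max (1 - x⁻¹) 0 = 1 - x⁻¹ := by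
    apply max_eq_left
    have := inv_le_one_of_one_le₀ hx
    linarith
  rw [RR, h1, h2, mul_sub, Finset.mul_sum]
  congr 1
  · apply Finset.sum_congr rfl; intro n _; rw [← hmax]; ring
  · have : x * x⁻¹ = 1 := mul_inv_cancel₀ hx0.ne'
    have h3 : x * ((q.totient:ℝ)⁻¹ * ((1 - x⁻¹)^2 * x / 2)) = (q.totient:ℝ)⁻¹ * ((x - x * x⁻¹)^2 / 2) := by ring
    rw [h3, this]

/-- prime counting with weights in a residue class -/
lemma sw_psi {B : ℝ} (hB : 0 < B) : ∃ a L₀ C : ℝ, 0 < a ∧ 1 ≤ L₀ ∧ 0 < C ∧ ∀ L, L₀ ≤ L → ∀ (q : ℕ) [NeZero q],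
    (q:ℝ) ≤ L^B → ∀ b : ZMod q, IsUnit b → ∀ m : ℕ, (m:ℝ) ≤ 2 * Real.exp (L^2) →
    |∑ n ∈ Finset.range m, residueClass b n - m / q.totient| ≤ C * Real.exp (L^2) * Real.exp (-(a * L)) := by
  obtain ⟨a, L₀, C, ha, hL₀, hC, H⟩ := RR_small hB
  refine ⟨a/2, max L₀ a, 6 * C + 2, by positivity, le_max_of_le_left hL₀, by positivity, ?_⟩
  intro L hL q _ hq b hb m hm
  have hL1 : L₀ ≤ L := (le_max_left _ _).trans hL
  have hLa : a ≤ L := (le_max_right _ _).trans hL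
  have hL0 : 0 < L := by linarith
  set N := Real.exp (L^2) with hN
  have hN0 : 0 < N := Real.exp_pos _
  set d := Real.exp (-(a/2 * L)) with hd
  have hd0 : 0 < d := Real.exp_pos _
  have hd1 : d ≤ 1 := by rw [hd]; apply Real.exp_le_one_iff.mpr; have : 0 < a/2*L := by positivity
                         linarith
  have hdd : Real.exp (-(a*L)) = d * d := by rw [hd, ← Real.exp_add]; congr 1; ring
  set h := N * d with hh
  have hh1 : 1 ≤ h := by
    rw [hh, hN, hd, ← Real.exp_add]
    apply Real.one_le_exp; nlinarith
  have hhN : h ≤ N := by rw [hh]; nlinarith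
  have hφ : 1 ≤ (q.totient : ℝ) := mod_cast Nat.totient_pos.mpr q.pos_of_neZero
  set φ' := (q.totient : ℝ)⁻¹ with hφ'
  have hφ1 : φ' ≤ 1 := inv_le_one_of_one_le₀ hφ
  have hφ0 : 0 < φ' := by positivity
  have hm0 : (0:ℝ) ≤ m := Nat.cast_nonneg m
  obtain ⟨M, hM⟩ := exists_nat_ge (3 * N)
  have hR : ∀ x, 1 ≤ x → x ≤ 3 * N → |x * RR b x| ≤ 3 * C * h * h := by
    intro x hx hx3
    rw [abs_mul, abs_of_pos (by linarith)]
    have := H L hL1 q hq b hb x hx hx3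
    rw [hdd] at this
    calc x * |RR b x| ≤ 3 * N * (C * N * (d * d)) := mul_le_mul hx3 this (abs_nonneg _) (by positivity)
      _ = _ := by rw [hh]; ring
  have hmM : m ≤ M := by
    have : (m:ℝ) ≤ M := by linarith
    exact_mod_cast this
  have hsum : ∑ n ∈ Finset.range m, residueClass b n = ∑ n ∈ Finset.range M, residueClass b n * (if n < m then 1 else 0) := by
    simp_rw [mul_ite, mul_one, mul_zero]
    rw [← Finset.sum_filter]
    apply Finset.sum_congr _ (fun _ _ => rfl)
    ext n; simp; omega
  have hSnn : 0 ≤ ∑ n ∈ Finset.range m, residueClass b n := Finset.sum_nonneg (fun n _ => residueClass_nonneg b n)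
  rw [div_eq_mul_inv, ← hφ']
  have hgoal : (6 * C + 2) * N * d = (6 * C + 2) * h := by rw [hh]; ring
  rw [hgoal, abs_le]
  have hCh : 0 < C * h := by positivity
  rcases Nat.eq_zero_or_pos m with hm00 | hmpos
  · rw [hm00]; simp; nlinarith
  have hm1 : (1:ℝ) ≤ m := by exact_mod_cast hmpos
  have pm := x_RR b hm1 (M := M) (by linarith)
  have pmR := abs_le.mp (hR m hm1 (by linarith))
  constructor
  · rcases le_or_gt ((m:ℝ) - h) 1 with hc | hc
    · nlinarith
    · have p2 := x_RR b hc.le (M := M) (by linarith)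
      have p2R := abs_le.mp (hR _ hc.le (by linarith))
      have key : (∑ n ∈ Finset.range M, residueClass b n * max ((m:ℝ) - n) 0) -
          (∑ n ∈ Finset.range M, residueClass b n * max ((m:ℝ) - h - n) 0) ≤ h * ∑ n ∈ Finset.range m, residueClass b n := by
        rw [hsum, Finset.mul_sum, ← Finset.sum_sub_distrib]
        apply Finset.sum_le_sum
        intro n _
        have hr := residueClass_nonneg b n
        rw [← mul_sub, mul_left_comm]
        apply mul_le_mul_of_nonneg_left _ hr
        split_ifs with hn
        · have : max ((m:ℝ) - n) 0 ≤ max ((m:ℝ) - h - n) 0 + h := by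
            apply max_le
            · have := le_max_left ((m:ℝ) - h - n) 0; linarith
            · have := le_max_right ((m:ℝ) - h - n) 0; linarith
          linarith
        · have : (m:ℝ) ≤ n := by exact_mod_cast not_lt.mp hn
          rw [max_eq_right (by linarith), max_eq_right (by linarith)]; simp
      have : h * (∑ n ∈ Finset.range m, residueClass b n - m * φ') ≥ h * (-((6 * C + 2) * h)) := by
        have e : φ' * (((m:ℝ)-1)^2/2) - φ' * (((m:ℝ)-h-1)^2/2) = h * m * φ' - φ' * (h + h^2/2) := by ring
        have e2 : φ' * (h + h^2/2) ≤ 2 * h * h := by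
          have e3 : φ' * (h + h^2/2) ≤ 1 * (h + h^2/2) := mul_le_mul_of_nonneg_right hφ1 (by positivity)
          have e4 : h * 1 ≤ h * h := mul_le_mul_of_nonneg_left hh1 (by linarith)
          linarith
        generalize ∑ n ∈ Finset.range m, residueClass b n = S at *
        generalize ∑ n ∈ Finset.range M, residueClass b n * max ((m:ℝ) - n) 0 = D1 at *
        generalize ∑ n ∈ Finset.range M, residueClass b n * max ((m:ℝ) - h - n) 0 = D2 at *
        linarith [pmR.1, pmR.2, p2R.1, p2R.2]
      exact le_of_mul_le_mul_left this (by linarith)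
  · have hc : 1 ≤ (m:ℝ) + h := by linarith
    have p2 := x_RR b hc (M := M) (by linarith)
    have p2R := abs_le.mp (hR _ hc (by linarith))
    have key : h * ∑ n ∈ Finset.range m, residueClass b n ≤ (∑ n ∈ Finset.range M, residueClass b n * max ((m:ℝ) + h - n) 0) -
          (∑ n ∈ Finset.range M, residueClass b n * max ((m:ℝ) - n) 0) := by
      rw [hsum, Finset.mul_sum, ← Finset.sum_sub_distrib]
      apply Finset.sum_le_sum
      intro n _
      have hr := residueClass_nonneg b n
      rw [← mul_sub, mul_left_comm]
      apply mul_le_mul_of_nonneg_left _ hr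
      split_ifs with hn
      · have : (n:ℝ) ≤ m := by exact_mod_cast hn.le
        rw [max_eq_left (by linarith), max_eq_left (by linarith)]; linarith
      · have : max ((m:ℝ) - n) 0 ≤ max ((m:ℝ) + h - n) 0 := max_le_max (by linarith) le_rfl
        linarith
    have : h * (∑ n ∈ Finset.range m, residueClass b n - m * φ') ≤ h * ((6 * C + 2) * h) := by
      have e : φ' * (((m:ℝ)+h-1)^2/2) - φ' * (((m:ℝ)-1)^2/2) = h * m * φ' + φ' * (h^2/2 - h) := by ring
      have e2 : φ' * (h^2/2 - h) ≤ 2 * h * h := by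
        have e3 : φ' * (h^2/2) ≤ 1 * (h^2/2) := mul_le_mul_of_nonneg_right hφ1 (by positivity)
        have e4 : 0 ≤ φ' * h := by positivity
        have e5 : 0 ≤ h * h := by positivity
        have e6 : φ' * (h^2/2 - h) = φ' * (h^2/2) - φ' * h := by ring
        have e7 : h^2 = h * h := by ring
        rw [e6]; rw [e7] at e3 ⊢; linarith
      generalize ∑ n ∈ Finset.range m, residueClass b n = S at *
      generalize ∑ n ∈ Finset.range M, residueClass b n * max ((m:ℝ) - n) 0 = D1 at *
      generalize ∑ n ∈ Finset.range M, residueClass b n * max ((m:ℝ) + h - n) 0 = D2 at *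
      linarith [pmR.1, pmR.2, p2R.1, p2R.2]
    exact le_of_mul_le_mul_left this (by linarith)

/-- Siegel-Walfisz -/
lemma siegel_walfisz {B : ℝ} (hB : 0 < B) : ∃ a L₀ C : ℝ, 0 < a ∧ 1 ≤ L₀ ∧ 0 < C ∧ ∀ L, L₀ ≤ L → ∀ (q : ℕ) [NeZero q],
    (q:ℝ) ≤ L^B → ∀ b : ZMod q, IsUnit b → ∀ m : ℕ, (m:ℝ) ≤ 2 * Real.exp (L^2) →
    |∑ n ∈ Finset.range m, (if n.Prime ∧ (n : ZMod q) = b then Real.log n else 0) - m / q.totient|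
      ≤ C * Real.exp (L^2) * Real.exp (-(a * L)) := by
  obtain ⟨a, L₀, C, ha, hL₀, hC, H⟩ := sw_psi hB
  obtain ⟨C1, hC1⟩ := Chebyshev.psi_sub_theta_le_mul_sqrt
  refine ⟨a, max L₀ (2*a), C + 2 * |C1|, ha, le_max_of_le_left hL₀, by positivity, ?_⟩
  intro L hL q _ hq b hb m hm
  have hL1 : L₀ ≤ L := (le_max_left _ _).trans hL
  have hLa : 2*a ≤ L := (le_max_right _ _).trans hL
  have hL0 : 0 < L := by linarith
  have h1 := H L hL1 q hq b hb m hm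
  have h2 := hC1 m
  rw [Chebyshev.psi_sub_theta_eq_sum_not_prime] at h2
  set P := ∑ n ∈ Finset.range m, (if n.Prime ∧ (n : ZMod q) = b then Real.log n else 0)
  set S := ∑ n ∈ Finset.range m, residueClass b n
  have h3 : S - P = ∑ n ∈ Finset.range m, if ¬ n.Prime then residueClass b n else 0 := by
    rw [← Finset.sum_sub_distrib]
    apply Finset.sum_congr rfl
    intro n _
    by_cases hp : n.Prime
    · simp only [hp, not_true, if_false, true_and, Set.indicator_apply, Set.mem_ofPred_eq,
        ArithmeticFunction.vonMangoldt_apply_prime hp, sub_self]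
    · simp [hp]
  have h4 : 0 ≤ S - P := by
    rw [h3]; apply Finset.sum_nonneg; intro n _
    split_ifs <;> first | exact le_rfl | exact residueClass_nonneg b n
  have h5 : S - P ≤ C1 * √m := by
    refine le_trans ?_ h2
    rw [h3, Nat.floor_natCast, Finset.sum_filter]
    refine le_trans (Finset.sum_le_sum (g := fun n => if ¬ n.Prime then ArithmeticFunction.vonMangoldt n else 0) ?_) ?_
    · intro n _
      split_ifs <;> first | exact le_rfl | exact residueClass_le b n
    · have hsub : ∑ n ∈ Finset.range m, (if ¬ n.Prime then ArithmeticFunction.vonMangoldt n else 0) ≤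
        ∑ n ∈ Finset.range (m+1), (if ¬ n.Prime then ArithmeticFunction.vonMangoldt n else 0) := by
        rw [Finset.sum_range_succ]
        have : 0 ≤ (if ¬ m.Prime then ArithmeticFunction.vonMangoldt m else 0) := by
          split_ifs <;> first | exact le_rfl | exact ArithmeticFunction.vonMangoldt_nonneg
        linarith
      refine hsub.trans (le_of_eq ?_)
      symm
      apply Finset.sum_subset
      · intro n; simp
      · intro n hn hn'
        have : n = 0 := by
          simp at hn hn'; omega
        simp [this]
  have h6 : √m ≤ 2 * (Real.exp (L^2) * Real.exp (-(a*L))) := by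
    rw [← Real.exp_add]
    apply Real.sqrt_le_iff.mpr
    refine ⟨by positivity, hm.trans ?_⟩
    rw [mul_pow, ← Real.exp_nat_mul]
    have : Real.exp (L^2) ≤ Real.exp ((2:ℕ) * (L^2 + -(a*L))) := by
      apply Real.exp_le_exp.mpr; push_cast; nlinarith
    nlinarith [Real.exp_pos (L^2)]
  have h7 : C1 * √m ≤ |C1| * (2 * (Real.exp (L^2) * Real.exp (-(a*L)))) :=
    mul_le_mul (le_abs_self _) h6 (Real.sqrt_nonneg _) (abs_nonneg _)
  rw [abs_le] at h1 ⊢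
  have e : (C + 2 * |C1|) * Real.exp (L^2) * Real.exp (-(a * L)) = C * Real.exp (L^2) * Real.exp (-(a * L)) + |C1| * (2 * (Real.exp (L^2) * Real.exp (-(a*L)))) := by ring
  rw [e]
  constructor <;> linarith [h1.1, h1.2]

end SW

namespace SW

open Classical in
noncomputable def Th (q : ℕ) (b : ZMod q) (m : ℕ) : ℝ :=
  ∑ n ∈ Finset.range m, (if n.Prime ∧ (n : ZMod q) = b then Real.log n else 0)

open Classical in
noncomputable def rhoP (q : ℕ) (b : ZMod q) : ℝ := if IsUnit b then (q.totient : ℝ)⁻¹ else 0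

lemma Th_nonneg (q : ℕ) (b : ZMod q) (m : ℕ) : 0 ≤ Th q b m := by
  apply Finset.sum_nonneg; intro n _
  split_ifs
  · exact Real.log_natCast_nonneg n
  · exact le_rfl

lemma Th_nonunit (q : ℕ) [NeZero q] (b : ZMod q) (hb : ¬ IsUnit b) (m : ℕ) : Th q b m ≤ (q:ℝ)^2 := by
  have hq : 0 < q := q.pos_of_neZero
  classical
  calc Th q b m ≤ ∑ n ∈ Finset.range m, (if n ∈ Nat.divisors q then (q:ℝ) else 0) := by
        apply Finset.sum_le_sum
        intro n _
        split_ifs with h1 h2 h2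
        · have : n ≤ q := Nat.divisor_le h2
          calc Real.log n ≤ n := Real.log_le_self (Nat.cast_nonneg n)
            _ ≤ q := by exact_mod_cast this
        · exfalso
          apply h2
          rw [Nat.mem_divisors]
          refine ⟨?_, hq.ne'⟩
          by_contra h
          apply hb
          rw [← h1.2, ZMod.isUnit_iff_coprime]
          exact (Nat.Prime.coprime_iff_not_dvd h1.1).mpr h
        · positivity
        · exact le_rfl
    _ = ∑ n ∈ (Finset.range m).filter (fun n => n ∈ Nat.divisors q), (q:ℝ) := by rw [Finset.sum_filter]
    _ ≤ ∑ n ∈ Nat.divisors q, (q:ℝ) := by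
        apply Finset.sum_le_sum_of_subset_of_nonneg
        · intro n; simp
        · intros; positivity
    _ ≤ _ := by
        rw [Finset.sum_const, nsmul_eq_mul, sq]
        apply mul_le_mul_of_nonneg_right _ (by positivity)
        exact_mod_cast Nat.card_divisors_le_self q

lemma sw_ext {B : ℝ} (hB : 0 < B) : ∃ a L₀ C : ℝ, 0 < a ∧ 1 ≤ L₀ ∧ 0 < C ∧ ∀ L, L₀ ≤ L → ∀ (q : ℕ) [NeZero q],
    (q:ℝ) ≤ L^B → ∀ b : ZMod q, ∀ m : ℕ, (m:ℝ) ≤ 2 * Real.exp (L^2) →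
    |Th q b m - m * rhoP q b| ≤ C * Real.exp (L^2) * Real.exp (-(a * L)) := by
  obtain ⟨a, L₀, C, ha, hL₀, hC, H⟩ := siegel_walfisz hB
  obtain ⟨L₁, hL₁⟩ := Filter.eventually_atTop.mp (ev_log (2*B) 0)
  refine ⟨a, max (max L₀ L₁) (a + 1), C + 1, ha, le_max_of_le_left (le_max_of_le_left hL₀), by positivity, ?_⟩
  intro L hL q _ hq b m hm
  have hL1 : L₀ ≤ L := (le_max_left _ _).trans ((le_max_left _ _).trans hL)
  have hL2 : L₁ ≤ L := (le_max_right _ _).trans ((le_max_left _ _).trans hL)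
  have hLa : a + 1 ≤ L := (le_max_right _ _).trans hL
  have hL0 : 0 < L := by linarith
  have hpos : 0 < Real.exp (L^2) * Real.exp (-(a * L)) := by positivity
  by_cases hb : IsUnit b
  · have := H L hL1 q hq b hb m hm
    rw [rhoP, if_pos hb, ← div_eq_mul_inv]
    refine le_trans (le_of_eq ?_) (this.trans ?_)
    · unfold Th; congr!
    · nlinarith
  · rw [rhoP, if_neg hb, mul_zero, sub_zero, abs_of_nonneg (Th_nonneg q b m)]
    refine (Th_nonunit q b hb m).trans ?_
    have h1 : (q:ℝ)^2 ≤ Real.exp L := by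
      calc (q:ℝ)^2 ≤ (L^B)^2 := by gcongr
        _ = Real.exp (2 * B * Real.log L) := by
          rw [← Real.rpow_natCast, ← Real.rpow_mul hL0.le, Real.rpow_def_of_pos hL0]; congr 1; push_cast; ring
        _ ≤ _ := by apply Real.exp_le_exp.mpr; have := hL₁ L hL2; linarith
    have h2 : Real.exp L ≤ Real.exp (L^2) * Real.exp (-(a * L)) := by
      rw [← Real.exp_add]; apply Real.exp_le_exp.mpr; nlinarith
    nlinarith

/-- one-dimensional weights -/
noncomputable def wt (isP : Prop) [Decidable isP] (n : ℤ) : ℝ :=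
  if isP then (if Prime n then Real.log |(n:ℝ)| else 0) else 1

lemma wt_nonneg (isP : Prop) [Decidable isP] (n : ℤ) : 0 ≤ wt isP n := by
  unfold wt
  split_ifs with h1 h2
  · have : (1:ℝ) ≤ |(n:ℝ)| := by
      have : 1 ≤ |n| := Int.one_le_abs h2.ne_zero
      exact_mod_cast this
    exact Real.log_nonneg this
  · exact le_rfl
  · exact zero_le_one

lemma wt_le (isP : Prop) [Decidable isP] (n : ℤ) : wt isP n ≤ 1 + |(n:ℝ)| := by
  unfold wt
  split_ifs with h1 h2
  · have := Real.log_le_self (abs_nonneg (n:ℝ)); linarith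
  · positivity
  · have := abs_nonneg (n:ℝ); linarith

open Classical in
noncomputable def rho (isP : Prop) (q : ℕ) (r : ZMod q) : ℝ := if isP then rhoP q r else (q:ℝ)⁻¹

lemma rho_nonneg (isP : Prop) (q : ℕ) (r : ZMod q) : 0 ≤ rho isP q r := by
  unfold rho rhoP; split_ifs <;> positivity

lemma rho_le_one (isP : Prop) (q : ℕ) (r : ZMod q) : rho isP q r ≤ 1 := by
  have h : ∀ n : ℕ, (n:ℝ)⁻¹ ≤ 1 := by
    intro n
    rcases Nat.eq_zero_or_pos n with rfl | hn
    · simp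
    · exact inv_le_one_of_one_le₀ (by exact_mod_cast hn)
  unfold rho rhoP; split_ifs
  · exact h _
  · exact zero_le_one
  · exact h _

open Classical in
noncomputable def Ac (isP : Prop) (q M : ℕ) (j : ℤ) (r : ZMod q) : ℝ :=
  ∑ n ∈ Finset.Ico (j * M) ((j+1) * M), if (n : ZMod q) = r then wt isP n else 0

lemma Ac_int (q M : ℕ) [NeZero q] (j : ℤ) (r : ZMod q) : |Ac False q M j r - M * rho False q r| ≤ 1 := by
  classical
  have hq : 0 < q := q.pos_of_neZero
  have h1 : Ac False q M j r = (((Finset.Ico (j * M) ((j+1) * M)).filter (fun n => n ≡ (r.val : ℤ) [ZMOD (q:ℤ)])).card : ℝ) := by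
    rw [Ac, Finset.card_filter]
    push_cast
    apply Finset.sum_congr rfl
    intro n _
    have : ((n : ZMod q) = r) ↔ n ≡ (r.val : ℤ) [ZMOD (q:ℤ)] := by
      rw [← ZMod.intCast_eq_intCast_iff]
      simp
    simp only [this, wt, if_false]
  have hc := Int.Ico_filter_modEq_card (a := j * M) (b := (j+1) * M) (r := (q:ℤ)) (by exact_mod_cast hq) (r.val : ℤ)
  have h2 : (((Finset.Ico (j * M) ((j+1) * M)).filter (fun n => n ≡ (r.val : ℤ) [ZMOD (q:ℤ)])).card : ℤ) =
     max (⌈((((j+1) * M : ℤ):ℚ) - ((r.val:ℤ):ℚ)) / ((q:ℤ):ℚ)⌉ - ⌈(((j * M : ℤ):ℚ) - ((r.val:ℤ):ℚ)) / ((q:ℤ):ℚ)⌉) 0 := by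
    rw [← hc]
  set u : ℚ := (((j * M : ℤ):ℚ) - ((r.val:ℤ):ℚ)) / ((q:ℤ):ℚ) with hu
  set v : ℚ := ((((j+1) * M : ℤ):ℚ) - ((r.val:ℤ):ℚ)) / ((q:ℤ):ℚ) with hv
  have huv : v - u = (M:ℚ) / q := by rw [hu, hv]; push_cast; ring
  have hMq : (0:ℚ) ≤ (M:ℚ)/q := by positivity
  have hle : ⌈u⌉ ≤ ⌈v⌉ := Int.ceil_mono (by linarith)
  rw [max_eq_left (by linarith)] at h2
  have e : rho False q r = (q:ℝ)⁻¹ := by simp [rho]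
  rw [h1, e]
  have h3 : (((Finset.Ico (j * M) ((j+1) * M)).filter (fun n => n ≡ (r.val : ℤ) [ZMOD (q:ℤ)])).card : ℝ) = (((⌈v⌉ - ⌈u⌉ : ℤ) : ℚ) : ℝ) := by
    rw [← h2]; push_cast; rfl
  rw [h3]
  have e2 : (M:ℝ) * (q:ℝ)⁻¹ = ((v - u : ℚ) : ℝ) := by rw [huv]; push_cast; ring
  rw [e2]
  have : |((⌈v⌉ - ⌈u⌉ : ℤ) : ℚ) - (v - u)| ≤ 1 := by
    push_cast
    have a1 := Int.le_ceil v
    have a2 := Int.ceil_lt_add_one v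
    have a3 := Int.le_ceil u
    have a4 := Int.ceil_lt_add_one u
    rw [abs_le]; constructor <;> linarith
  exact_mod_cast this

lemma Th_diff (q : ℕ) (b : ZMod q) (m M : ℕ) : Th q b (m + M) - Th q b m =
    ∑ n ∈ Finset.Ico m (m+M), (if n.Prime ∧ (n : ZMod q) = b then Real.log n else 0) := by
  classical
  rw [Th, Th, Finset.sum_Ico_eq_sub _ (by omega)]

lemma Ac_nat (q M : ℕ) (m : ℕ) (r : ZMod q) :
    Ac True q M m r = Th q r (m*M + M) - Th q r (m*M) := by
  classical
  rw [Th_diff, Ac]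
  symm
  refine Finset.sum_bij (fun (n:ℕ) _ => (n:ℤ)) ?_ ?_ ?_ ?_
  · intro n hn
    simp only [Finset.mem_Ico] at hn ⊢
    constructor
    · exact_mod_cast hn.1
    · have := hn.2; push_cast [add_mul]; zify at this; linarith
  · intro a _ b _ h; exact_mod_cast h
  · intro n hn
    simp only [Finset.mem_Ico] at hn
    have h0 : 0 ≤ n := le_trans (by positivity) hn.1
    lift n to ℕ using h0
    refine ⟨n, ?_, rfl⟩
    simp only [Finset.mem_Ico]
    constructor
    · exact_mod_cast hn.1
    · have := hn.2; zify; linarith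
  · intro n _
    by_cases h : (n : ZMod q) = r <;> simp [h, wt, Nat.prime_iff_prime_int]

lemma Ac_neg (q M : ℕ) (m : ℕ) (r : ZMod q) :
    Ac True q M (-(m+1 : ℕ)) r = Th q (-r) (m*M + 1 + M) - Th q (-r) (m*M + 1) := by
  classical
  rw [Th_diff, Ac]
  symm
  refine Finset.sum_bij (fun (n:ℕ) _ => -(n:ℤ)) ?_ ?_ ?_ ?_
  · intro n hn
    simp only [Finset.mem_Ico] at hn ⊢
    obtain ⟨h1, h2⟩ := hn
    zify at h1 h2
    push_cast
    constructor <;> linarith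
  · intro a _ b _ h; simpa using h
  · intro n hn
    simp only [Finset.mem_Ico] at hn
    obtain ⟨h1, h2⟩ := hn
    push_cast at h1 h2
    have h0 : 0 ≤ -n := by
      have : (0:ℤ) ≤ m * M := by positivity
      linarith
    obtain ⟨l, hl⟩ := Int.eq_ofNat_of_zero_le h0
    refine ⟨l, ?_, by rw [← hl]; ring⟩
    simp only [Finset.mem_Ico]
    zify
    rw [← hl]
    constructor <;> linarith
  · intro n _
    have : ((-(n:ℤ) : ℤ) : ZMod q) = r ↔ (n : ZMod q) = -r := by
      push_cast; exact neg_eq_iff_eq_neg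
    have hp : Prime (-(n:ℤ)) ↔ Prime (n:ℤ) := ⟨fun h => by simpa using h.neg, fun h => h.neg⟩
    simp only [this, wt, if_true, hp, Nat.prime_iff_prime_int]
    by_cases h : (n : ZMod q) = -r <;> simp [h]

lemma rhoP_neg (q : ℕ) (r : ZMod q) : rhoP q (-r) = rhoP q r := by
  have h : IsUnit (-r) ↔ IsUnit r := IsUnit.neg_iff r
  by_cases hr : IsUnit r
  · simp [rhoP, hr, h]
  · have h2 : ¬ IsUnit (-r) := fun h3 => hr (h.1 h3)
    simp [rhoP, hr, h2]

/-- cell estimate for the weights -/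
lemma Ac_est {q M J : ℕ} [NeZero q] {E X : ℝ} (hE : 1 ≤ 2 * E) (hX : (J * M + 1 : ℕ) ≤ X)
    (H : ∀ b : ZMod q, ∀ m : ℕ, (m:ℝ) ≤ X → |Th q b m - m * rhoP q b| ≤ E)
    (isP : Prop) (j : ℤ) (hj : -J ≤ j) (hj' : j < J) (r : ZMod q) :
    |Ac isP q M j r - M * rho isP q r| ≤ 2 * E := by
  by_cases hP : isP
  · simp only [hP]
    have e : rho True q r = rhoP q r := by simp [rho]
    rw [e]
    rcases le_or_gt 0 j with h0 | h0
    · lift j to ℕ using h0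
      have hj2 : j + 1 ≤ J := by omega
      have hle : j * M + M ≤ J * M := by nlinarith
      rw [Ac_nat]
      have h1 := H r (j*M+M) (le_trans (by exact_mod_cast (by omega)) hX)
      have h2 := H r (j*M) (le_trans (by exact_mod_cast (by omega)) hX)
      rw [abs_le] at *
      push_cast at h1 h2
      constructor <;> linarith [h1.1, h1.2, h2.1, h2.2]
    · obtain ⟨m, hm⟩ : ∃ m : ℕ, j = -((m+1 : ℕ) : ℤ) := ⟨(-j-1).toNat, by omega⟩
      have hj2 : m + 1 ≤ J := by omega
      have hle : m * M + M ≤ J * M := by nlinarith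
      rw [hm, Ac_neg]
      have h1 := H (-r) (m*M+1+M) (le_trans (by exact_mod_cast (by omega)) hX)
      have h2 := H (-r) (m*M+1) (le_trans (by exact_mod_cast (by omega)) hX)
      rw [rhoP_neg] at h1 h2
      rw [abs_le] at *
      push_cast at h1 h2
      constructor <;> linarith [h1.1, h1.2, h2.1, h2.2]
  · simp only [hP]
    exact (Ac_int q M j r).trans hE

end SW

namespace SW

lemma prod_diff {ι : Type*} (s : Finset ι) (a b : ι → ℝ) {R E : ℝ} (hR : 0 ≤ R) (hE : 0 ≤ E)
    (ha : ∀ i ∈ s, |a i| ≤ R) (hb : ∀ i ∈ s, |b i| ≤ R) (hab : ∀ i ∈ s, |a i - b i| ≤ E) :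
    R * |∏ i ∈ s, a i - ∏ i ∈ s, b i| ≤ s.card * R ^ s.card * E := by
  classical
  induction s using Finset.induction_on with
  | empty => simp
  | insert x s hx ih =>
    have ih' := ih (fun i hi => ha i (Finset.mem_insert_of_mem hi)) (fun i hi => hb i (Finset.mem_insert_of_mem hi))
      (fun i hi => hab i (Finset.mem_insert_of_mem hi))
    rw [Finset.prod_insert hx, Finset.prod_insert hx, Finset.card_insert_of_notMem hx]
    have hbp : |∏ i ∈ s, b i| ≤ R ^ s.card := by
      rw [Finset.abs_prod]
      calc _ ≤ ∏ i ∈ s, R := Finset.prod_le_prod (fun _ _ => abs_nonneg _) (fun i hi => hb i (Finset.mem_insert_of_mem hi))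
        _ = _ := by simp
    have hax := ha x (Finset.mem_insert_self _ _)
    have habx := hab x (Finset.mem_insert_self _ _)
    have e : a x * ∏ i ∈ s, a i - b x * ∏ i ∈ s, b i = a x * (∏ i ∈ s, a i - ∏ i ∈ s, b i) + (a x - b x) * ∏ i ∈ s, b i := by ring
    rw [e]
    have h1 : |a x * (∏ i ∈ s, a i - ∏ i ∈ s, b i)| ≤ R * |∏ i ∈ s, a i - ∏ i ∈ s, b i| := by
      rw [abs_mul]; exact mul_le_mul_of_nonneg_right hax (abs_nonneg _)
    have h2 : |(a x - b x) * ∏ i ∈ s, b i| ≤ E * R ^ s.card := by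
      rw [abs_mul]; exact mul_le_mul habx hbp (abs_nonneg _) hE
    have h3 := abs_add_le (a x * (∏ i ∈ s, a i - ∏ i ∈ s, b i)) ((a x - b x) * ∏ i ∈ s, b i)
    calc R * |a x * (∏ i ∈ s, a i - ∏ i ∈ s, b i) + (a x - b x) * ∏ i ∈ s, b i|
        ≤ R * (s.card * R ^ s.card * E + E * R ^ s.card) :=
          mul_le_mul_of_nonneg_left (by linarith) hR
      _ = _ := by push_cast; ring

open Classical in
lemma sum_class {k q : ℕ} [NeZero q] {α : Type*} (S : Fin k → Finset α) (c : α → ZMod q)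
    (χ : (Fin k → ZMod q) → ℂ) (w : Fin k → α → ℝ) :
    ∑ v ∈ Fintype.piFinset S, χ (fun i => c (v i)) * ((∏ i, w i (v i) : ℝ) : ℂ) =
      ∑ r : Fin k → ZMod q, χ r * ((∏ i, ∑ n ∈ S i, (if c n = r i then w i n else 0) : ℝ) : ℂ) := by
  have h : ∀ r : Fin k → ZMod q, χ r * ((∏ i, ∑ n ∈ S i, (if c n = r i then w i n else 0) : ℝ) : ℂ)
      = ∑ v ∈ Fintype.piFinset S, if (fun i => c (v i)) = r then χ r * ((∏ i, w i (v i) : ℝ) : ℂ) else 0 := by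
    intro r
    rw [Finset.prod_univ_sum, Complex.ofReal_sum, Finset.mul_sum]
    apply Finset.sum_congr rfl
    intro v _
    rw [Finset.prod_ite_zero]
    by_cases hv : (fun i => c (v i)) = r
    · have : ∀ i ∈ Finset.univ, c (v i) = r i := fun i _ => congrFun hv i
      rw [if_pos hv, if_pos this]
    · have : ¬ ∀ i ∈ Finset.univ, c (v i) = r i := fun h => hv (funext fun i => h i (Finset.mem_univ i))
      rw [if_neg hv, if_neg this]; simp
  rw [Finset.sum_congr rfl (fun r _ => h r), Finset.sum_comm]
  apply Finset.sum_congr rfl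
  intro v _
  rw [Finset.sum_ite_eq]; simp

/-- the real cell -/
def rcell {k : ℕ} (M : ℕ) (j : Fin k → ℤ) : Set (Fin k → ℝ) :=
  Set.pi Set.univ fun i => Set.Ico ((j i : ℝ) * M) (((j i : ℝ) + 1) * M)

lemma rcell_meas {k : ℕ} (M : ℕ) (j : Fin k → ℤ) : MeasurableSet (rcell M j) :=
  MeasurableSet.univ_pi fun _ => measurableSet_Ico

lemma rcell_vol {k : ℕ} (M : ℕ) (j : Fin k → ℤ) : (volume (rcell M j)) = ENNReal.ofReal ((M:ℝ)^k) := by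
  rw [rcell, Real.volume_pi_Ico]
  rw [ENNReal.ofReal_pow (by positivity)]
  have : ∀ i, ((j i : ℝ) + 1) * M - (j i : ℝ) * M = M := fun i => by ring
  simp [this]

noncomputable def icell {k : ℕ} (M : ℕ) (j : Fin k → ℤ) : Finset (Fin k → ℤ) :=
  Fintype.piFinset fun i => Finset.Ico (j i * M) ((j i + 1) * M)

lemma cell_est {k q M : ℕ} [NeZero q] (P : Fin k → Prop) [∀ i, Decidable (P i)] (χ : (Fin k → ZMod q) → ℂ)
    (hχ : ∀ r, ‖χ r‖ ≤ 1) (H : (Fin k → ℝ) → ℂ) (Hc : Continuous H) {B δ E : ℝ}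
    (hB : ∀ x, ‖H x‖ ≤ B) (j : Fin k → ℤ)
    (hδ0 : 0 ≤ δ) (hE0 : 0 ≤ E) (hM : 0 < M)
    (hδ : ∀ x ∈ rcell M j, ‖H x - H (fun i => (j i : ℝ) * M)‖ ≤ δ)
    (hE : ∀ i r, |Ac (P i) q M (j i) r - M * rho (P i) q r| ≤ E) :
    ‖∑ v ∈ icell M j, χ (fun i => (v i : ZMod q)) * H (fun i => (v i : ℝ)) * ((∏ i, wt (P i) (v i) : ℝ) : ℂ)
      - (∑ r, χ r * ((∏ i, rho (P i) q (r i) : ℝ) : ℂ)) * ∫ x in rcell M j, H x‖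
      ≤ (q:ℝ)^k * ((M+E)^k * (2 * δ + B * k * (E / (M+E)))) := by
  classical
  set h0 := H (fun i => (j i : ℝ) * M) with hh0
  set R : ℝ := M + E with hR
  have hMr : (0:ℝ) < M := by exact_mod_cast hM
  have hR0 : 0 < R := by linarith
  have hMR : (M:ℝ) ≤ R := by linarith
  have hB0 : 0 ≤ B := (norm_nonneg _).trans (hB 0)
  have hAcd : ∀ i r, Ac (P i) q M (j i) r = ∑ n ∈ Finset.Ico (j i * M) ((j i+1) * M), (if (n : ZMod q) = r then wt (P i) n else 0) := by
    intro i r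
    unfold Ac
    apply Finset.sum_congr rfl
    intro n _
    congr 1
    unfold wt; congr
  have hA0 : ∀ i r, 0 ≤ Ac (P i) q M (j i) r := by
    intro i r
    rw [hAcd]
    apply Finset.sum_nonneg
    intro n _
    split_ifs
    · exact wt_nonneg _ _
    · exact le_rfl
  have hMρ0 : ∀ i r, 0 ≤ M * rho (P i) q r := fun i r => mul_nonneg hMr.le (rho_nonneg _ _ _)
  have hMρ : ∀ i r, M * rho (P i) q r ≤ M := fun i r => by
    have := mul_le_mul_of_nonneg_left (rho_le_one (P i) q r) hMr.le; linarith
  have hAR : ∀ i r, Ac (P i) q M (j i) r ≤ R := fun i r => by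
    have := (abs_le.1 (hE i r)).2; have := hMρ i r; linarith
  have hcard : ∀ X : ℝ, ∑ _r : Fin k → ZMod q, X = (q:ℝ)^k * X := by
    intro X; simp [ZMod.card]
  -- the identity
  have hid : ∀ χ' : (Fin k → ZMod q) → ℂ, ∑ v ∈ icell M j, χ' (fun i => (v i : ZMod q)) * ((∏ i, wt (P i) (v i) : ℝ) : ℂ)
      = ∑ r, χ' r * ((∏ i, Ac (P i) q M (j i) (r i) : ℝ) : ℂ) := by
    intro χ'
    have := sum_class (q := q) (fun i => Finset.Ico (j i * M) ((j i + 1) * M)) (fun n : ℤ => (n : ZMod q)) χ' (fun i n => wt (P i) n)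
    rw [icell, this]
    apply Finset.sum_congr rfl
    intro r _
    simp only [hAcd]
  -- total mass
  have hmass : ∑ v ∈ icell M j, ∏ i, wt (P i) (v i) ≤ (q:ℝ)^k * R^k := by
    have h1 := hid (fun _ => 1)
    simp only [one_mul] at h1
    have h2 : ∑ v ∈ icell M j, ∏ i, wt (P i) (v i) = ∑ r : Fin k → ZMod q, ∏ i, Ac (P i) q M (j i) (r i) := by
      exact_mod_cast h1
    rw [h2, ← hcard]
    apply Finset.sum_le_sum
    intro r _
    calc _ ≤ ∏ i : Fin k, R := Finset.prod_le_prod (fun i _ => hA0 _ _) (fun i _ => hAR _ _)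
      _ = _ := by simp
  have hGn : ‖∑ r, χ r * ((∏ i, rho (P i) q (r i) : ℝ) : ℂ)‖ ≤ (q:ℝ)^k := by
    have := hcard 1
    rw [mul_one] at this
    rw [← this]
    apply norm_sum_le_of_le
    intro r _
    rw [norm_mul, Complex.norm_real, Real.norm_eq_abs, Finset.abs_prod]
    have : ∏ i, |rho (P i) q (r i)| ≤ 1 := by
      apply Finset.prod_le_one (fun _ _ => abs_nonneg _)
      intro i _
      rw [abs_of_nonneg (rho_nonneg _ _ _)]; exact rho_le_one _ _ _
    calc _ ≤ (1:ℝ) * 1 := mul_le_mul (hχ r) this (Finset.prod_nonneg fun _ _ => abs_nonneg _) zero_le_one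
      _ = 1 := by ring
  set G := ∑ r, χ r * ((∏ i, rho (P i) q (r i) : ℝ) : ℂ) with hG
  -- T1
  have T1 : ‖∑ v ∈ icell M j, χ (fun i => (v i : ZMod q)) * (H (fun i => (v i : ℝ)) - h0) * ((∏ i, wt (P i) (v i) : ℝ) : ℂ)‖
      ≤ (q:ℝ)^k * R^k * δ := by
    have : ∀ v ∈ icell M j, ‖χ (fun i => (v i : ZMod q)) * (H (fun i => (v i : ℝ)) - h0) * ((∏ i, wt (P i) (v i) : ℝ) : ℂ)‖
       ≤ (∏ i, wt (P i) (v i)) * δ := by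
      intro v hv
      have hw : 0 ≤ ∏ i, wt (P i) (v i) := Finset.prod_nonneg fun i _ => wt_nonneg _ _
      rw [norm_mul, norm_mul, Complex.norm_real, Real.norm_eq_abs, abs_of_nonneg hw, mul_comm]
      apply mul_le_mul_of_nonneg_left _ hw
      have hin : (fun i => (v i : ℝ)) ∈ rcell M j := by
        rw [rcell, Set.mem_univ_pi]
        intro i
        rw [icell, Fintype.mem_piFinset] at hv
        have := Finset.mem_Ico.1 (hv i)
        exact ⟨by exact_mod_cast this.1, by exact_mod_cast this.2⟩
      calc _ ≤ 1 * δ := mul_le_mul (hχ _) (hδ _ hin) (norm_nonneg _) zero_le_one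
        _ = δ := one_mul _
    refine (norm_sum_le_of_le _ this).trans ?_
    rw [← Finset.sum_mul]
    exact mul_le_mul_of_nonneg_right hmass hδ0
  -- T2
  have T2 : ‖∑ v ∈ icell M j, χ (fun i => (v i : ZMod q)) * ((∏ i, wt (P i) (v i) : ℝ) : ℂ) - G * ((M:ℝ)^k : ℝ)‖
      ≤ (q:ℝ)^k * (k * R^k * (E / R)) := by
    rw [hid, hG, Finset.sum_mul, ← Finset.sum_sub_distrib, ← hcard]
    apply norm_sum_le_of_le
    intro r _
    have e : χ r * ((∏ i, Ac (P i) q M (j i) (r i) : ℝ) : ℂ) - χ r * ((∏ i, rho (P i) q (r i) : ℝ) : ℂ) * ((M:ℝ)^k : ℝ)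
      = χ r * ((∏ i, Ac (P i) q M (j i) (r i) - ∏ i, (M * rho (P i) q (r i)) : ℝ) : ℂ) := by
      rw [Finset.prod_mul_distrib]; simp; ring
    rw [e, norm_mul, Complex.norm_real, Real.norm_eq_abs]
    have hd := prod_diff Finset.univ (fun i => Ac (P i) q M (j i) (r i)) (fun i => M * rho (P i) q (r i)) hR0.le hE0
      (fun i _ => by rw [abs_of_nonneg (hA0 _ _)]; exact hAR _ _)
      (fun i _ => by rw [abs_of_nonneg (hMρ0 _ _)]; exact (hMρ _ _).trans hMR)
      (fun i _ => hE i _)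
    rw [Finset.card_univ, Fintype.card_fin] at hd
    have hd' : |∏ i, Ac (P i) q M (j i) (r i) - ∏ i, (M * rho (P i) q (r i))| ≤ k * R^k * (E / R) := by
      rw [← mul_div_assoc, le_div_iff₀ hR0, mul_comm]; exact hd
    calc _ ≤ 1 * (k * R^k * (E / R)) := mul_le_mul (hχ _) hd' (abs_nonneg _) zero_le_one
      _ = _ := one_mul _
  -- T3
  have hvol : volume.real (rcell M j) = (M:ℝ)^k := by
    rw [Measure.real, rcell_vol, ENNReal.toReal_ofReal (by positivity)]
  have hfin : volume (rcell M j) < ∞ := by rw [rcell_vol]; exact ENNReal.ofReal_lt_top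
  have hIntg : IntegrableOn H (rcell M j) := by
    apply Measure.integrableOn_of_bounded (M := B) hfin.ne Hc.aestronglyMeasurable
    exact Filter.Eventually.of_forall hB
  have T3 : ‖(∫ x in rcell M j, H x) - h0 * ((M:ℝ)^k : ℝ)‖ ≤ δ * (M:ℝ)^k := by
    have e : h0 * ((M:ℝ)^k : ℝ) = ∫ _x in rcell M j, h0 := by
      rw [setIntegral_const, hvol, Complex.real_smul, mul_comm]
    rw [e, ← integral_sub hIntg (integrableOn_const hfin.ne), ← hvol]
    exact norm_setIntegral_le_of_norm_le_const hfin hδ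
  have key : ∑ v ∈ icell M j, χ (fun i => (v i : ZMod q)) * H (fun i => (v i : ℝ)) * ((∏ i, wt (P i) (v i) : ℝ) : ℂ)
      - G * ∫ x in rcell M j, H x =
      ∑ v ∈ icell M j, χ (fun i => (v i : ZMod q)) * (H (fun i => (v i : ℝ)) - h0) * ((∏ i, wt (P i) (v i) : ℝ) : ℂ)
      + h0 * (∑ v ∈ icell M j, χ (fun i => (v i : ZMod q)) * ((∏ i, wt (P i) (v i) : ℝ) : ℂ) - G * ((M:ℝ)^k : ℝ))
      - G * ((∫ x in rcell M j, H x) - h0 * ((M:ℝ)^k : ℝ)) := by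
    have : ∑ v ∈ icell M j, χ (fun i => (v i : ZMod q)) * (H (fun i => (v i : ℝ)) - h0) * ((∏ i, wt (P i) (v i) : ℝ) : ℂ)
      = ∑ v ∈ icell M j, χ (fun i => (v i : ZMod q)) * H (fun i => (v i : ℝ)) * ((∏ i, wt (P i) (v i) : ℝ) : ℂ)
       - h0 * ∑ v ∈ icell M j, χ (fun i => (v i : ZMod q)) * ((∏ i, wt (P i) (v i) : ℝ) : ℂ) := by
      rw [Finset.mul_sum, ← Finset.sum_sub_distrib]
      apply Finset.sum_congr rfl; intro v _; ring
    rw [this]; ring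
  rw [key]
  refine (norm_sub_le _ _).trans ?_
  have a1 := norm_add_le (∑ v ∈ icell M j, χ (fun i => (v i : ZMod q)) * (H (fun i => (v i : ℝ)) - h0) * ((∏ i, wt (P i) (v i) : ℝ) : ℂ))
      (h0 * (∑ v ∈ icell M j, χ (fun i => (v i : ZMod q)) * ((∏ i, wt (P i) (v i) : ℝ) : ℂ) - G * ((M:ℝ)^k : ℝ)))
  have a2 : ‖h0 * (∑ v ∈ icell M j, χ (fun i => (v i : ZMod q)) * ((∏ i, wt (P i) (v i) : ℝ) : ℂ) - G * ((M:ℝ)^k : ℝ))‖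
      ≤ B * ((q:ℝ)^k * (k * R^k * (E / R))) := by
    rw [norm_mul]; exact mul_le_mul (hB _) T2 (norm_nonneg _) hB0
  have a3 : ‖G * ((∫ x in rcell M j, H x) - h0 * ((M:ℝ)^k : ℝ))‖ ≤ (q:ℝ)^k * (δ * R^k) := by
    rw [norm_mul]
    exact mul_le_mul hGn (T3.trans (mul_le_mul_of_nonneg_left (pow_le_pow_left₀ hMr.le hMR k) hδ0)) (norm_nonneg _) (by positivity)
  calc _ ≤ (q:ℝ)^k * R^k * δ + B * ((q:ℝ)^k * (k * R^k * (E / R))) + (q:ℝ)^k * (δ * R^k) := by linarith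
    _ = _ := by ring

end SW

namespace SW

lemma mem_rcell_iff {k M : ℕ} (hM : 0 < M) (j : Fin k → ℤ) (x : Fin k → ℝ) :
    x ∈ rcell M j ↔ j = fun i => ⌊x i / M⌋ := by
  have hMr : (0:ℝ) < M := by exact_mod_cast hM
  rw [rcell, Set.mem_univ_pi]
  have : ∀ i, x i ∈ Set.Ico ((j i : ℝ) * M) (((j i : ℝ) + 1) * M) ↔ j i = ⌊x i / M⌋ := by
    intro i
    rw [eq_comm, Int.floor_eq_iff, le_div_iff₀ hMr, div_lt_iff₀ hMr, Set.mem_Ico]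
  simp only [this]
  exact ⟨fun h => funext h, fun h i => congrFun h i⟩

lemma mem_icell_iff {k M : ℕ} (hM : 0 < M) (j : Fin k → ℤ) (v : Fin k → ℤ) :
    v ∈ icell M j ↔ (fun i => v i / (M:ℤ)) = j := by
  have hMr : (0:ℤ) < M := by exact_mod_cast hM
  rw [icell, Fintype.mem_piFinset]
  have : ∀ i, v i ∈ Finset.Ico (j i * M) ((j i + 1) * M) ↔ v i / (M:ℤ) = j i := by
    intro i
    rw [Finset.mem_Ico, ← Int.le_ediv_iff_mul_le hMr, ← Int.ediv_lt_iff_lt_mul hMr]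
    omega
  simp only [this]
  exact ⟨fun h => funext h, fun h i => congrFun h i⟩

noncomputable def cells (k J : ℕ) : Finset (Fin k → ℤ) := Fintype.piFinset fun _ => Finset.Ico (-(J:ℤ)) J

noncomputable def box (k L : ℕ) : Finset (Fin k → ℤ) := Fintype.piFinset fun _ => Finset.Ico (-(L:ℤ)) L

lemma cells_card (k J : ℕ) : ((cells k J).card : ℝ) = (2 * (J:ℝ))^k := by
  have : ((J:ℤ) + J).toNat = 2 * J := by omega
  rw [cells, Fintype.card_piFinset]; simp [this]

lemma sum_box {k J M : ℕ} (hM : 0 < M) (f : (Fin k → ℤ) → ℂ) :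
    ∑ v ∈ box k (J * M), f v = ∑ j ∈ cells k J, ∑ v ∈ icell M j, f v := by
  classical
  have hMr : (0:ℤ) < M := by exact_mod_cast hM
  have hb : ∀ v : Fin k → ℤ, v ∈ box k (J*M) ↔ (fun i => v i / (M:ℤ)) ∈ cells k J := by
    intro v
    rw [box, cells, Fintype.mem_piFinset, Fintype.mem_piFinset]
    apply forall_congr'
    intro i
    rw [Finset.mem_Ico, Finset.mem_Ico, Int.le_ediv_iff_mul_le hMr, Int.ediv_lt_iff_lt_mul hMr]
    push_cast
    rw [neg_mul]
  rw [← Finset.sum_fiberwise_of_maps_to (s := box k (J*M)) (t := cells k J) (g := fun v i => v i / (M:ℤ)) (fun v hv => (hb v).1 hv)]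
  apply Finset.sum_congr rfl
  intro j hj
  apply Finset.sum_congr _ (fun _ _ => rfl)
  ext v
  rw [Finset.mem_filter, mem_icell_iff hM, hb]
  constructor
  · exact fun h => h.2
  · intro h; rw [h]; exact ⟨hj, rfl⟩

lemma integral_box {k J M : ℕ} (hM : 0 < M) (H : (Fin k → ℝ) → ℂ) (Hc : Continuous H) {B : ℝ}
    (hB : ∀ x, ‖H x‖ ≤ B) (hs : ∀ x, H x ≠ 0 → ∀ i, -((J*M:ℕ):ℝ) ≤ x i ∧ x i < ((J*M:ℕ):ℝ)) :
    ∫ x, H x = ∑ j ∈ cells k J, ∫ x in rcell M j, H x := by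
  have hMr : (0:ℝ) < M := by exact_mod_cast hM
  rw [← integral_biUnion_finset]
  · symm
    apply setIntegral_eq_integral_of_forall_compl_eq_zero
    intro x hx
    by_contra hne
    apply hx
    rw [Set.mem_iUnion₂]
    refine ⟨fun i => ⌊x i / M⌋, ?_, (mem_rcell_iff hM _ _).2 rfl⟩
    rw [cells, Fintype.mem_piFinset]
    intro i
    obtain ⟨h1, h2⟩ := hs x hne i
    push_cast at h1 h2
    rw [Finset.mem_Ico, Int.le_floor, Int.floor_lt, le_div_iff₀ hMr, div_lt_iff₀ hMr]
    push_cast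
    constructor <;> linarith
  · intro j _; exact rcell_meas M j
  · intro j _ j' _ hne
    rw [Function.onFun, Set.disjoint_left]
    intro x hx hx'
    exact hne (((mem_rcell_iff hM _ _).1 hx).trans ((mem_rcell_iff hM _ _).1 hx').symm)
  · intro j _
    apply Measure.integrableOn_of_bounded (M := B) _ Hc.aestronglyMeasurable
    · exact Filter.Eventually.of_forall hB
    · rw [rcell_vol]; exact ENNReal.ofReal_ne_top

lemma box_est {k q M J : ℕ} [NeZero q] (P : Fin k → Prop) [∀ i, Decidable (P i)] (χ : (Fin k → ZMod q) → ℂ)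
    (hχ : ∀ r, ‖χ r‖ ≤ 1) (H : (Fin k → ℝ) → ℂ) (Hc : Continuous H) {B δ E : ℝ}
    (hB : ∀ x, ‖H x‖ ≤ B) (hs : ∀ x, H x ≠ 0 → ∀ i, -((J*M:ℕ):ℝ) ≤ x i ∧ x i < ((J*M:ℕ):ℝ))
    (hδ0 : 0 ≤ δ) (hE0 : 0 ≤ E) (hM : 0 < M)
    (hδ : ∀ j ∈ cells k J, ∀ x ∈ rcell M j, ‖H x - H (fun i => (j i : ℝ) * M)‖ ≤ δ)
    (hE : ∀ isP : Prop, ∀ j : ℤ, -(J:ℤ) ≤ j → j < J → ∀ r, |Ac isP q M j r - M * rho isP q r| ≤ E) :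
    ‖∑ v ∈ box k (J*M), χ (fun i => (v i : ZMod q)) * H (fun i => (v i : ℝ)) * ((∏ i, wt (P i) (v i) : ℝ) : ℂ)
      - (∑ r, χ r * ((∏ i, rho (P i) q (r i) : ℝ) : ℂ)) * ∫ x, H x‖
      ≤ (2 * (J:ℝ))^k * ((q:ℝ)^k * ((M+E)^k * (2 * δ + B * k * (E / (M+E))))) := by
  rw [sum_box hM, integral_box hM H Hc hB hs, Finset.mul_sum, ← Finset.sum_sub_distrib, ← cells_card,
    ← nsmul_eq_mul, ← Finset.sum_const]
  apply norm_sum_le_of_le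
  intro j hj
  apply cell_est P χ hχ H Hc hB j hδ0 hE0 hM (hδ j hj)
  intro i r
  rw [cells, Fintype.mem_piFinset] at hj
  have := Finset.mem_Ico.1 (hj i)
  exact hE _ _ this.1 this.2 r

end SW

namespace SW

lemma eC_add (x y : ℝ) : eC (x + y) = eC x * eC y := by
  unfold eC; rw [← Complex.exp_add]; congr 1; push_cast; ring

lemma eC_norm (x : ℝ) : ‖eC x‖ = 1 := by
  have : eC x = Complex.exp ((2 * Real.pi * x : ℝ) * Complex.I) := by
    unfold eC; congr 1; push_cast; ring
  rw [this, Complex.norm_exp_ofReal_mul_I]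

lemma eC_cont : Continuous eC := by unfold eC; fun_prop

lemma eC_sub_le (x y : ℝ) : ‖eC x - eC y‖ ≤ 2 * Real.pi * |x - y| := by
  have e : eC x - eC y = eC y * (eC (x - y) - 1) := by
    rw [mul_sub, ← eC_add]; simp
  have e2 : eC (x - y) = Complex.exp (Complex.I * (2 * Real.pi * (x-y) : ℝ)) := by
    unfold eC; congr 1; push_cast; ring
  rw [e, norm_mul, eC_norm, one_mul, e2]
  refine (Real.norm_exp_I_mul_ofReal_sub_one_le).trans ?_
  rw [Real.norm_eq_abs, abs_mul, abs_of_pos (by positivity : 0 < 2 * Real.pi)]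

noncomputable def chi {k : ℕ} (Γ : Finset (Fin k → ℕ)) (q : ℕ) [NeZero q] (a : (Fin k → ℕ) → ℕ) (r : Fin k → ZMod q) : ℂ :=
  ZMod.stdAddChar (∑ γ ∈ Γ, (a γ : ZMod q) * ∏ i, r i ^ γ i)

lemma chi_norm {k : ℕ} (Γ : Finset (Fin k → ℕ)) (q : ℕ) [NeZero q] (a : (Fin k → ℕ) → ℕ) (r : Fin k → ZMod q) :
    ‖chi Γ q a r‖ ≤ 1 := by
  unfold chi; rw [AddChar.norm_apply]

lemma eC_chi {k : ℕ} (Γ : Finset (Fin k → ℕ)) (q : ℕ) [NeZero q] (a : (Fin k → ℕ) → ℕ) (v : Fin k → ℤ) :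
    eC (∑ γ ∈ Γ, ((a γ : ℝ) / (q : ℝ)) * ∏ i, (v i : ℝ) ^ (γ i)) = chi Γ q a (fun i => (v i : ZMod q)) := by
  have h : (∑ γ ∈ Γ, (a γ : ZMod q) * ∏ i, (v i : ZMod q) ^ γ i) = ((∑ γ ∈ Γ, (a γ : ℤ) * ∏ i, (v i) ^ γ i : ℤ) : ZMod q) := by
    push_cast; rfl
  unfold chi
  rw [h, ZMod.stdAddChar_coe]
  unfold eC
  congr 1
  have : ((∑ γ ∈ Γ, ((a γ : ℝ) / (q : ℝ)) * ∏ i, (v i : ℝ) ^ (γ i) : ℝ) : ℂ) = ((∑ γ ∈ Γ, (a γ : ℤ) * ∏ i, (v i) ^ γ i : ℤ) : ℂ) / q := by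
    push_cast
    rw [Finset.sum_div]
    apply Finset.sum_congr rfl
    intro γ _; ring
  rw [this]; ring

lemma gauss_eq {k k' k'' : ℕ} (hk : k' + k'' = k) (Γ : Finset (Fin k → ℕ)) (q : ℕ) [NeZero q] (a : (Fin k → ℕ) → ℕ) :
    gaussSumQ Γ k' k'' q a = ∑ r, chi Γ q a r * ((∏ i : Fin k, rho (k' ≤ (i:ℕ)) q (r i) : ℝ) : ℂ) := by
  classical
  have hq : 0 < q := q.pos_of_neZero
  set S : Fin k → Finset ℕ := (fun i : Fin k =>
        if (i : ℕ) < k' then Finset.Icc 1 q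
        else (Finset.Icc 1 q).filter fun m => Nat.Coprime m q) with hS
  set w : Fin k → ℕ → ℝ := fun i _ => if (i : ℕ) < k' then (q:ℝ)⁻¹ else (q.totient : ℝ)⁻¹ with hw
  have hprod : ∏ i : Fin k, (if (i : ℕ) < k' then (q:ℝ)⁻¹ else (q.totient : ℝ)⁻¹) = ((q:ℝ)^k' * (q.totient:ℝ)^k'')⁻¹ := by
    subst hk
    rw [Fin.prod_univ_add]
    simp
    ring
  have huniq : ∀ r : ZMod q, ∃ m ∈ Finset.Icc 1 q, ∀ n ∈ Finset.Icc 1 q, ((n : ZMod q) = r ↔ n = m) := by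
    intro r
    refine ⟨if r.val = 0 then q else r.val, ?_, ?_⟩
    · have := r.val_lt
      rw [Finset.mem_Icc]; split_ifs <;> omega
    · intro n hn
      rw [Finset.mem_Icc] at hn
      have hr := r.val_lt
      have e : (n : ZMod q) = r ↔ n % q = r.val := by
        rw [← ZMod.val_natCast]
        exact (ZMod.val_injective q).eq_iff.symm
      rw [e]
      rcases hn.2.lt_or_eq with h | h
      · rw [Nat.mod_eq_of_lt h]; split_ifs <;> omega
      · subst h; rw [Nat.mod_self]; split_ifs <;> omega
  have hid := sum_class (q := q) S (fun n : ℕ => (n : ZMod q)) (chi Γ q a) w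
  have hL : gaussSumQ Γ k' k'' q a = ∑ v ∈ Fintype.piFinset S, chi Γ q a (fun i => ((v i : ℕ) : ZMod q)) * ((∏ i, w i (v i) : ℝ) : ℂ) := by
    unfold gaussSumQ
    rw [← hS, Finset.mul_sum]
    apply Finset.sum_congr rfl
    intro v _
    have := eC_chi Γ q a (fun i => (v i : ℤ))
    simp only [Int.cast_natCast] at this
    rw [this]
    simp only [hw]
    rw [hprod, mul_comm]
    push_cast
    rfl
  rw [hL, hid]
  apply Finset.sum_congr rfl
  intro r _
  congr 2
  apply Finset.prod_congr rfl
  intro i _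
  obtain ⟨m, hm, hmu⟩ := huniq (r i)
  have hmr : (m : ZMod q) = r i := (hmu m hm).2 rfl
  by_cases hi : (i:ℕ) < k'
  · have hi' : ¬ k' ≤ (i:ℕ) := by omega
    simp only [hS, hw, hi, hi', if_true, rho, if_false]
    rw [Finset.sum_congr rfl (fun n hn => by rw [if_congr (hmu n hn) rfl rfl]), Finset.sum_ite_eq', if_pos hm]
  · have hi' : k' ≤ (i:ℕ) := by omega
    simp only [hS, hw, hi, hi', if_true, rho, if_false]
    rw [Finset.sum_filter]
    have : ∀ n ∈ Finset.Icc 1 q, (if n.Coprime q then (if (n : ZMod q) = r i then (q.totient : ℝ)⁻¹ else 0) else 0)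
       = if n = m then (if m.Coprime q then (q.totient : ℝ)⁻¹ else 0) else 0 := by
      intro n hn
      by_cases h : n = m
      · subst h; simp [hmr]
      · have h2 : ¬ ((n : ZMod q) = r i) := fun h' => h ((hmu n hn).1 h')
        simp [h, h2]
    rw [Finset.sum_congr rfl this, Finset.sum_ite_eq', if_pos hm, rhoP]
    have hu : IsUnit (r i) ↔ m.Coprime q := by rw [← hmr, ZMod.isUnit_iff_coprime]
    by_cases h : m.Coprime q
    · rw [if_pos h, if_pos (hu.2 h)]
    · rw [if_neg h, if_neg (fun h' => h (hu.1 h'))]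

lemma primeWeight_eq {k k' : ℕ} (v : Fin k → ℤ) : primeWeight k' v = ∏ i : Fin k, wt (k' ≤ (i:ℕ)) (v i) := by
  classical
  unfold primeWeight
  by_cases h : ∀ i : Fin k, k' ≤ (i : ℕ) → Prime (v i)
  · rw [Set.indicator_of_mem (by exact h), one_mul]
    apply Finset.prod_congr rfl
    intro i _
    unfold wt
    by_cases hi : k' ≤ (i:ℕ)
    · simp [hi, h i hi]
    · simp [hi]
  · rw [Set.indicator_of_notMem (by exact h), zero_mul]
    push Not at h
    obtain ⟨i, hi, hp⟩ := h
    symm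
    apply Finset.prod_eq_zero (Finset.mem_univ i)
    simp [wt, hi, hp]

lemma eC_split {k : ℕ} (Γ : Finset (Fin k → ℕ)) (q : ℕ) [NeZero q] (a : (Fin k → ℕ) → ℕ) (θ : (Fin k → ℕ) → ℝ) (v : Fin k → ℤ) :
    eC (qPair Γ (fun γ => (a γ : ℝ) / (q : ℝ) + θ γ) v) = chi Γ q a (fun i => (v i : ZMod q)) * eC (qPairR Γ θ (zEmbed v)) := by
  rw [← eC_chi, ← eC_add]
  congr 1
  unfold qPair qPairR zEmbed
  rw [← Finset.sum_add_distrib]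
  apply Finset.sum_congr rfl
  intro γ _
  simp only [add_mul]

end SW

namespace SW

lemma osc_all {V : Type*} [NormedAddCommGroup V] [NormedSpace ℝ V] {K : V → ℂ} (Kc : Continuous K) {Ω : Set V}
    (hz : ∀ x, x ∉ Ω → K x = 0) {ω D : ℝ} (hω0 : 0 ≤ ω)
    (hω : ∀ x ∈ Ω, ∀ y ∈ Ω, dist x y ≤ D → ‖K x - K y‖ ≤ ω) :
    ∀ x y, dist x y ≤ D → ‖K x - K y‖ ≤ ω := by
  have main : ∀ x ∈ Ω, ∀ y, y ∉ Ω → dist x y ≤ D → ‖K x‖ ≤ ω := by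
    intro x hx y hy hd
    by_contra hlt
    push Not at hlt
    set ε := (‖K x‖ - ω) / 2 with hε
    have hε0 : 0 < ε := by rw [hε]; linarith
    set f : ℝ → ℝ := fun t => ‖K (AffineMap.lineMap x y t)‖ with hf
    have hfc : Continuous f := by
      rw [hf]
      exact (Kc.comp AffineMap.lineMap_continuous).norm
    have h0 : f 0 = ‖K x‖ := by simp [hf]
    have h1 : f 1 = 0 := by simp [hf, hz y hy]
    have hmem : ε ∈ Set.Icc (f 1) (f 0) := by
      rw [h0, h1]; constructor <;> linarith
    obtain ⟨t, ht, hft⟩ := intermediate_value_Icc' (zero_le_one) hfc.continuousOn hmem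
    have hzΩ : AffineMap.lineMap x y t ∈ Ω := by
      by_contra hn
      have : f t = 0 := by simp [hf, hz _ hn]
      linarith
    have hdz : dist x (AffineMap.lineMap x y t) ≤ D := by
      rw [dist_left_lineMap, Real.norm_eq_abs, abs_of_nonneg ht.1]
      have := mul_le_mul_of_nonneg_right ht.2 (dist_nonneg (x := x) (y := y))
      linarith
    have h2 := hω x hx _ hzΩ hdz
    have h3 := norm_sub_norm_le (K x) (K (AffineMap.lineMap x y t))
    have h4 : ‖K (AffineMap.lineMap x y t)‖ = ε := hft
    linarith
  intro x y hd
  by_cases hx : x ∈ Ω <;> by_cases hy : y ∈ Ω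
  · exact hω x hx y hy hd
  · rw [hz y hy, sub_zero]; exact main x hx y hy hd
  · rw [hz x hx, zero_sub, norm_neg]; exact main y hy x hx (by rwa [dist_comm])
  · rw [hz x hx, hz y hy]; simpa using hω0

lemma osc_chain {V : Type*} [NormedAddCommGroup V] [NormedSpace ℝ V] {K : V → ℂ} {ω D : ℝ}
    (hω : ∀ x y, dist x y ≤ D → ‖K x - K y‖ ≤ ω) :
    ∀ n : ℕ, ∀ x y, dist x y ≤ n * D → ‖K x - K y‖ ≤ n * ω := by
  intro n
  induction n with
  | zero =>
    intro x y h
    have : x = y := by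
      apply dist_le_zero.1; simpa using h
    simp [this]
  | succ n ih =>
    intro x y h
    have hn : (0:ℝ) < (n:ℝ) + 1 := by positivity
    push_cast at h ⊢
    set t : ℝ := ((n:ℝ)+1)⁻¹ with ht
    have ht0 : 0 ≤ t := by positivity
    have htn : t * ((n:ℝ) + 1) = 1 := inv_mul_cancel₀ hn.ne'
    have hdt : t * dist x y ≤ D := by
      have := mul_le_mul_of_nonneg_left h ht0
      calc _ ≤ _ := this
        _ = (t * ((n:ℝ) + 1)) * D := by ring
        _ = D := by rw [htn, one_mul]
    have h1 := hω x (AffineMap.lineMap x y t) (by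
      rw [dist_left_lineMap, Real.norm_eq_abs, abs_of_nonneg ht0]; exact hdt)
    have h2 := ih (AffineMap.lineMap x y t) y (by
      rw [dist_lineMap_right, Real.norm_eq_abs]
      have e : 1 - t = n * t := by linarith
      rw [e, abs_of_nonneg (by positivity), mul_assoc]
      exact mul_le_mul_of_nonneg_left hdt (by positivity))
    have h3 := norm_sub_le_norm_sub_add_norm_sub (K x) (K (AffineMap.lineMap x y t)) (K y)
    linarith

lemma mono_diff {k : ℕ} (γ : Fin k → ℕ) (x y : Fin k → ℝ) {R E : ℝ} (hR : 0 ≤ R) (hE : 0 ≤ E)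
    (hx : ∀ i, |x i| ≤ R) (hy : ∀ i, |y i| ≤ R) (hxy : ∀ i, |x i - y i| ≤ E) :
    R * |∏ i, x i ^ γ i - ∏ i, y i ^ γ i| ≤ (∑ i, γ i : ℕ) * R ^ (∑ i, γ i) * E := by
  have h := prod_diff (Finset.univ.sigma (fun i : Fin k => Finset.range (γ i))) (fun s => x s.1) (fun s => y s.1) hR hE
    (fun s _ => hx s.1) (fun s _ => hy s.1) (fun s _ => hxy s.1)
  rw [Finset.prod_sigma, Finset.prod_sigma, Finset.card_sigma] at h
  simpa using h

/-- the constant -/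
def DΓ {k : ℕ} (Γ : Finset (Fin k → ℕ)) : ℝ := ∑ γ ∈ Γ, ((∑ i, γ i : ℕ) : ℝ) * 2 ^ (∑ i, γ i)

lemma DΓ_nonneg {k : ℕ} (Γ : Finset (Fin k → ℕ)) : 0 ≤ DΓ Γ := Finset.sum_nonneg fun _ _ => by positivity

lemma phase_diff {k : ℕ} (Γ : Finset (Fin k → ℕ)) (θ : (Fin k → ℕ) → ℝ) (x y : Fin k → ℝ) {N M : ℝ} (hN : 0 < N) (hM : 0 ≤ M)
    (hx : ∀ i, |x i| ≤ 2 * N) (hy : ∀ i, |y i| ≤ 2 * N) (hxy : ∀ i, |x i - y i| ≤ M) :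
    |qPairR Γ θ (WithLp.toLp 2 x) - qPairR Γ θ (WithLp.toLp 2 y)| ≤ DΓ Γ * (M / N) * ∑ γ ∈ Γ, |θ γ| * N ^ (∑ i, γ i) := by
  unfold qPairR
  rw [← Finset.sum_sub_distrib, Finset.mul_sum]
  refine (Finset.abs_sum_le_sum_abs _ _).trans (Finset.sum_le_sum fun γ hγ => ?_)
  rw [← mul_sub, abs_mul]
  have h := mono_diff γ x y (by positivity : 0 ≤ 2 * N) hM hx hy hxy
  have hD : ((∑ i, γ i : ℕ) : ℝ) * 2 ^ (∑ i, γ i) ≤ DΓ Γ :=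
    Finset.single_le_sum (f := fun γ : Fin k → ℕ => ((∑ i, γ i : ℕ) : ℝ) * 2 ^ (∑ i, γ i)) (fun _ _ => by positivity) hγ
  have hD0 := DΓ_nonneg Γ
  have h2 : |∏ i, x i ^ γ i - ∏ i, y i ^ γ i| ≤ DΓ Γ * (M / N) * N ^ (∑ i, γ i) := by
    have e : DΓ Γ * (M / N) * N ^ (∑ i, γ i) = DΓ Γ * N ^ (∑ i, γ i) * M / N := by ring
    rw [e, le_div_iff₀ hN]
    rw [mul_pow] at h
    have a0 := abs_nonneg (∏ i, x i ^ γ i - ∏ i, y i ^ γ i)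
    have a1 : ((∑ i, γ i : ℕ) : ℝ) * (2 ^ (∑ i, γ i) * N ^ (∑ i, γ i)) * M ≤ DΓ Γ * N ^ (∑ i, γ i) * M := by
      have : ((∑ i, γ i : ℕ) : ℝ) * (2 ^ (∑ i, γ i) * N ^ (∑ i, γ i)) * M = (((∑ i, γ i : ℕ) : ℝ) * 2 ^ (∑ i, γ i)) * (N ^ (∑ i, γ i) * M) := by ring
      rw [this, mul_assoc (DΓ Γ)]
      exact mul_le_mul_of_nonneg_right hD (by positivity)
    have a2 := mul_nonneg hN.le a0
    linarith
  calc |θ γ| * _ ≤ |θ γ| * (DΓ Γ * (M / N) * N ^ (∑ i, γ i)) := mul_le_mul_of_nonneg_left h2 (abs_nonneg _)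
    _ = _ := by ring

lemma core_est {k k' k'' : ℕ} (hk : k' + k'' = k) (Γ : Finset (Fin k → ℕ)) {N M J q : ℕ} [NeZero q] (hN : 0 < N) (hM : 0 < M)
    (hJ : N ≤ J * M) (hJ2 : J * M ≤ 2 * N) {E : ℝ} (hE0 : 0 ≤ E)
    (hE : ∀ isP : Prop, ∀ j : ℤ, -(J:ℤ) ≤ j → j < J → ∀ r : ZMod q, |Ac isP q M j r - M * rho isP q r| ≤ E)
    {Ω : Set (EuclideanSpace ℝ (Fin k))} (hΩ : Ω ⊆ Metric.ball 0 N)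
    {K : EuclideanSpace ℝ (Fin k) → ℂ} (Kc : Continuous K) (hz : ∀ x, x ∉ Ω → K x = 0)
    {B ω : ℝ} (hB : ∀ x, ‖K x‖ ≤ B) (hω0 : 0 ≤ ω)
    (hω : ∀ x ∈ Ω, ∀ y ∈ Ω, dist x y ≤ (q:ℝ) * Real.sqrt k → ‖K x - K y‖ ≤ ω)
    (a : (Fin k → ℕ) → ℕ) (θ : (Fin k → ℕ) → ℝ) :
    ‖(∑' v : Fin k → ℤ,
              eC (qPair Γ (fun γ => (a γ : ℝ) / (q : ℝ) + θ γ) v) * K (zEmbed v) *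
                ((primeWeight k' v : ℝ) : ℂ)) -
            gaussSumQ Γ k' k'' q a * ∫ t in Ω, eC (qPairR Γ θ t) * K t‖
     ≤ (2 * (J:ℝ))^k * ((q:ℝ)^k * ((M+E)^k * (2 * (M * ω + 2 * Real.pi * (DΓ Γ * ((M:ℝ) / N) * ∑ γ ∈ Γ, |θ γ| * (N:ℝ) ^ (∑ i, γ i)) * B) + B * k * (E / (M+E))))) := by
  classical
  have hNr : (0:ℝ) < N := by exact_mod_cast hN
  have hMr : (0:ℝ) < M := by exact_mod_cast hM
  have hB0 : 0 ≤ B := (norm_nonneg _).trans (hB 0)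
  set H : (Fin k → ℝ) → ℂ := fun x => eC (qPairR Γ θ (WithLp.toLp 2 x)) * K (WithLp.toLp 2 x) with hH
  have hsupp : ∀ x : Fin k → ℝ, K (WithLp.toLp 2 x) ≠ 0 → ∀ i, |x i| < N := by
    intro x hx i
    have h1 : WithLp.toLp 2 x ∈ Ω := by by_contra h; exact hx (hz _ h)
    have h2 := hΩ h1
    rw [mem_ball_zero_iff] at h2
    have h3 := PiLp.norm_apply_le (WithLp.toLp 2 x : EuclideanSpace ℝ (Fin k)) i
    rw [Real.norm_eq_abs] at h3
    exact lt_of_le_of_lt h3 h2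
  have hJr : (N:ℝ) ≤ ((J * M : ℕ) : ℝ) := by exact_mod_cast hJ
  have hJ2r : ((J * M : ℕ) : ℝ) ≤ 2 * N := by exact_mod_cast hJ2
  have hqc : Continuous (fun x : Fin k → ℝ => qPairR Γ θ (WithLp.toLp 2 x)) := by
    unfold qPairR; fun_prop
  have Hc : Continuous H := by
    rw [hH]
    exact (eC_cont.comp hqc).mul (Kc.comp (PiLp.continuous_toLp 2 _))
  have hHB : ∀ x, ‖H x‖ ≤ B := by
    intro x; rw [hH]; simp only [norm_mul, eC_norm, one_mul]; exact hB _
  have hs : ∀ x, H x ≠ 0 → ∀ i, -((J*M:ℕ):ℝ) ≤ x i ∧ x i < ((J*M:ℕ):ℝ) := by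
    intro x hx i
    have := abs_lt.1 (hsupp x (right_ne_zero_of_mul hx) i)
    constructor <;> linarith [this.1, this.2]
  set T := ∑ γ ∈ Γ, |θ γ| * (N:ℝ) ^ (∑ i, γ i) with hT
  have hT0 : 0 ≤ T := Finset.sum_nonneg fun _ _ => by positivity
  have hD0 := DΓ_nonneg Γ
  have hpi := Real.pi_pos
  have hq1 : (1:ℝ) ≤ q := by exact_mod_cast q.pos_of_neZero
  have hosc := osc_chain (osc_all Kc hz hω0 hω) M
  have hδ : ∀ j ∈ cells k J, ∀ x ∈ rcell M j, ‖H x - H (fun i => (j i : ℝ) * M)‖ ≤ M * ω + 2 * Real.pi * (DΓ Γ * ((M:ℝ) / N) * T) * B := by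
    intro j hj x hx
    rw [rcell, Set.mem_univ_pi] at hx
    rw [cells, Fintype.mem_piFinset] at hj
    set y : Fin k → ℝ := fun i => (j i : ℝ) * M with hy
    have hxy : ∀ i, |x i - y i| ≤ M := by
      intro i
      have := hx i
      rw [abs_le, hy]; constructor <;> linarith [this.1, this.2]
    have hj1 : ∀ i, -(2 * (N:ℝ)) ≤ (j i : ℝ) * M := by
      intro i
      have h1 := (Finset.mem_Ico.1 (hj i)).1
      have h2 : (-(J:ℝ)) ≤ j i := by exact_mod_cast h1
      have h3 := mul_le_mul_of_nonneg_right h2 hMr.le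
      push_cast at hJ2r
      linarith
    have hj2 : ∀ i, ((j i : ℝ) + 1) * M ≤ 2 * (N:ℝ) := by
      intro i
      have h1 := (Finset.mem_Ico.1 (hj i)).2
      have h2 : (j i : ℝ) + 1 ≤ J := by exact_mod_cast h1
      have h3 := mul_le_mul_of_nonneg_right h2 hMr.le
      push_cast at hJ2r
      linarith
    have hxN : ∀ i, |x i| ≤ 2 * N := by
      intro i
      have := hx i
      rw [abs_le]; constructor <;> linarith [this.1, this.2, hj1 i, hj2 i]
    have hyN : ∀ i, |y i| ≤ 2 * N := by
      intro i
      rw [abs_le, hy]; constructor <;> linarith [hj1 i, hj2 i]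
    have hph := phase_diff Γ θ x y hNr hMr.le hxN hyN hxy
    have hdist : dist (WithLp.toLp 2 x : EuclideanSpace ℝ (Fin k)) (WithLp.toLp 2 y) ≤ M * ((q:ℝ) * Real.sqrt k) := by
      rw [EuclideanSpace.dist_eq]
      have h1 : Real.sqrt (∑ i, dist (x i) (y i) ^ 2) ≤ Real.sqrt ((M:ℝ)^2 * k) := by
        apply Real.sqrt_le_sqrt
        calc _ ≤ ∑ _i : Fin k, (M:ℝ)^2 := Finset.sum_le_sum fun i _ => by
                rw [Real.dist_eq]; exact pow_le_pow_left₀ (abs_nonneg _) (hxy i) 2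
          _ = _ := by simp; ring
      rw [Real.sqrt_mul (by positivity), Real.sqrt_sq hMr.le] at h1
      refine h1.trans (mul_le_mul_of_nonneg_left ?_ hMr.le)
      have := mul_le_mul_of_nonneg_right hq1 (Real.sqrt_nonneg (k:ℝ))
      linarith
    have hK := hosc _ _ hdist
    have e : H x - H y = eC (qPairR Γ θ (WithLp.toLp 2 x)) * (K (WithLp.toLp 2 x) - K (WithLp.toLp 2 y))
      + (eC (qPairR Γ θ (WithLp.toLp 2 x)) - eC (qPairR Γ θ (WithLp.toLp 2 y))) * K (WithLp.toLp 2 y) := by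
      rw [hH]; ring
    rw [e]
    refine (norm_add_le _ _).trans (add_le_add ?_ ?_)
    · rw [norm_mul, eC_norm, one_mul]; exact hK
    · rw [norm_mul]
      refine mul_le_mul ((eC_sub_le _ _).trans ?_) (hB _) (norm_nonneg _) (by positivity)
      exact mul_le_mul_of_nonneg_left hph (by positivity)
  have hmain := box_est (q := q) (fun i : Fin k => k' ≤ (i:ℕ)) (chi Γ q a) (chi_norm Γ q a) H Hc hHB hs (by positivity) hE0 hM hδ hE
  have hsum : (∑' v : Fin k → ℤ,
              eC (qPair Γ (fun γ => (a γ : ℝ) / (q : ℝ) + θ γ) v) * K (zEmbed v) *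
                ((primeWeight k' v : ℝ) : ℂ)) = ∑ v ∈ box k (J*M), chi Γ q a (fun i => (v i : ZMod q)) * H (fun i => (v i : ℝ)) * ((∏ i : Fin k, wt (k' ≤ (i:ℕ)) (v i) : ℝ) : ℂ) := by
    rw [tsum_eq_sum (s := box k (J*M))]
    · apply Finset.sum_congr rfl
      intro v _
      rw [eC_split, primeWeight_eq, hH]
      simp only [zEmbed]
      ring
    · intro v hv
      have : K (zEmbed v) = 0 := by
        by_contra hne
        apply hv
        rw [box, Fintype.mem_piFinset]
        intro i
        have h1 := abs_lt.1 (hsupp (fun i => (v i : ℝ)) hne i)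
        rw [Finset.mem_Ico]
        have h2 : (-((J*M:ℕ):ℝ)) ≤ (v i : ℝ) := by linarith [h1.1]
        have h3 : (v i : ℝ) < ((J*M:ℕ):ℝ) := by linarith [h1.2]
        exact ⟨by exact_mod_cast h2, by exact_mod_cast h3⟩
      rw [this]; ring
  have hIntg : ∫ t in Ω, eC (qPairR Γ θ t) * K t = ∫ x, H x := by
    rw [setIntegral_eq_integral_of_forall_compl_eq_zero (fun x hx => by rw [hz x hx, mul_zero])]
    rw [hH]
    exact ((PiLp.volume_preserving_toLp (Fin k)).integral_comp (MeasurableEquiv.toLp 2 (Fin k → ℝ)).measurableEmbedding (fun t => eC (qPairR Γ θ t) * K t)).symm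
  rw [hsum, hIntg, gauss_eq hk]
  exact hmain

end SW

namespace SW

lemma Ac_triv {q N : ℕ} [NeZero q] (isP : Prop) (j : ℤ) (hj : -1 ≤ j) (hj' : j < 1) (r : ZMod q) :
    |Ac isP q N j r - N * rho isP q r| ≤ N * (1 + N) + N := by
  classical
  have h1 : Ac isP q N j r ≤ N * (1 + N) := by
    unfold Ac
    have : ∀ n ∈ Finset.Ico (j * N) ((j+1) * N), (if (n : ZMod q) = r then wt isP n else 0) ≤ (1 + (N:ℝ)) := by
      intro n hn
      rw [Finset.mem_Ico] at hn
      have hN0 : (0:ℤ) ≤ N := by positivity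
      have h2 : |(n:ℝ)| ≤ N := by
        have : |n| ≤ N := by
          rw [abs_le]; constructor <;> nlinarith [hn.1, hn.2]
        exact_mod_cast this
      split_ifs
      · exact (wt_le _ _).trans (by linarith)
      · positivity
    refine (Finset.sum_le_sum this).trans ?_
    rw [Finset.sum_const, Int.card_Ico, nsmul_eq_mul]
    have e : ((j+1) * (N:ℤ) - j * N).toNat = N := by
      have : (j+1) * (N:ℤ) - j * N = N := by ring
      rw [this]; simp
    rw [e]
  have h0 : 0 ≤ Ac isP q N j r := by
    unfold Ac
    apply Finset.sum_nonneg
    intro n _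
    split_ifs
    · exact wt_nonneg _ _
    · exact le_rfl
  have hN : (0:ℝ) ≤ N := by positivity
  have h3 := mul_le_mul_of_nonneg_left (rho_le_one isP q r) hN
  have h4 := mul_nonneg hN (rho_nonneg isP q r)
  have h5 : (0:ℝ) ≤ N * (1+N) := by positivity
  rw [abs_le]; constructor <;> linarith

lemma param (k : ℕ) {β : ℝ} (hβ : 0 < β) : ∃ c : ℝ, 0 < c ∧ ∃ A : ℝ, 0 < A ∧
    ∀ N : ℕ, 2 ≤ N → ∀ q : ℕ, ∀ [NeZero q], (q:ℝ) ≤ (Real.log N) ^ β →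
    ∃ M J : ℕ, ∃ E : ℝ, 0 < M ∧ N ≤ J * M ∧ J * M ≤ 2 * N ∧ 0 ≤ E ∧
      (∀ isP : Prop, ∀ j : ℤ, -(J:ℤ) ≤ j → j < J → ∀ r : ZMod q, |Ac isP q M j r - M * rho isP q r| ≤ E) ∧
      (2 * (J:ℝ) * (M + E) * q)^k * ((M:ℝ)/N) ≤ A * N^k * Real.exp (-c * Real.sqrt (Real.log N)) ∧
      (2 * (J:ℝ) * (M + E) * q)^k * (E/(M+E)) ≤ A * N^k * Real.exp (-c * Real.sqrt (Real.log N)) := by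
  obtain ⟨a, L₀, C₀, ha, hL₀, hC₀, hsw⟩ := sw_ext (B := 2 * β) (by positivity)
  obtain ⟨L₂, hL₂⟩ := Filter.eventually_atTop.1 (ev_log (8 * β * k / a) 0)
  set C := max C₀ 1 with hC
  have hC1 : 1 ≤ C := le_max_right _ _
  have hCC : C₀ ≤ C := le_max_left _ _
  set L₁ := max L₀ (max a L₂) with hL₁
  have h11 : L₀ ≤ L₁ := le_max_left _ _
  have h12 : a ≤ L₁ := (le_max_left _ _).trans (le_max_right _ _)
  have h13 : L₂ ≤ L₁ := (le_max_right _ _).trans (le_max_right _ _)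
  have hL1pos : 0 < L₁ := by linarith
  set A1 : ℝ := (4 * (1 + 2 * C))^k * (2 * C) with hA1
  set A2 : ℝ := (2 * (Real.exp (L₁^2) + 3) * (L₁^2)^β)^k * Real.exp (a/4 * L₁) with hA2
  have hA1p : 0 < A1 := by positivity
  have hA2p : 0 < A2 := by positivity
  refine ⟨a/4, by positivity, A1 + A2, by positivity, ?_⟩
  intro N hN q _ hq
  set ℒ := Real.sqrt (Real.log N) with hℒ
  have hN1 : (1:ℝ) ≤ N := by exact_mod_cast (by omega : 1 ≤ N)
  have hNpos : (0:ℝ) < N := by linarith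
  have hlog : 0 ≤ Real.log N := Real.log_nonneg hN1
  have hsq : ℒ^2 = Real.log N := Real.sq_sqrt hlog
  have hNexp : Real.exp (ℒ^2) = N := by rw [hsq, Real.exp_log hNpos]
  have hℒ0 : 0 ≤ ℒ := Real.sqrt_nonneg _
  have hq0 : (0:ℝ) ≤ q := by positivity
  have hNk : (0:ℝ) < (N:ℝ)^k := by positivity
  rcases le_or_gt L₁ ℒ with hlarge | hsmall
  · -- large case
    have hℒ1 : 1 ≤ ℒ := by linarith
    have hqL : (q:ℝ) ≤ ℒ ^ (2 * β) := by
      rw [Real.rpow_mul hℒ0]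
      have : ℒ ^ (2:ℝ) = Real.log N := by rw [← hsq]; exact_mod_cast Real.rpow_natCast ℒ 2
      rw [this]; exact hq
    have hS := hsw ℒ (by linarith) q hqL
    set u := Real.exp (-(a/2*ℒ)) with hu
    have hu0 : 0 < u := Real.exp_pos _
    have hu1 : u ≤ 1 := by rw [hu]; apply Real.exp_le_one_iff.2; have : 0 ≤ a/2*ℒ := by positivity
                           linarith
    have huu : Real.exp (-(a*ℒ)) = u * u := by rw [hu, ← Real.exp_add]; congr 1; ring
    have haL : a * ℒ ≤ ℒ^2 := by rw [pow_two]; exact mul_le_mul_of_nonneg_right (by linarith) hℒ0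
    have hNuu : 1 ≤ N * (u * u) := by
      rw [← huu, ← hNexp, ← Real.exp_add]
      exact Real.one_le_exp (by linarith)
    have hNu : 1 ≤ N * u := by
      refine hNuu.trans (mul_le_mul_of_nonneg_left ?_ hNpos.le)
      have := mul_le_mul_of_nonneg_left hu1 hu0.le
      linarith
    set M := ⌈(N:ℝ) * u⌉₊ with hM
    have hM1 : N * u ≤ M := Nat.le_ceil _
    have hM2 : (M:ℝ) ≤ 2 * (N * u) := by
      have := Nat.ceil_lt_add_one (by positivity : 0 ≤ (N:ℝ) * u)
      linarith
    have hM3 : M ≤ N := by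
      apply Nat.ceil_le.2
      have := mul_le_mul_of_nonneg_left hu1 hNpos.le
      linarith
    have hMpos : 0 < M := by
      have : (0:ℝ) < M := by linarith
      exact_mod_cast this
    have hMr : (0:ℝ) < M := by exact_mod_cast hMpos
    set J := (N + M - 1) / M with hJ
    have hJ1 : N ≤ J * M := by
      have h1 := Nat.div_add_mod (N+M-1) M
      have h2 := Nat.mod_lt (N+M-1) hMpos
      rw [← hJ, mul_comm] at h1
      omega
    have hJ2 : J * M ≤ N + M - 1 := Nat.div_mul_le_self _ _
    have hJ3 : J * M + 1 ≤ 2 * N := by omega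
    have hJ3r : ((J * M + 1 : ℕ) : ℝ) ≤ 2 * N := by exact_mod_cast hJ3
    set E := C * N * (u*u) with hE
    have hE1 : 1 ≤ E := by
      have := mul_le_mul hC1 hNuu zero_le_one (by linarith)
      rw [hE, mul_assoc]; linarith
    have hAc := Ac_est (q := q) (M := M) (J := J) (E := E) (X := 2 * N) (by linarith) hJ3r (by
      intro b m hm
      have := hS b m (by rw [hNexp]; exact hm)
      rw [hNexp, huu] at this
      refine this.trans ?_
      rw [hE]
      have := mul_le_mul_of_nonneg_right hCC (by positivity : 0 ≤ (N:ℝ) * (u*u))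
      linarith)
    have hJM : (J:ℝ) * M ≤ 2 * N := by push_cast at hJ3r; linarith
    have hEM : 2 * E ≤ (2 * C * u) * M := by
      have := mul_le_mul_of_nonneg_left hM1 (by positivity : 0 ≤ 2 * C * u)
      calc 2 * E = 2 * C * u * (N * u) := by rw [hE]; ring
        _ ≤ _ := this
    have hEM1 : 2 * E ≤ 2 * C * M := by
      refine hEM.trans (mul_le_mul_of_nonneg_right ?_ hMr.le)
      have := mul_le_mul_of_nonneg_left hu1 (by positivity : 0 ≤ 2 * C)
      linarith
    have hbase : 2 * (J:ℝ) * (M + 2 * E) ≤ 4 * (1 + 2 * C) * N := by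
      have h1 : (M:ℝ) + 2 * E ≤ (1 + 2 * C) * M := by linarith
      have h2 := mul_le_mul_of_nonneg_left h1 (by positivity : 0 ≤ 2 * (J:ℝ))
      have h3 := mul_le_mul_of_nonneg_left hJM (by positivity : 0 ≤ 2 * (1 + 2 * C))
      calc _ ≤ _ := h2
        _ = 2 * (1 + 2 * C) * (J * M) := by ring
        _ ≤ _ := h3
        _ = _ := by ring
    -- q^k
    have hqk : (q:ℝ)^k ≤ Real.exp (a/4*ℒ) := by
      have h1 := hL₂ ℒ (by linarith)
      have h2 : (q:ℝ)^k ≤ (ℒ ^ (2 * β))^k := pow_le_pow_left₀ hq0 hqL k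
      refine h2.trans ?_
      rw [Real.rpow_def_of_pos (by linarith), ← Real.exp_nat_mul]
      apply Real.exp_le_exp.2
      have h3 := mul_le_mul_of_nonneg_left h1 (by positivity : 0 ≤ a/4)
      have e : a/4 * (8 * β * k / a * Real.log ℒ + 0) = k * (Real.log ℒ * (2 * β)) := by
        field_simp; ring
      rw [e] at h3; exact h3
    have hqu : (q:ℝ)^k * u ≤ Real.exp (-(a/4) * ℒ) := by
      have := mul_le_mul_of_nonneg_right hqk hu0.le
      refine this.trans (le_of_eq ?_)
      rw [hu, ← Real.exp_add]; congr 1; ring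
    have hQ : ∀ X : ℝ, 0 ≤ X → X ≤ 2 * C * u → (2 * (J:ℝ) * (M + 2 * E) * q)^k * X ≤ (A1 + A2) * N^k * Real.exp (-(a/4) * ℒ) := by
      intro X hX0 hX
      have h1 : (2 * (J:ℝ) * (M + 2 * E) * q)^k ≤ (4 * (1 + 2 * C) * N)^k * (q:ℝ)^k := by
        rw [mul_pow]
        exact mul_le_mul_of_nonneg_right (pow_le_pow_left₀ (by positivity) hbase k) (by positivity)
      calc _ ≤ ((4 * (1 + 2 * C) * N)^k * (q:ℝ)^k) * (2 * C * u) := mul_le_mul h1 hX hX0 (by positivity)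
        _ = A1 * N^k * ((q:ℝ)^k * u) := by rw [hA1, mul_pow _ (N:ℝ)]; ring
        _ ≤ A1 * N^k * Real.exp (-(a/4) * ℒ) := mul_le_mul_of_nonneg_left hqu (by positivity)
        _ ≤ _ := by
          apply mul_le_mul_of_nonneg_right _ (Real.exp_pos _).le
          exact mul_le_mul_of_nonneg_right (by linarith) hNk.le
    refine ⟨M, J, 2 * E, hMpos, hJ1, by omega, by linarith, hAc, ?_, ?_⟩
    · apply hQ _ (by positivity)
      rw [div_le_iff₀ hNpos]
      have := mul_le_mul_of_nonneg_right hC1 (by positivity : 0 ≤ 2 * ((N:ℝ) * u))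
      linarith
    · apply hQ _ (by positivity)
      rw [div_le_iff₀ (by linarith)]
      have : 0 ≤ 2 * C * u * (2 * E) := by positivity
      linarith
  · -- small case
    have hlogL : Real.log N ≤ L₁^2 := by rw [← hsq]; exact pow_le_pow_left₀ hℒ0 hsmall.le 2
    have hNL : (N:ℝ) ≤ Real.exp (L₁^2) := by rw [← hNexp]; exact Real.exp_le_exp.2 (by linarith)
    have hqL : (q:ℝ) ≤ (L₁^2)^β := hq.trans (Real.rpow_le_rpow hlog hlogL hβ.le)
    set E : ℝ := N * (1 + N) + N with hE
    have hE0 : 0 < E := by positivity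
    have hQ : ∀ X : ℝ, 0 ≤ X → X ≤ 1 → (2 * ((1:ℕ):ℝ) * (N + E) * q)^k * X ≤ (A1 + A2) * N^k * Real.exp (-(a/4) * ℒ) := by
      intro X hX0 hX
      have h1 : 2 * ((1:ℕ):ℝ) * (N + E) * q ≤ 2 * (Real.exp (L₁^2) + 3) * (L₁^2)^β * N := by
        have e : 2 * ((1:ℕ):ℝ) * (N + E) * q = (2 * (N + 3)) * q * N := by rw [hE]; push_cast; ring
        rw [e]
        apply mul_le_mul_of_nonneg_right _ hNpos.le
        exact mul_le_mul (by linarith) hqL hq0 (by positivity)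
      have h2 : (2 * ((1:ℕ):ℝ) * (N + E) * q)^k ≤ (2 * (Real.exp (L₁^2) + 3) * (L₁^2)^β)^k * N^k := by
        rw [← mul_pow]; exact pow_le_pow_left₀ (by positivity) h1 k
      have h3 : 1 ≤ Real.exp (a/4 * L₁) * Real.exp (-(a/4) * ℒ) := by
        rw [← Real.exp_add]
        apply Real.one_le_exp
        have := mul_le_mul_of_nonneg_left hsmall.le (by positivity : 0 ≤ a/4)
        linarith
      calc _ ≤ ((2 * (Real.exp (L₁^2) + 3) * (L₁^2)^β)^k * N^k) * 1 := mul_le_mul h2 hX hX0 (by positivity)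
        _ ≤ ((2 * (Real.exp (L₁^2) + 3) * (L₁^2)^β)^k * N^k) * (Real.exp (a/4 * L₁) * Real.exp (-(a/4) * ℒ)) :=
          mul_le_mul_of_nonneg_left h3 (by positivity)
        _ = A2 * N^k * Real.exp (-(a/4) * ℒ) := by rw [hA2]; ring
        _ ≤ _ := by
          apply mul_le_mul_of_nonneg_right _ (Real.exp_pos _).le
          exact mul_le_mul_of_nonneg_right (by linarith) hNk.le
    refine ⟨N, 1, E, by omega, by omega, by omega, hE0.le, ?_, ?_, ?_⟩
    · intro isP j hj hj' r
      exact Ac_triv isP j (by simpa using hj) (by simpa using hj') r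
    · apply hQ _ (by positivity)
      rw [div_self hNpos.ne']
    · apply hQ _ (by positivity)
      rw [div_le_one (by positivity)]; linarith

lemma real_est {k k' k'' : ℕ} (hk : k' + k'' = k) (hk1 : 1 ≤ k) (Γ : Finset (Fin k → ℕ)) {β : ℝ} (hβ : 0 < β) :
    ∃ c : ℝ, 0 < c ∧ ∃ C : ℝ, 0 < C ∧ ∀ N : ℕ, 2 ≤ N →
    ∀ Ω : Set (EuclideanSpace ℝ (Fin k)), Ω ⊆ Metric.ball 0 N →
    ∀ K : EuclideanSpace ℝ (Fin k) → ℂ, Continuous K → (∀ x, x ∉ Ω → K x = 0) →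
    ∀ q : ℕ, 1 ≤ q → (q : ℝ) ≤ (Real.log N) ^ β →
    ∀ (a : (Fin k → ℕ) → ℕ) (θ : (Fin k → ℕ) → ℝ) (B ω : ℝ),
     (∀ x, ‖K x‖ ≤ B) → 0 ≤ ω →
     (∀ x ∈ Ω, ∀ y ∈ Ω, dist x y ≤ (q:ℝ) * Real.sqrt k → ‖K x - K y‖ ≤ ω) →
     ‖(∑' v : Fin k → ℤ,
              eC (qPair Γ (fun γ => (a γ : ℝ) / (q : ℝ) + θ γ) v) * K (zEmbed v) *
                ((primeWeight k' v : ℝ) : ℂ)) -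
            gaussSumQ Γ k' k'' q a * ∫ t in Ω, eC (qPairR Γ θ t) * K t‖
      ≤ C * ((N : ℝ) ^ (k - 1) *
                (1 + ∑ γ ∈ Γ, |θ γ| * (N : ℝ) ^ ((∑ i, γ i : ℕ) : ℝ)) * B + (N:ℝ)^k * ω) *
         ((N : ℝ) * Real.exp (-c * Real.sqrt (Real.log N))) := by
  obtain ⟨c, hc, A, hA, h⟩ := param k hβ
  have hD0 := DΓ_nonneg Γ
  have hpi := Real.pi_pos
  refine ⟨c, hc, A * (2 + 4 * Real.pi * DΓ Γ + k), by positivity, ?_⟩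
  intro N hN Ω hΩ K Kc hz q hq1 hq a θ B ω hB hω0 hω
  haveI hNeZ : NeZero q := ⟨by omega⟩
  obtain ⟨M, J, E, hM, hJ1, hJ2, hE0, hE, e1, e2⟩ := h N hN q hq
  have hcore := core_est (k' := k') (k'' := k'') hk Γ (by omega) hM hJ1 hJ2 hE0 hE hΩ Kc hz hB hω0 hω a θ
  refine hcore.trans ?_
  simp only [Real.rpow_natCast]
  have hB0 : 0 ≤ B := (norm_nonneg _).trans (hB 0)
  have hT0 : 0 ≤ ∑ γ ∈ Γ, |θ γ| * (N:ℝ) ^ (∑ i, γ i) := Finset.sum_nonneg fun _ _ => by positivity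
  generalize (∑ γ ∈ Γ, |θ γ| * (N:ℝ) ^ (∑ i, γ i)) = T at *
  have hNpos : (0:ℝ) < N := by exact_mod_cast (by omega : 0 < N)
  generalize Real.exp (-c * Real.sqrt (Real.log N)) = ε at *
  have hkk : (N:ℝ)^k = N^(k-1) * N := by rw [← pow_succ]; congr 1; omega
  set Q := (2 * (J:ℝ) * (M + E) * q)^k with hQ
  set D := DΓ Γ
  have hexp : (2 * (J:ℝ))^k * ((q:ℝ)^k * ((M+E)^k * (2 * (M * ω + 2 * Real.pi * (D * ((M:ℝ) / N) * T) * B) + B * k * (E / (M+E)))))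
    = (Q * ((M:ℝ)/N)) * (2 * N * ω + 4 * Real.pi * D * T * B) + (Q * (E/(M+E))) * (k * B) := by
    have hMω : (M:ℝ) * ω = (M:ℝ)/N * N * ω := by field_simp
    have e : 2 * (M * ω + 2 * Real.pi * (D * ((M:ℝ) / N) * T) * B) + B * k * (E / (M+E))
       = ((M:ℝ)/N) * (2 * N * ω + 4 * Real.pi * D * T * B) + (E/(M+E)) * (k * B) := by
      linear_combination 2 * hMω
    rw [e, hQ, mul_pow (2 * (J:ℝ) * (M + E)) (q:ℝ), mul_pow (2 * (J:ℝ)) ((M:ℝ) + E)]; ring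
  rw [hexp]
  have hX : 0 ≤ A * N^k * ε := le_trans (by positivity) e1
  have f1 := mul_le_mul_of_nonneg_right e1 (by positivity : 0 ≤ 2 * N * ω + 4 * Real.pi * D * T * B)
  have f2 := mul_le_mul_of_nonneg_right e2 (by positivity : 0 ≤ (k:ℝ) * B)
  have f3 : 2 * N * ω + 4 * Real.pi * D * T * B + k * B ≤ (2 + 4 * Real.pi * D + k) * ((1 + T) * B + N * ω) := by
    have g1 : 0 ≤ 2 * ((1+T) * B) := by positivity
    have g2 : 0 ≤ 4 * Real.pi * D * (B + N * ω) := by positivity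
    have g3 : 0 ≤ k * (T * B + N * ω) := by positivity
    linarith
  have f4 := mul_le_mul_of_nonneg_left f3 hX
  calc _ ≤ A * N^k * ε * (2 * N * ω + 4 * Real.pi * D * T * B) + A * N^k * ε * (k * B) := add_le_add f1 f2
    _ = A * N^k * ε * (2 * N * ω + 4 * Real.pi * D * T * B + k * B) := by ring
    _ ≤ _ := f4
    _ = _ := by rw [hkk]; ring

end SW

/-- Lemma 2.6 = [MeS, Lemma 7], major arc approximation: for a continuous
`𝒦` supported in `Ω ⊆ B(0,N)` (a Boolean combination of convex sets), `q ≤ (log N)^β`,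
`a ∈ A_q^Γ` and `ξ = a/q + θ`, the weighted exponential sum over `ℤ^{k'} × (±ℙ)^{k''}` is
approximated by `G(a/q) ∫_Ω e(θ·𝒬(t)) 𝒦(t) dt`, with the stated error bound and implicit
constant independent of `N, a, q, ξ` and `𝒦`. -/
theorem major_arc_approximation
    (k k' k'' : ℕ) (hk : k' + k'' = k)
    (Γ : Finset (Fin k → ℕ)) (hΓ : Γ.Nonempty) (h0 : (0 : Fin k → ℕ) ∉ Γ)
    (β : ℝ) (hβ : 0 < β) :
    ∃ c : ℝ, 0 < c ∧ ∃ C : ℝ, 0 < C ∧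
      ∀ (N : ℕ), 2 ≤ N →
      ∀ Ω : Set (EuclideanSpace ℝ (Fin k)),
        Ω ⊆ Metric.ball 0 N → IsBooleanCombConvex Ω →
      ∀ 𝒦 : EuclideanSpace ℝ (Fin k) → ℂ,
        Continuous 𝒦 → (∀ x, x ∉ Ω → 𝒦 x = 0) →
      ∀ q : ℕ, 1 ≤ q → (q : ℝ) ≤ (Real.log N) ^ β →
      ∀ a : (Fin k → ℕ) → ℕ,
        (∀ γ ∈ Γ, a γ ∈ Finset.Icc 1 q ∧ Nat.Coprime (a γ) q) →
      ∀ θ : (Fin k → ℕ) → ℝ,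
        (‖(∑' v : Fin k → ℤ,
              eC (qPair Γ (fun γ => (a γ : ℝ) / (q : ℝ) + θ γ) v) * 𝒦 (zEmbed v) *
                ((primeWeight k' v : ℝ) : ℂ)) -
            gaussSumQ Γ k' k'' q a * ∫ t in Ω, eC (qPairR Γ θ t) * 𝒦 t‖₊ : ℝ≥0∞)
          ≤ ENNReal.ofReal C *
            (ENNReal.ofReal ((N : ℝ) ^ (k - 1) *
                (1 + ∑ γ ∈ Γ, |θ γ| * (N : ℝ) ^ ((∑ i, γ i : ℕ) : ℝ))) *
              (⨆ (x : EuclideanSpace ℝ (Fin k)) (_ : x ∈ Ω), (‖𝒦 x‖₊ : ℝ≥0∞)) +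
            ENNReal.ofReal ((N : ℝ) ^ k) *
              (⨆ (x : EuclideanSpace ℝ (Fin k)) (y : EuclideanSpace ℝ (Fin k))
                (_ : x ∈ Ω) (_ : y ∈ Ω)
                (_ : dist x y ≤ (q : ℝ) * Real.sqrt k),
                (‖𝒦 x - 𝒦 y‖₊ : ℝ≥0∞))) *
            ENNReal.ofReal ((N : ℝ) * Real.exp (-c * Real.sqrt (Real.log N))) := by
  have hk1 : 1 ≤ k := by
    rcases Nat.eq_zero_or_pos k with h | h
    · subst h
      obtain ⟨γ, hγ⟩ := hΓ
      exact absurd (Subsingleton.elim γ 0 ▸ hγ) h0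
    · exact h
  obtain ⟨c, hc, C, hC, h⟩ := SW.real_est (k' := k') (k'' := k'') hk hk1 Γ hβ
  refine ⟨c, hc, C, hC, ?_⟩
  intro N hN Ω hΩ _ 𝒦 Kc hz q hq1 hq a _ θ
  -- boundedness of `𝒦`
  obtain ⟨B₀, hB₀⟩ : ∃ B₀ : ℝ, ∀ x, ‖𝒦 x‖ ≤ B₀ := by
    obtain ⟨b, hb⟩ := (isCompact_closedBall (0 : EuclideanSpace ℝ (Fin k)) (N:ℝ)).exists_bound_of_continuousOn Kc.continuousOn
    refine ⟨max b 0, fun x => ?_⟩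
    by_cases hx : x ∈ Ω
    · exact (hb x (Metric.ball_subset_closedBall (hΩ hx))).trans (le_max_left _ _)
    · rw [hz x hx, norm_zero]; exact le_max_right _ _
  have hB₀0 : 0 ≤ B₀ := (norm_nonneg _).trans (hB₀ 0)
  have hnn : ∀ z : ℂ, (‖z‖₊ : ℝ≥0∞) = ENNReal.ofReal ‖z‖ := fun z => (ofReal_norm_eq_enorm z).symm
  set S₁ : ℝ≥0∞ := ⨆ (x : EuclideanSpace ℝ (Fin k)) (_ : x ∈ Ω), (‖𝒦 x‖₊ : ℝ≥0∞) with hS₁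
  set S₂ : ℝ≥0∞ := (⨆ (x : EuclideanSpace ℝ (Fin k)) (y : EuclideanSpace ℝ (Fin k))
                (_ : x ∈ Ω) (_ : y ∈ Ω)
                (_ : dist x y ≤ (q : ℝ) * Real.sqrt k),
                (‖𝒦 x - 𝒦 y‖₊ : ℝ≥0∞)) with hS₂
  have hS₁t : S₁ ≠ ∞ := by
    refine ne_top_of_le_ne_top (ENNReal.ofReal_ne_top (r := B₀)) ?_
    refine iSup_le fun x => iSup_le fun _ => ?_
    rw [hnn]; exact ENNReal.ofReal_le_ofReal (hB₀ x)
  have hS₂t : S₂ ≠ ∞ := by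
    refine ne_top_of_le_ne_top (ENNReal.ofReal_ne_top (r := B₀ + B₀)) ?_
    refine iSup_le fun x => iSup_le fun y => iSup_le fun _ => iSup_le fun _ => iSup_le fun _ => ?_
    rw [hnn]
    exact ENNReal.ofReal_le_ofReal ((norm_sub_le _ _).trans (add_le_add (hB₀ x) (hB₀ y)))
  have hB : ∀ x, ‖𝒦 x‖ ≤ S₁.toReal := by
    intro x
    by_cases hx : x ∈ Ω
    · have : ENNReal.ofReal ‖𝒦 x‖ ≤ S₁ := by
        rw [← hnn]
        exact le_iSup₂ (f := fun (x : EuclideanSpace ℝ (Fin k)) (_ : x ∈ Ω) => (‖𝒦 x‖₊ : ℝ≥0∞)) x hx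
      exact (ENNReal.ofReal_le_iff_le_toReal hS₁t).1 this
    · rw [hz x hx, norm_zero]; exact ENNReal.toReal_nonneg
  have hω : ∀ x ∈ Ω, ∀ y ∈ Ω, dist x y ≤ (q:ℝ) * Real.sqrt k → ‖𝒦 x - 𝒦 y‖ ≤ S₂.toReal := by
    intro x hx y hy hd
    have : ENNReal.ofReal ‖𝒦 x - 𝒦 y‖ ≤ S₂ := by
      rw [← hnn, hS₂]
      refine le_trans ?_ (le_iSup _ x)
      refine le_trans ?_ (le_iSup _ y)
      refine le_trans ?_ (le_iSup _ hx)
      refine le_trans ?_ (le_iSup _ hy)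
      exact le_iSup (fun _ : dist x y ≤ (q:ℝ) * Real.sqrt k => (‖𝒦 x - 𝒦 y‖₊ : ℝ≥0∞)) hd
    exact (ENNReal.ofReal_le_iff_le_toReal hS₂t).1 this
  have hmain := h N hN Ω hΩ 𝒦 Kc hz q hq1 hq a θ S₁.toReal S₂.toReal hB ENNReal.toReal_nonneg hω
  have hT0 : 0 ≤ ∑ γ ∈ Γ, |θ γ| * (N : ℝ) ^ ((∑ i, γ i : ℕ) : ℝ) := Finset.sum_nonneg fun _ _ => by positivity
  have e1 : S₁ = ENNReal.ofReal S₁.toReal := (ENNReal.ofReal_toReal hS₁t).symm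
  have e2 : S₂ = ENNReal.ofReal S₂.toReal := (ENNReal.ofReal_toReal hS₂t).symm
  have hb0 : 0 ≤ S₁.toReal := ENNReal.toReal_nonneg
  have hw0 : 0 ≤ S₂.toReal := ENNReal.toReal_nonneg
  rw [hnn, e1, e2, ← ENNReal.ofReal_mul (by positivity), ← ENNReal.ofReal_mul (by positivity),
    ← ENNReal.ofReal_add (by positivity) (by positivity), ← ENNReal.ofReal_mul hC.le,
    ← ENNReal.ofReal_mul (by positivity)]
  exact ENNReal.ofReal_le_ofReal hmain
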